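/- Let N ≥ 2 and 1 < α < N. There exists a constant C = C(N, α) > 0 such that for every measurable set E ⊆ ℝ^N with |E| = ω_N one has δ(E) ≤ C·√(D(E)). -/

import Mathlib

open MeasureTheory Metric
open scoped symmDiff

noncomputable def rieszEnergy (N : ℕ) (α : ℝ) (E : Set (EuclideanSpace ℝ (Fin N))) : ℝ :=
  ∫ x in E, ∫ y in E, ‖y - x‖ ^ (α - (N : ℝ))

noncomputable def deficit (N : ℕ) (α : ℝ) (E : Set (EuclideanSpace ℝ (Fin N))) : ℝ :=
  rieszEnergy N α (ball (0 : EuclideanSpace ℝ (Fin N)) 1) - rieszEnergy N α E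

noncomputable def asymmetry (N : ℕ) (E : Set (EuclideanSpace ℝ (Fin N))) : ℝ :=
  ⨅ x : EuclideanSpace ℝ (Fin N), (volume (ball x 1 ∆ E)).toReal

set_option linter.unusedSectionVars false

namespace RieszStability

variable {V : Type*} [NormedAddCommGroup V] [InnerProductSpace ℝ V] [FiniteDimensional ℝ V]
  [MeasurableSpace V] [BorelSpace V]

/-- A nonnegative radially nonincreasing profile whose radial extension to `V` is locally
integrable. -/
structure RadialKernel (V : Type*) [NormedAddCommGroup V] [InnerProductSpace ℝ V]
    [FiniteDimensional ℝ V] [MeasurableSpace V] [BorelSpace V] (k : ℝ → ℝ) : Prop where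
  measurable : Measurable k
  nonneg : ∀ r, 0 ≤ k r
  antitone : AntitoneOn k (Set.Ioi 0)
  integrableOn : IntegrableOn (fun x : V => k ‖x‖) (ball 0 1)

/-- The potential at `x` generated by the set `T`. -/
noncomputable def pot (k : ℝ → ℝ) (T : Set V) (x : V) : ℝ := ∫ y in T, k ‖y - x‖

/-- The mutual energy of two sets. -/
noncomputable def cross (k : ℝ → ℝ) (S T : Set V) : ℝ := ∫ x in S, pot k T x

variable {k : ℝ → ℝ}

namespace RadialKernel

lemma measurable_shift (hk : RadialKernel V k) (x : V) : Measurable fun y : V => k ‖y - x‖ :=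
  hk.measurable.comp (by fun_prop)

lemma integrableOn_ball (hk : RadialKernel V k) (x : V) :
    IntegrableOn (fun y : V => k ‖y - x‖) (ball x 1) := by
  have h := (measurePreserving_sub_right (volume : Measure V) x).integrableOn_comp_preimage
    (MeasurableEquiv.subRight x).measurableEmbedding (f := fun z : V => k ‖z‖) (s := ball 0 1)
  have e : (fun y : V => y - x) ⁻¹' ball 0 1 = ball x 1 := by
    ext y; simp [dist_eq_norm]
  have := h.2 hk.integrableOn
  rw [e] at this
  exact this

lemma le_one (hk : RadialKernel V k) {r : ℝ} (hr : 1 ≤ r) : k r ≤ k 1 :=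
  hk.antitone (by simp) (by simp; linarith) hr

lemma integrableOn_shift (hk : RadialKernel V k) {T : Set V} (hT : volume T ≠ ⊤) (x : V) :
    IntegrableOn (fun y : V => k ‖y - x‖) T := by
  have h1 : IntegrableOn (fun y : V => k ‖y - x‖) (T ∩ ball x 1) :=
    (hk.integrableOn_ball x).mono_set Set.inter_subset_right
  have h2 : IntegrableOn (fun y : V => k ‖y - x‖) (T \ ball x 1) := by
    have hfin : volume (T \ ball x 1) ≠ ⊤ := measure_ne_top_of_subset Set.sdiff_subset hT
    have : IntegrableOn (fun y : V => k ‖y - x‖) (toMeasurable volume T \ ball x 1) := by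
      refine Measure.integrableOn_of_bounded (M := k 1) ?_
        (hk.measurable_shift x).aestronglyMeasurable ?_
      · exact measure_ne_top_of_subset Set.sdiff_subset (by rwa [measure_toMeasurable])
      · refine (ae_restrict_mem ((measurableSet_toMeasurable _ _).diff measurableSet_ball)).mono ?_
        intro y hy
        rw [Real.norm_of_nonneg (hk.nonneg _)]
        apply hk.le_one
        simpa [dist_eq_norm] using hy.2
    exact this.mono_set (Set.sdiff_subset_sdiff_left (subset_toMeasurable _ _))
  simpa [Set.inter_union_sdiff] using h1.union h2

lemma pot_nonneg (hk : RadialKernel V k) (T : Set V) (x : V) : 0 ≤ pot k T x :=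
  integral_nonneg fun _ => hk.nonneg _

lemma pot_union (hk : RadialKernel V k) {S T : Set V} (hTm : MeasurableSet T)
    (hS : volume S ≠ ⊤) (hT : volume T ≠ ⊤) (h : Disjoint S T) (x : V) :
    pot k (S ∪ T) x = pot k S x + pot k T x :=
  setIntegral_union h hTm (hk.integrableOn_shift hS x) (hk.integrableOn_shift hT x)

lemma pot_le (hk : RadialKernel V k) {T : Set V} (hTm : MeasurableSet T) (hT : volume T ≠ ⊤)
    (x : V) :
    pot k T x ≤ (∫ z in ball (0 : V) 1 ∩ (fun z => z + x) ⁻¹' T, k ‖z‖)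
      + k 1 * volume.real T := by
  have h0 : pot k T x = (∫ y in T ∩ ball x 1, k ‖y - x‖) + ∫ y in T \ ball x 1, k ‖y - x‖ :=
    (integral_inter_add_sdiff measurableSet_ball (hk.integrableOn_shift hT x)).symm
  rw [h0]
  refine add_le_add (le_of_eq ?_) ?_
  · have h := (measurePreserving_add_right (volume : Measure V) x).setIntegral_preimage_emb
      (MeasurableEquiv.addRight x).measurableEmbedding (fun y : V => k ‖y - x‖) (T ∩ ball x 1)
    rw [← h]
    have e : (fun z : V => z + x) ⁻¹' (T ∩ ball x 1) = ball 0 1 ∩ (fun z => z + x) ⁻¹' T := by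
      ext z; simp [dist_eq_norm, and_comm]
    rw [e]; simp
  · have hd : volume (T \ ball x 1) ≠ ⊤ := measure_ne_top_of_subset Set.sdiff_subset hT
    calc ∫ y in T \ ball x 1, k ‖y - x‖ ≤ ∫ y in T \ ball x 1, k 1 := by
          refine setIntegral_mono_on (hk.integrableOn_shift hd x)
            (integrableOn_const hd) (hTm.diff measurableSet_ball) ?_
          intro y hy
          apply hk.le_one
          simpa [dist_eq_norm] using hy.2
      _ = k 1 * volume.real (T \ ball x 1) := by simp [mul_comm]
      _ ≤ k 1 * volume.real T :=
          mul_le_mul_of_nonneg_left (measureReal_mono Set.sdiff_subset hT) (hk.nonneg 1)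

/-- A uniform bound for the potential of a set of measure at most `m`. -/
lemma exists_pot_le (hk : RadialKernel V k) (m : ℝ) : ∃ M : ℝ, 0 < M ∧ ∀ T : Set V,
    MeasurableSet T → volume T ≠ ⊤ → volume.real T ≤ m → ∀ x, pot k T x ≤ M := by
  refine ⟨(∫ z in ball (0 : V) 1, k ‖z‖) + k 1 * |m| + 1, ?_, fun T hTm hT hm x => ?_⟩
  · have : 0 ≤ ∫ z in ball (0 : V) 1, k ‖z‖ := integral_nonneg fun _ => hk.nonneg _
    have := mul_nonneg (hk.nonneg 1) (abs_nonneg m)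
    linarith
  · have h1 := hk.pot_le hTm hT x
    have h2 : (∫ z in ball (0 : V) 1 ∩ (fun z => z + x) ⁻¹' T, k ‖z‖) ≤
        ∫ z in ball (0 : V) 1, k ‖z‖ :=
      setIntegral_mono_set hk.integrableOn (ae_of_all _ fun _ => hk.nonneg _)
        (ae_of_all _ Set.inter_subset_left)
    have h3 := mul_le_mul_of_nonneg_left (hm.trans (le_abs_self m)) (hk.nonneg 1)
    linarith

/-- Sets of small measure generate uniformly small potentials. -/
lemma exists_pot_small (hk : RadialKernel V k) {ε : ℝ} (hε : 0 < ε) : ∃ δ : ℝ, 0 < δ ∧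
    ∀ T : Set V, MeasurableSet T → volume T ≠ ⊤ → volume.real T ≤ δ → ∀ x, pot k T x ≤ ε := by
  have hfin : ∫⁻ z in ball (0 : V) 1, ENNReal.ofReal (k ‖z‖) ≠ ⊤ := by
    have := hk.integrableOn.2
    rw [hasFiniteIntegral_iff_ofReal (ae_of_all _ fun _ => hk.nonneg _)] at this
    exact this.ne
  obtain ⟨δ, hδ, H⟩ := exists_pos_setLIntegral_lt_of_measure_lt hfin
    (ε := ENNReal.ofReal (ε / 2)) (by simp [hε])
  obtain ⟨δ', hδ', hlt⟩ : ∃ δ' : ℝ, 0 < δ' ∧ ENNReal.ofReal δ' < δ := by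
    rcases eq_or_ne δ ⊤ with rfl | hne
    · exact ⟨1, one_pos, by simp⟩
    · refine ⟨δ.toReal / 2, half_pos (ENNReal.toReal_pos hδ.ne' hne), ?_⟩
      rw [ENNReal.ofReal_lt_iff_lt_toReal (by positivity) hne]
      exact half_lt_self (ENNReal.toReal_pos hδ.ne' hne)
  refine ⟨min δ' (ε / 2 / (k 1 + 1)), ?_, fun T hTm hT hm x => ?_⟩
  · have := hk.nonneg 1
    positivity
  have h1 := hk.pot_le hTm hT x
  have hpre : volume ((fun z : V => z + x) ⁻¹' T) = volume T :=
    (measurePreserving_add_right volume x).measure_preimage hTm.nullMeasurableSet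
  have h2 : (∫ z in ball (0 : V) 1 ∩ (fun z => z + x) ⁻¹' T, k ‖z‖) ≤ ε / 2 := by
    rw [integral_eq_lintegral_of_nonneg_ae (ae_of_all _ fun _ => hk.nonneg _)
      (hk.measurable.comp measurable_norm).aestronglyMeasurable]
    refine ENNReal.toReal_le_of_le_ofReal (by positivity) (le_of_lt ?_)
    have := H ((fun z => z + x) ⁻¹' T) (by
      refine (Measure.restrict_apply_le _ _).trans_lt ?_
      rw [hpre]
      refine lt_of_le_of_lt ?_ hlt
      rw [← ENNReal.ofReal_toReal hT]
      exact ENNReal.ofReal_le_ofReal (hm.trans (min_le_left _ _)))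
    rwa [Measure.restrict_restrict' measurableSet_ball, Set.inter_comm] at this
  have h3 : k 1 * volume.real T ≤ ε / 2 := by
    have hk1 := hk.nonneg 1
    have h4 : volume.real T ≤ ε / 2 / (k 1 + 1) := hm.trans (min_le_right _ _)
    rw [le_div_iff₀ (by positivity)] at h4
    nlinarith [measureReal_nonneg (μ := (volume : Measure V)) (s := T)]
  linarith

lemma stronglyMeasurable_pot (hk : RadialKernel V k) (T : Set V) :
    StronglyMeasurable (pot k T) := by
  have : Measurable fun p : V × V => k ‖p.2 - p.1‖ := hk.measurable.comp (by fun_prop)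
  exact this.stronglyMeasurable.integral_prod_right (ν := volume.restrict T)

lemma integrableOn_pot (hk : RadialKernel V k) {S T : Set V} (hTm : MeasurableSet T)
    (hS : volume S ≠ ⊤) (hT : volume T ≠ ⊤) : IntegrableOn (pot k T) S := by
  obtain ⟨M, -, hM⟩ := hk.exists_pot_le (V := V) (volume.real T)
  refine Measure.integrableOn_of_bounded (M := M) hS
    (hk.stronglyMeasurable_pot T).aestronglyMeasurable (ae_of_all _ fun x => ?_)
  rw [Real.norm_of_nonneg (hk.pot_nonneg T x)]
  exact hM T hTm hT le_rfl x

lemma integrable_prod (hk : RadialKernel V k) {S T : Set V} (hTm : MeasurableSet T)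
    (hS : volume S ≠ ⊤) (hT : volume T ≠ ⊤) :
    Integrable (fun p : V × V => k ‖p.2 - p.1‖)
      ((volume.restrict S).prod (volume.restrict T)) := by
  have hm : Measurable fun p : V × V => k ‖p.2 - p.1‖ := hk.measurable.comp (by fun_prop)
  rw [integrable_prod_iff hm.aestronglyMeasurable]
  refine ⟨ae_of_all _ fun x => hk.integrableOn_shift hT x, ?_⟩
  simp only [Real.norm_of_nonneg (hk.nonneg _)]
  exact hk.integrableOn_pot hTm hS hT

lemma cross_comm (hk : RadialKernel V k) {S T : Set V} (hTm : MeasurableSet T)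
    (hS : volume S ≠ ⊤) (hT : volume T ≠ ⊤) : cross k S T = cross k T S := by
  have := integral_integral_swap (f := fun x y : V => k ‖y - x‖) (hk.integrable_prod hTm hS hT)
  simp only [cross, pot]
  rw [this]
  simp only [norm_sub_rev]

lemma cross_union_left (hk : RadialKernel V k) {S S' T : Set V} (hSm : MeasurableSet S')
    (hTm : MeasurableSet T) (hS : volume S ≠ ⊤) (hS' : volume S' ≠ ⊤) (hT : volume T ≠ ⊤)
    (h : Disjoint S S') : cross k (S ∪ S') T = cross k S T + cross k S' T :=
  setIntegral_union h hSm (hk.integrableOn_pot hTm hS hT) (hk.integrableOn_pot hTm hS' hT)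

lemma cross_union_right (hk : RadialKernel V k) {S T T' : Set V} (hTm : MeasurableSet T)
    (hTm' : MeasurableSet T') (hS : volume S ≠ ⊤) (hT : volume T ≠ ⊤) (hT' : volume T' ≠ ⊤)
    (h : Disjoint T T') : cross k S (T ∪ T') = cross k S T + cross k S T' := by
  simp only [cross, hk.pot_union hTm' hT hT' h]
  exact integral_add (hk.integrableOn_pot hTm hS hT) (hk.integrableOn_pot hTm' hS hT')

/-- Exchanging `Q ⊆ E` for `P` outside `E` changes the energy by the difference of the integrals
of the sum of the two potentials. -/
lemma cross_sub_cross (hk : RadialKernel V k) {E E' : Set V} (hE : MeasurableSet E)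
    (hE' : MeasurableSet E') (hf : volume E ≠ ⊤) (hf' : volume E' ≠ ⊤) :
    cross k E' E' - cross k E E = (∫ x in E' \ E, (pot k E x + pot k E' x))
      - ∫ x in E \ E', (pot k E x + pot k E' x) := by
  set C := E ∩ E' with hC
  set P := E' \ E with hP
  set Q := E \ E' with hQ
  have hCm : MeasurableSet C := hE.inter hE'
  have hPm : MeasurableSet P := hE'.diff hE
  have hQm : MeasurableSet Q := hE.diff hE'
  have fC : volume C ≠ ⊤ := measure_ne_top_of_subset Set.inter_subset_left hf
  have fP : volume P ≠ ⊤ := measure_ne_top_of_subset Set.sdiff_subset hf'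
  have fQ : volume Q ≠ ⊤ := measure_ne_top_of_subset Set.sdiff_subset hf
  have dP : Disjoint C P := Set.disjoint_left.2 fun x hx hx' => hx'.2 hx.1
  have dQ : Disjoint C Q := Set.disjoint_left.2 fun x hx hx' => hx'.2 hx.2
  have eE : E = C ∪ Q := (Set.inter_union_sdiff E E').symm
  have eE' : E' = C ∪ P := by rw [hC, hP, Set.inter_comm]; exact (Set.inter_union_sdiff E' E).symm
  have hI : ∀ {S : Set V}, volume S ≠ ⊤ → (∫ x in S, (pot k E x + pot k E' x)) =
      cross k S E + cross k S E' := fun hS =>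
    integral_add (hk.integrableOn_pot hE hS hf) (hk.integrableOn_pot hE' hS hf')
  rw [hI fP, hI fQ, eE, eE']
  rw [hk.cross_union_right hCm hPm (by rw [← eE']; exact hf') fC fP dP,
    hk.cross_union_right hCm hQm (by rw [← eE]; exact hf) fC fQ dQ,
    hk.cross_union_right hCm hQm fP fC fQ dQ, hk.cross_union_right hCm hPm fP fC fP dP,
    hk.cross_union_right hCm hQm fQ fC fQ dQ, hk.cross_union_right hCm hPm fQ fC fP dP,
    hk.cross_union_left hPm hCm fC fP fC dP, hk.cross_union_left hPm hPm fC fP fP dP,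
    hk.cross_union_left hQm hCm fC fQ fC dQ, hk.cross_union_left hQm hQm fC fQ fQ dQ,
    hk.cross_comm hPm fC fP, hk.cross_comm hQm fC fQ, hk.cross_comm hPm fQ fP]
  ring

end RadialKernel

/-- Reflection in the hyperplane `{x | ⟪x, e⟫ = t}`, for a unit vector `e`. -/
noncomputable def refl (e : V) (t : ℝ) (x : V) : V := x + (2 * (t - inner ℝ x e)) • e

section Refl

variable {e : V} (he : ‖e‖ = 1) (t : ℝ)

lemma continuous_refl (e : V) (t : ℝ) : Continuous (refl e t) := by
  unfold refl; fun_prop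

include he

lemma inner_refl (x : V) : inner ℝ (refl e t x) e = 2 * t - inner ℝ x e := by
  simp only [refl, inner_add_left, inner_smul_left, real_inner_self_eq_norm_sq, he]
  simp; ring

lemma refl_refl (x : V) : refl e t (refl e t x) = x := by
  have h := inner_refl he t x
  conv_lhs => rw [refl, h]
  rw [refl, add_assoc, ← add_smul]
  have : 2 * (t - inner ℝ x e) + 2 * (t - (2 * t - inner ℝ x e)) = 0 := by ring
  simp [this]

lemma norm_sub_refl_sq (x y : V) : ‖y - refl e t x‖ ^ 2 =
    ‖y - x‖ ^ 2 + 4 * (t - inner ℝ x e) * (t - inner ℝ y e) := by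
  have : y - refl e t x = (y - x) - (2 * (t - inner ℝ x e)) • e := by simp [refl, sub_sub]
  rw [this, norm_sub_sq_real, inner_smul_right, norm_smul, he, inner_sub_left, mul_one,
    Real.norm_eq_abs, sq_abs]
  ring

lemma norm_refl_sub_refl (x y : V) : ‖refl e t y - refl e t x‖ = ‖y - x‖ := by
  have h := norm_sub_refl_sq he t x (refl e t y)
  rw [inner_refl he, norm_sub_rev _ x, norm_sub_refl_sq he t y x, norm_sub_rev x y] at h
  rw [← sq_eq_sq₀ (norm_nonneg _) (norm_nonneg _), h]
  ring

lemma norm_sub_refl_comm (x y : V) : ‖y - refl e t x‖ = ‖refl e t y - x‖ := by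
  rw [← norm_refl_sub_refl he t x, refl_refl he]

lemma norm_refl_sq (x : V) : ‖refl e t x‖ ^ 2 = ‖x‖ ^ 2 + 4 * t * (t - inner ℝ x e) := by
  have h := norm_sub_refl_sq he t x 0
  simp only [zero_sub, norm_neg, inner_zero_left, sub_zero] at h
  rw [h]; ring

lemma measurePreserving_refl : MeasurePreserving (refl e t) (volume : Measure V) volume := by
  have h1 := ((ℝ ∙ e)ᗮ.reflection).measurePreserving
  have h2 := measurePreserving_add_right (volume : Measure V) ((2 * t) • e)
  have h : refl e t = (fun x => x + (2 * t) • e) ∘ ((ℝ ∙ e)ᗮ.reflection) := by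
    funext x
    have hc : inner ℝ e x = inner ℝ x e := real_inner_comm x e
    simp only [Function.comp, Submodule.reflection_orthogonal_apply,
      Submodule.reflection_singleton_apply, he, refl, hc]
    simp
    module
  rw [h]
  exact h2.comp h1

lemma measurableEmbedding_refl : MeasurableEmbedding (refl e t : V → V) :=
  (continuous_refl e t).measurableEmbedding (Function.LeftInverse.injective (refl_refl he t))

lemma volume_preimage_refl {S : Set V} (hS : MeasurableSet S) :
    volume (refl e t ⁻¹' S) = volume S :=
  (measurePreserving_refl he t).measure_preimage hS.nullMeasurableSet

lemma setIntegral_preimage_refl (f : V → ℝ) (S : Set V) :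
    ∫ x in refl e t ⁻¹' S, f (refl e t x) = ∫ x in S, f x :=
  (measurePreserving_refl he t).setIntegral_preimage_emb (measurableEmbedding_refl he t) f S

lemma pot_preimage_refl (T : Set V) (x : V) :
    pot k (refl e t ⁻¹' T) x = pot k T (refl e t x) := by
  simp only [pot]
  rw [← setIntegral_preimage_refl he t (fun y => k ‖y - refl e t x‖) T]
  simp only [norm_refl_sub_refl he]

lemma cross_preimage_refl (S T : Set V) :
    cross k (refl e t ⁻¹' S) (refl e t ⁻¹' T) = cross k S T := by
  simp only [cross]
  rw [← setIntegral_preimage_refl he t (pot k T) S]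
  have h : pot k (refl e t ⁻¹' T) = fun x => pot k T (refl e t x) :=
    funext fun x => pot_preimage_refl he t T x
  rw [h]

end Refl

/-- The points of the half-space `{⟪x, e⟫ < t}` lying in `E` whose mirror image is not in `E`. -/
def keepSet (e : V) (t : ℝ) (E : Set V) : Set V :=
  {x | inner ℝ x e < t ∧ x ∈ E ∧ refl e t x ∉ E}

/-- The points of the half-space `{⟪x, e⟫ < t}` outside `E` whose mirror image is in `E`. -/
def gainSet (e : V) (t : ℝ) (E : Set V) : Set V :=
  {x | inner ℝ x e < t ∧ x ∉ E ∧ refl e t x ∈ E}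

/-- The polarization of `E` towards the half-space `{⟪x, e⟫ < t}`. -/
def polarize (e : V) (t : ℝ) (E : Set V) : Set V :=
  (E \ refl e t ⁻¹' gainSet e t E) ∪ gainSet e t E

section Polarize

variable {e : V} (he : ‖e‖ = 1) (t : ℝ) {E : Set V}

lemma measurableSet_halfSpace (e : V) : MeasurableSet {x : V | inner ℝ x e < t} :=
  measurableSet_lt (by fun_prop) measurable_const

lemma measurableSet_keepSet (hE : MeasurableSet E) : MeasurableSet (keepSet e t E) :=
  (measurableSet_halfSpace t e).inter
    (hE.inter ((continuous_refl e t).measurable hE).compl)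

lemma measurableSet_gainSet (hE : MeasurableSet E) : MeasurableSet (gainSet e t E) :=
  (measurableSet_halfSpace t e).inter
    (hE.compl.inter ((continuous_refl e t).measurable hE))

lemma measurableSet_preimage_gainSet (hE : MeasurableSet E) :
    MeasurableSet (refl e t ⁻¹' gainSet e t E) :=
  (continuous_refl e t).measurable (measurableSet_gainSet t hE)

lemma measurableSet_polarize (hE : MeasurableSet E) : MeasurableSet (polarize e t E) :=
  (hE.diff (measurableSet_preimage_gainSet t hE)).union (measurableSet_gainSet t hE)

lemma disjoint_gainSet (E : Set V) : Disjoint E (gainSet e t E) :=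
  Set.disjoint_left.2 fun _ hx hx' => hx'.2.1 hx

include he

lemma preimage_gainSet_subset : refl e t ⁻¹' gainSet e t E ⊆ E := fun x hx => by
  simpa only [refl_refl he] using hx.2.2

lemma volume_polarize (hE : MeasurableSet E) :
    volume (polarize e t E) = volume E := by
  have hG := measurableSet_gainSet (e := e) t hE
  have hG' := measurableSet_preimage_gainSet (e := e) t hE
  rw [polarize, measure_union ((disjoint_gainSet t E).mono_left Set.sdiff_subset) hG,
    ← volume_preimage_refl he t hG]
  have h := measure_sdiff_add_inter (μ := (volume : Measure V)) E hG'
  rwa [Set.inter_eq_self_of_subset_right (preimage_gainSet_subset he t)] at h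

/-- The part of `E` symmetric under the reflection. -/
lemma symmetric_part :
    refl e t ⁻¹' ((E \ refl e t ⁻¹' gainSet e t E) \ keepSet e t E) =
      (E \ refl e t ⁻¹' gainSet e t E) \ keepSet e t E := by
  ext x
  have h1 := inner_refl he t x
  simp only [Set.mem_preimage, Set.mem_sdiff, keepSet, gainSet, Set.mem_ofPred_eq, refl_refl he, h1]
  rcases lt_trichotomy (inner ℝ x e) t with h | h | h
  · have h2 : ¬ (2 * t - inner ℝ x e < t) := by linarith
    simp only [h, h2]; tauto
  · have h3 : refl e t x = x := by simp [refl, h]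
    simp [h3, h]
  · have h2 : (2 * t - inner ℝ x e < t) := by linarith
    have h4 : ¬ (inner ℝ x e < t) := by linarith
    simp only [h4, h2]; tauto

lemma keepSet_subset_diff : keepSet e t E ⊆ E \ refl e t ⁻¹' gainSet e t E := fun x hx =>
  ⟨hx.2.1, fun h => by
    have := h.1
    rw [inner_refl he] at this
    linarith [hx.1]⟩

lemma polarize_decomp : E = ((E \ refl e t ⁻¹' gainSet e t E) \ keepSet e t E) ∪ keepSet e t E
    ∪ refl e t ⁻¹' gainSet e t E := by
  rw [Set.sdiff_union_of_subset (keepSet_subset_diff he t),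
    Set.sdiff_union_of_subset (preimage_gainSet_subset he t)]

/-- The gain in energy under polarization. -/
lemma cross_polarize_sub (hk : RadialKernel V k) (hE : MeasurableSet E) (hf : volume E ≠ ⊤) :
    cross k (polarize e t E) (polarize e t E) - cross k E E =
      2 * ∫ x in keepSet e t E, ∫ y in gainSet e t E, (k ‖y - x‖ - k ‖y - refl e t x‖) := by
  set A := keepSet e t E with hA
  set G := gainSet e t E with hG
  set B := refl e t ⁻¹' G with hB
  have mA : MeasurableSet A := measurableSet_keepSet t hE
  have mG : MeasurableSet G := measurableSet_gainSet t hE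
  have mB : MeasurableSet B := measurableSet_preimage_gainSet t hE
  have BE : B ⊆ E := preimage_gainSet_subset he t
  have fA : volume A ≠ ⊤ := measure_ne_top_of_subset (fun x hx => hx.2.1) hf
  have fB : volume B ≠ ⊤ := measure_ne_top_of_subset BE hf
  have fG : volume G ≠ ⊤ := by rwa [← volume_preimage_refl he t mG]
  set U := E \ B with hU
  set S := U \ A with hS
  have mU : MeasurableSet U := hE.diff mB
  have fU : volume U ≠ ⊤ := measure_ne_top_of_subset Set.sdiff_subset hf
  have mS : MeasurableSet S := mU.diff mA
  have fS : volume S ≠ ⊤ := measure_ne_top_of_subset Set.sdiff_subset fU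
  have eU : U = S ∪ A := (Set.sdiff_union_of_subset (keepSet_subset_diff he t)).symm
  have eE : E = U ∪ B := (Set.sdiff_union_of_subset BE).symm
  have dUG : Disjoint U G := (disjoint_gainSet t E).mono_left Set.sdiff_subset
  have dUB : Disjoint U B := Set.disjoint_sdiff_left
  have dSA : Disjoint S A := Set.disjoint_sdiff_left
  have key : ∀ X : Set V, MeasurableSet X → volume X ≠ ⊤ → Disjoint U X →
      cross k (U ∪ X) (U ∪ X) = cross k U U + 2 * cross k U X + cross k X X := by
    intro X mX fX d
    rw [hk.cross_union_left mX (mU.union mX) fU fX (by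
        exact ne_of_lt ((measure_union_le _ _).trans_lt (ENNReal.add_lt_top.2
          ⟨fU.lt_top, fX.lt_top⟩))) d,
      hk.cross_union_right mU mX fU fU fX d, hk.cross_union_right mU mX fX fU fX d,
      hk.cross_comm mU fX fU]
    ring
  have e1 : polarize e t E = U ∪ G := rfl
  have hSS : refl e t ⁻¹' S = S := symmetric_part he t
  have e2 : cross k U G = cross k S G + cross k A G := by
    rw [eU]; exact hk.cross_union_left mA mG fS fA fG dSA
  have e3 : cross k U B = cross k S B + cross k A B := by
    rw [eU]; exact hk.cross_union_left mA mB fS fA fB dSA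
  have e4 : cross k S B = cross k S G := by
    rw [← cross_preimage_refl he t S G, hSS]
  have e5 : cross k B B = cross k G G := cross_preimage_refl he t G G
  have e6 : (∫ x in A, ∫ y in G, (k ‖y - x‖ - k ‖y - refl e t x‖)) = cross k A G - cross k A B := by
    have : ∀ x, ∫ y in G, (k ‖y - x‖ - k ‖y - refl e t x‖) = pot k G x - pot k B x := by
      intro x
      rw [pot_preimage_refl he]
      exact integral_sub (hk.integrableOn_shift fG x) (hk.integrableOn_shift fG _)
    simp only [this]
    exact integral_sub (hk.integrableOn_pot mG fA fG) (hk.integrableOn_pot mB fA fB)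
  have e7 : cross k E E = cross k (U ∪ B) (U ∪ B) := by rw [← eE]
  rw [e1, e7, key G mG fG dUG, key B mB fB dUB, e2, e3, e4, e5, e6]
  ring

lemma norm_sub_le_norm_sub_refl {x y : V} (hx : inner ℝ x e < t) (hy : inner ℝ y e < t) :
    ‖y - x‖ ≤ ‖y - refl e t x‖ := by
  have := norm_sub_refl_sq he t x y
  rw [← sq_le_sq₀ (norm_nonneg _) (norm_nonneg _), this]
  nlinarith [mul_pos (sub_pos.2 hx) (sub_pos.2 hy)]

lemma kernel_refl_le (hk : RadialKernel V k) {x y : V} (hx : inner ℝ x e < t)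
    (hy : inner ℝ y e < t) (hxy : y ≠ x) : k ‖y - refl e t x‖ ≤ k ‖y - x‖ := by
  have h0 : 0 < ‖y - x‖ := norm_pos_iff.2 (sub_ne_zero.2 hxy)
  have h1 := norm_sub_le_norm_sub_refl he t hx hy
  exact hk.antitone h0 (h0.trans_le h1) h1

lemma cross_le_polarize (hk : RadialKernel V k) (hE : MeasurableSet E) (hf : volume E ≠ ⊤) :
    cross k E E ≤ cross k (polarize e t E) (polarize e t E) := by
  rw [← sub_nonneg, cross_polarize_sub he t hk hE hf]
  refine mul_nonneg zero_le_two (setIntegral_nonneg (measurableSet_keepSet t hE) fun x hx =>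
    setIntegral_nonneg (measurableSet_gainSet t hE) fun y hy => sub_nonneg.2 ?_)
  exact kernel_refl_le he t hk hx.1 hy.1 fun h => hy.2.1 (h ▸ hx.2.1)

lemma integrableOn_height {S : Set V} {R : ℝ} (hS : S ⊆ ball 0 R) :
    IntegrableOn (fun x : V => t - inner ℝ x e) S := by
  have : IntegrableOn (fun x : V => t - inner ℝ x e) (closedBall 0 R) :=
    ContinuousOn.integrableOn_compact (isCompact_closedBall _ _) (by fun_prop)
  exact this.mono_set (hS.trans ball_subset_closedBall)

/-- Quantitative gain under polarization of a bounded set. -/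
lemma polarize_gain (hk : RadialKernel V k) (hE : MeasurableSet E) {R c : ℝ}
    (hR : E ⊆ ball 0 R)
    (hc : ∀ a b : ℝ, 0 < a → a ≤ b → b ≤ 2 * R → c * (b ^ 2 - a ^ 2) ≤ k a - k b) :
    8 * c * (∫ x in keepSet e t E, (t - inner ℝ x e)) * (∫ y in gainSet e t E, (t - inner ℝ y e))
      ≤ cross k (polarize e t E) (polarize e t E) - cross k E E := by
  have hf : volume E ≠ ⊤ := measure_ne_top_of_subset hR measure_ball_lt_top.ne
  rw [cross_polarize_sub he t hk hE hf]
  set A := keepSet e t E with hA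
  set G := gainSet e t E with hG
  have mA : MeasurableSet A := measurableSet_keepSet t hE
  have mG : MeasurableSet G := measurableSet_gainSet t hE
  have AE : A ⊆ E := fun x hx => hx.2.1
  have fA : volume A ≠ ⊤ := measure_ne_top_of_subset AE hf
  have fG : volume G ≠ ⊤ := by
    rw [← volume_preimage_refl he t mG]
    exact measure_ne_top_of_subset (preimage_gainSet_subset he t) hf
  have mB : MeasurableSet (refl e t ⁻¹' G) := measurableSet_preimage_gainSet t hE
  have fB : volume (refl e t ⁻¹' G) ≠ ⊤ :=
    measure_ne_top_of_subset (preimage_gainSet_subset he t) hf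
  have iG : IntegrableOn (fun x : V => t - inner ℝ x e) G := by
    have h := ((measurePreserving_refl he t).integrableOn_comp_preimage
      (measurableEmbedding_refl he t) (f := fun x : V => t - inner ℝ x e) (s := G)).1
    apply h
    have : ((fun x : V => t - inner ℝ x e) ∘ refl e t) = fun x => -(t - inner ℝ x e) := by
      ext x; simp only [Function.comp, inner_refl he]; ring
    rw [this]
    exact (integrableOn_height he t ((preimage_gainSet_subset he t).trans hR)).neg
  have e0 : 8 * c * (∫ x in A, (t - inner ℝ x e)) * (∫ y in G, (t - inner ℝ y e)) =
      2 * ∫ x in A, ∫ y in G, 4 * c * (t - inner ℝ x e) * (t - inner ℝ y e) := by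
    simp only [integral_const_mul, integral_mul_const]
    ring
  rw [e0]
  refine mul_le_mul_of_nonneg_left ?_ zero_le_two
  refine setIntegral_mono_on ?_ ?_ mA fun x hx => ?_
  · simp only [integral_const_mul]
    exact ((integrableOn_height he t (AE.trans hR)).const_mul _).mul_const _
  · have : ∀ x, ∫ y in G, (k ‖y - x‖ - k ‖y - refl e t x‖) =
        pot k G x - pot k (refl e t ⁻¹' G) x := by
      intro x
      rw [pot_preimage_refl he]
      exact integral_sub (hk.integrableOn_shift fG x) (hk.integrableOn_shift fG _)
    simp only [this]
    exact (hk.integrableOn_pot mG fA fG).sub (hk.integrableOn_pot mB fA fB)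
  · refine setIntegral_mono_on (iG.const_mul _)
      ((hk.integrableOn_shift fG x).sub (hk.integrableOn_shift fG _)) mG fun y hy => ?_
    have hxy : y ≠ x := fun h => hy.2.1 (h ▸ hx.2.1)
    have h0 : 0 < ‖y - x‖ := norm_pos_iff.2 (sub_ne_zero.2 hxy)
    have h1 := norm_sub_le_norm_sub_refl he t hx.1 hy.1
    have h2 : ‖y - refl e t x‖ ≤ 2 * R := by
      rw [norm_sub_refl_comm he]
      have h3 : ‖refl e t y‖ < R := by simpa using hR hy.2.2
      have h4 : ‖x‖ < R := by simpa using hR hx.2.1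
      linarith [norm_sub_le (refl e t y) x]
    have h5 := hc _ _ h0 h1 h2
    rw [norm_sub_refl_sq he] at h5
    linarith

/-- The first moments of the two asymmetric parts differ by the first moment of `E`. -/
lemma moment_keepSet_sub_gainSet (hE : MeasurableSet E) {R : ℝ} (hR : E ⊆ ball 0 R) :
    (∫ x in keepSet e t E, (t - inner ℝ x e)) - (∫ y in gainSet e t E, (t - inner ℝ y e)) =
      ∫ x in E, (t - inner ℝ x e) := by
  set A := keepSet e t E with hA
  set G := gainSet e t E with hG
  set S := (E \ refl e t ⁻¹' G) \ A with hS
  have mA : MeasurableSet A := measurableSet_keepSet t hE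
  have mB : MeasurableSet (refl e t ⁻¹' G) := measurableSet_preimage_gainSet t hE
  have odd : ∀ X : Set V, ∫ x in refl e t ⁻¹' X, (t - inner ℝ x e) =
      - ∫ x in X, (t - inner ℝ x e) := by
    intro X
    rw [← setIntegral_preimage_refl he t _ X, ← integral_neg]
    congr 1; ext x; rw [inner_refl he]; ring
  have h1 : ∫ x in S, (t - inner ℝ x e) = 0 := by
    have := odd S
    rw [hS, symmetric_part he t] at this
    rw [hS]; linarith
  have eE : E = S ∪ A ∪ refl e t ⁻¹' G := polarize_decomp he t
  have sS : S ⊆ ball 0 R := (Set.sdiff_subset.trans Set.sdiff_subset).trans hR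
  have sA : A ⊆ ball 0 R := fun x hx => hR hx.2.1
  have sB : refl e t ⁻¹' G ⊆ ball 0 R := (preimage_gainSet_subset he t).trans hR
  have d1 : Disjoint (S ∪ A) (refl e t ⁻¹' G) := by
    rw [hS, Set.sdiff_union_of_subset (keepSet_subset_diff he t)]
    exact Set.disjoint_sdiff_left
  conv_rhs => rw [eE]
  rw [setIntegral_union d1 mB (integrableOn_height he t (Set.union_subset sS sA))
      (integrableOn_height he t sB),
    setIntegral_union Set.disjoint_sdiff_left mA (integrableOn_height he t sS)
      (integrableOn_height he t sA), h1, odd G]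
  ring

end Polarize

/-- Integration in polar coordinates. -/
lemma lintegral_polar [Nontrivial V] {f : V → ENNReal} (hf : Measurable f) :
    ∫⁻ x, f x = ∫⁻ θ : sphere (0 : V) 1, ∫⁻ r in Set.Ioi (0 : ℝ),
      ENNReal.ofReal (r ^ (Module.finrank ℝ V - 1)) * f (r • (θ : V))
        ∂volume ∂(volume : Measure V).toSphere := by
  have hm : Measurable fun p : sphere (0 : V) 1 × Set.Ioi (0 : ℝ) => f ((p.2 : ℝ) • (p.1 : V)) :=
    hf.comp (by fun_prop)
  calc ∫⁻ x, f x = ∫⁻ x in {(0 : V)}ᶜ, f x := by rw [restrict_compl_singleton]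
    _ = ∫⁻ x : ({(0 : V)}ᶜ : Set V), f x ∂(volume.comap Subtype.val) :=
        (lintegral_subtype_comap (measurableSet_singleton _).compl f).symm
    _ = ∫⁻ x : ({(0 : V)}ᶜ : Set V), (fun p : sphere (0 : V) 1 × Set.Ioi (0 : ℝ) =>
          f ((p.2 : ℝ) • (p.1 : V))) (homeomorphUnitSphereProd V x)
            ∂(volume.comap Subtype.val) := by
        refine lintegral_congr fun x => ?_
        have : (x : V) ≠ 0 := x.2
        congr 1
        simp [smul_smul, this]
    _ = _ := by
        rw [(Measure.measurePreserving_homeomorphUnitSphereProd (volume : Measure V)).lintegral_comp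
          hm, lintegral_prod _ hm.aemeasurable]
        refine lintegral_congr fun θ => ?_
        have hm' : Measurable fun r : Set.Ioi (0 : ℝ) => f ((r : ℝ) • (θ : V)) :=
          hf.comp (by fun_prop)
        refine (lintegral_withDensity_eq_lintegral_mul _ (by fun_prop) hm').trans ?_
        exact lintegral_subtype_comap measurableSet_Ioi
          (fun r : ℝ => ENNReal.ofReal (r ^ (Module.finrank ℝ V - 1)) * f (r • (θ : V)))

lemma volume_le_sections [Nontrivial V] {Q : Set V} (hQ : MeasurableSet Q) {R : ℝ}
    (hR : Q ⊆ ball 0 R) {x : V} (hx : ‖x‖ ≤ 1) :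
    volume Q ≤ ENNReal.ofReal ((R + 1) ^ (Module.finrank ℝ V - 1)) *
      ∫⁻ θ : sphere (0 : V) 1, volume {r : ℝ | 0 < r ∧ x + r • (θ : V) ∈ Q}
        ∂(volume : Measure V).toSphere := by
  have h1 : volume Q = ∫⁻ z : V, Q.indicator 1 (x + z) := by
    rw [lintegral_add_left_eq_self (fun z => Q.indicator (1 : V → ENNReal) z) x,
      lintegral_indicator_one hQ]
  have hm : Measurable fun z : V => Q.indicator (1 : V → ENNReal) (x + z) :=
    (measurable_one.indicator hQ).comp (by fun_prop)
  rw [h1, lintegral_polar hm, ← lintegral_const_mul' _ _ ENNReal.ofReal_ne_top]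
  refine lintegral_mono fun θ => ?_
  have hms : MeasurableSet {r : ℝ | x + r • (θ : V) ∈ Q} :=
    (show Measurable fun r : ℝ => x + r • (θ : V) by fun_prop) hQ
  calc ∫⁻ r in Set.Ioi (0 : ℝ), ENNReal.ofReal (r ^ (Module.finrank ℝ V - 1)) *
        Q.indicator (1 : V → ENNReal) (x + r • (θ : V))
      ≤ ∫⁻ r in Set.Ioi (0 : ℝ), ENNReal.ofReal ((R + 1) ^ (Module.finrank ℝ V - 1)) *
        {r : ℝ | x + r • (θ : V) ∈ Q}.indicator 1 r := by
        refine setLIntegral_mono' measurableSet_Ioi fun r hr => ?_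
        by_cases hQr : x + r • (θ : V) ∈ Q
        · have hθ : ‖(θ : V)‖ = 1 := by simp
          have h2 : ‖x + r • (θ : V)‖ < R := by simpa using hR hQr
          have h3 : r ≤ R + 1 := by
            have h4 : ‖r • (θ : V)‖ = r := by
              rw [norm_smul, hθ, mul_one, Real.norm_of_nonneg (le_of_lt hr)]
            have h5 : ‖r • (θ : V)‖ ≤ ‖x + r • (θ : V)‖ + ‖x‖ := by
              have := norm_sub_le (x + r • (θ : V)) x
              rwa [add_sub_cancel_left] at this
            linarith
          have h4 : r ^ (Module.finrank ℝ V - 1) ≤ (R + 1) ^ (Module.finrank ℝ V - 1) :=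
            pow_le_pow_left₀ (le_of_lt hr) h3 _
          simp only [Set.indicator_of_mem hQr, Set.indicator_of_mem
            (show r ∈ {r : ℝ | x + r • (θ : V) ∈ Q} from hQr), Pi.one_apply, mul_one]
          exact ENNReal.ofReal_le_ofReal h4
        · simp [Set.indicator_of_notMem hQr]
    _ = ENNReal.ofReal ((R + 1) ^ (Module.finrank ℝ V - 1)) *
        volume {r : ℝ | 0 < r ∧ x + r • (θ : V) ∈ Q} := by
        rw [lintegral_const_mul' _ _ ENNReal.ofReal_ne_top, lintegral_indicator_one hms,
          Measure.restrict_apply hms, Set.inter_comm]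
        rfl

/-- Among all hyperplanes there is one whose reflection carries a definite part of `P` to `Q`. -/
lemma exists_refl_overlap [Nontrivial V] (R : ℝ) (hR1 : 1 ≤ R) : ∃ C : ℝ, 0 < C ∧
    ∀ P Q : Set V, MeasurableSet P → MeasurableSet Q → P ⊆ ball 0 1 → Q ⊆ ball 0 R →
      ∃ (e : V) (t : ℝ), ‖e‖ = 1 ∧ volume.real P * volume.real Q ≤
        C * volume.real {x | x ∈ P ∧ inner ℝ x e < t ∧ refl e t x ∈ Q} := by
  set K : ℝ := (R + 1) ^ (Module.finrank ℝ V - 1) with hK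
  have hKpos : 0 < K := by positivity
  set s : ℝ := (volume : Measure V).toSphere.real Set.univ with hs
  have hs0 : 0 ≤ s := measureReal_nonneg
  refine ⟨8 * K * R * (s + 1), by positivity, fun P Q hP hQ hPs hQs => ?_⟩
  by_contra! hcon
  have fP : volume P ≠ ⊤ := measure_ne_top_of_subset hPs measure_ball_lt_top.ne
  have fQ : volume Q ≠ ⊤ := measure_ne_top_of_subset hQs measure_ball_lt_top.ne
  set m := volume.real P * volume.real Q with hm
  set ν := (volume : Measure V).toSphere.prod (volume.restrict (Set.Icc (-R) R)) with hν
  set W : Set ((sphere (0 : V) 1 × ℝ) × V) :=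
    {q | q.2 ∈ P ∧ inner ℝ q.2 (q.1.1 : V) < q.1.2 ∧ refl (q.1.1 : V) q.1.2 q.2 ∈ Q} with hW
  have hWm : MeasurableSet W := by
    have h1 : Measurable fun q : (sphere (0 : V) 1 × ℝ) × V => refl (q.1.1 : V) q.1.2 q.2 := by
      unfold refl
      exact Continuous.measurable (by fun_prop)
    have h2 : MeasurableSet {q : (sphere (0 : V) 1 × ℝ) × V | inner ℝ q.2 (q.1.1 : V) < q.1.2} :=
      measurableSet_lt (Continuous.measurable (by fun_prop)) (by fun_prop)
    exact (measurable_snd hP).inter (h2.inter (h1 hQ))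
  have mpos : 0 < m := by
    obtain ⟨e, he⟩ := exists_norm_eq V zero_le_one
    refine lt_of_le_of_lt ?_ (hcon e 0 he)
    positivity
  have up : (ν.prod volume) W ≤ ENNReal.ofReal (m / (4 * K)) := by
    rw [Measure.prod_apply hWm]
    have : ∀ p : sphere (0 : V) 1 × ℝ, volume (Prod.mk p ⁻¹' W) ≤
        ENNReal.ofReal (m / (8 * K * R * (s + 1))) := by
      intro p
      have h1 := hcon p.1 p.2 (by simp)
      have h2 : volume (Prod.mk p ⁻¹' W) ≠ ⊤ :=
        measure_ne_top_of_subset (fun x hx => hx.1) fP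
      rw [← ENNReal.ofReal_toReal h2]
      refine ENNReal.ofReal_le_ofReal ?_
      rw [le_div_iff₀ (by positivity), mul_comm]
      exact h1.le
    refine (lintegral_mono this).trans ?_
    rw [lintegral_const, hν, ← Set.univ_prod_univ, Measure.prod_prod, Measure.restrict_apply_univ,
      Real.volume_Icc, ← ENNReal.ofReal_toReal (measure_ne_top (volume : Measure V).toSphere _),
      ← ENNReal.ofReal_mul (by positivity), ← ENNReal.ofReal_mul (by positivity)]
    refine ENNReal.ofReal_le_ofReal ?_
    change m / (8 * K * R * (s + 1)) * (s * (R - -R)) ≤ _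
    rw [div_mul_eq_mul_div, div_le_div_iff₀ (by positivity) (by positivity)]
    have : s * (2 * R) ≤ (s + 1) * (2 * R) := by nlinarith
    nlinarith [mul_le_mul_of_nonneg_left this (show 0 ≤ m * (4 * K) by positivity)]
  have low : ENNReal.ofReal m ≤ ENNReal.ofReal (2 * K) * (ν.prod volume) W := by
    rw [Measure.prod_apply_symm hWm, ← lintegral_const_mul' _ _ ENNReal.ofReal_ne_top]
    have h1 : ∀ x ∈ P, volume Q ≤
        ENNReal.ofReal (2 * K) * ν ((fun p => (p, x)) ⁻¹' W) := by
      intro x hx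
      have hx1 : ‖x‖ < 1 := by simpa using hPs hx
      refine (volume_le_sections hQ hQs hx1.le).trans ?_
      rw [ENNReal.ofReal_mul zero_le_two, mul_comm (ENNReal.ofReal 2), mul_assoc]
      refine mul_le_mul_right ?_ _
      rw [hν, Measure.prod_apply (measurable_prodMk_right hWm),
        ← lintegral_const_mul' _ _ ENNReal.ofReal_ne_top]
      refine lintegral_mono fun θ => ?_
      have hθ : ‖(θ : V)‖ = 1 := by simp
      have e1 : {r : ℝ | 0 < r ∧ x + r • (θ : V) ∈ Q} ⊆ (fun r => (2 : ℝ)⁻¹ * r) ⁻¹'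
          ((fun u => inner ℝ x (θ : V) + u) ⁻¹' (Prod.mk θ ⁻¹' ((fun p => (p, x)) ⁻¹' W) ∩
            Set.Icc (-R) R)) := by
        rintro r ⟨hr0, hr⟩
        have hre : refl (θ : V) (inner ℝ x (θ : V) + 2⁻¹ * r) x = x + r • (θ : V) := by
          simp [refl]
        refine ⟨⟨hx, ?_, ?_⟩, ?_⟩
        · show inner ℝ x (θ : V) < inner ℝ x (θ : V) + 2⁻¹ * r
          linarith
        · show refl (θ : V) (inner ℝ x (θ : V) + 2⁻¹ * r) x ∈ Q
          rwa [hre]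
        · have h3 := inner_refl hθ (inner ℝ x (θ : V) + 2⁻¹ * r) x
          rw [hre] at h3
          have h4 : ‖x + r • (θ : V)‖ < R := by simpa using hQs hr
          have h5 := abs_real_inner_le_norm (x + r • (θ : V)) (θ : V)
          have h6 := abs_real_inner_le_norm x (θ : V)
          rw [hθ, mul_one] at h5 h6
          rw [abs_le] at h5 h6
          constructor <;> linarith
      refine (measure_mono e1).trans (le_of_eq ?_)
      rw [Real.volume_preimage_mul_left (by norm_num), measure_preimage_add,
        Measure.restrict_apply (measurable_prodMk_left (measurable_prodMk_right hWm))]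
      norm_num
    calc ENNReal.ofReal m = ∫⁻ x in P, volume Q := by
          rw [setLIntegral_const, hm, ENNReal.ofReal_mul measureReal_nonneg, Measure.real,
            Measure.real, ENNReal.ofReal_toReal fP, ENNReal.ofReal_toReal fQ, mul_comm]
      _ ≤ ∫⁻ x in P, ENNReal.ofReal (2 * K) * ν ((fun p => (p, x)) ⁻¹' W) :=
          setLIntegral_mono' hP h1
      _ ≤ _ := setLIntegral_le_lintegral _ _
  have h2 := low.trans (mul_le_mul_right up _)
  rw [← ENNReal.ofReal_mul (by positivity), ENNReal.ofReal_le_ofReal_iff (by positivity)] at h2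
  have h3 : 2 * K * (m / (4 * K)) = m / 2 := by field_simp; norm_num
  linarith

lemma volume_real_ball (x : V) {r : ℝ} (hr : 0 < r) :
    volume.real (ball x r) = r ^ Module.finrank ℝ V * volume.real (ball (0 : V) 1) := by
  rw [Measure.real, Measure.addHaar_ball_of_pos _ _ hr, ENNReal.toReal_mul,
    ENNReal.toReal_ofReal (by positivity)]
  rfl

lemma volume_real_ball_pos : 0 < volume.real (ball (0 : V) 1) :=
  ENNReal.toReal_pos (measure_ball_pos _ _ one_pos).ne' measure_ball_lt_top.ne

/-- Two sets of the same finite measure have differences of the same measure. -/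
lemma volume_real_sdiff_comm {S T : Set V} (hS : MeasurableSet S) (hT : MeasurableSet T)
    (h : volume S = volume T) (hf : volume S ≠ ⊤) :
    volume.real (S \ T) = volume.real (T \ S) := by
  have h1 := measureReal_sdiff_add_inter (μ := (volume : Measure V)) (s := S) (t := T) hT hf
  have h2 := measureReal_sdiff_add_inter (μ := (volume : Measure V)) (s := T) (t := S) hS
    (h ▸ hf)
  have h3 : volume.real S = volume.real T := by simp [Measure.real, h]
  rw [Set.inter_comm] at h2
  linarith

lemma exists_thin_shell {m : ℝ} (hm : 0 < m) : ∃ η : ℝ, 0 < η ∧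
    volume.real (ball (0 : V) (1 + η) \ ball 0 1) ≤ m := by
  have hc : ContinuousAt (fun η : ℝ => (1 + η) ^ Module.finrank ℝ V *
      volume.real (ball (0 : V) 1) - volume.real (ball (0 : V) 1)) 0 := by fun_prop
  have h0 : (fun η : ℝ => (1 + η) ^ Module.finrank ℝ V *
      volume.real (ball (0 : V) 1) - volume.real (ball (0 : V) 1)) 0 < m := by simpa
  obtain ⟨ε, hε, H⟩ := Metric.eventually_nhds_iff.1 (hc.eventually_lt_const h0)
  refine ⟨ε / 2, by positivity, ?_⟩
  rw [measureReal_sdiff (ball_subset_ball (by linarith)) measurableSet_ball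
    measure_ball_lt_top.ne, volume_real_ball 0 (by positivity)]
  refine (H ?_).le
  rw [Real.dist_eq, sub_zero, abs_of_pos (by positivity)]
  linarith

/-- A plane whose reflection moves a definite part of `E` outside the unit ball into the unit
ball. -/
lemma exists_good_refl [Nontrivial V] {R : ℝ} (hR : 1 ≤ R) {m : ℝ} (hm : 0 < m) :
    ∃ h : ℝ, 0 < h ∧ ∃ c : ℝ, 0 < c ∧ ∀ E : Set V, MeasurableSet E → E ⊆ ball 0 R →
      volume E = volume (ball (0 : V) 1) → m ≤ volume.real (E \ ball 0 1) →
      ∃ (e : V) (t : ℝ), ‖e‖ = 1 ∧ h ≤ t ∧ c ≤ volume.real {x | x ∈ ball 0 1 ∧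
        x ∈ gainSet e t E ∧ refl e t x ∉ ball 0 1 ∧ h ≤ t - inner ℝ x e} := by
  obtain ⟨η, hη, hshell⟩ := exists_thin_shell (V := V) (half_pos hm)
  obtain ⟨C, hC, H⟩ := exists_refl_overlap (V := V) R hR
  refine ⟨η / 2, by positivity, m * (m / 2) / C, by positivity, fun E hE hER hv hmE => ?_⟩
  have hf : volume E ≠ ⊤ := measure_ne_top_of_subset hER measure_ball_lt_top.ne
  have hP : MeasurableSet (ball (0 : V) 1 \ E) := measurableSet_ball.diff hE
  have hQ : MeasurableSet ((E \ ball 0 1) \ ball 0 (1 + η)) :=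
    (hE.diff measurableSet_ball).diff measurableSet_ball
  obtain ⟨e, t, he, hle⟩ := H _ _ hP hQ Set.sdiff_subset
    ((Set.sdiff_subset.trans Set.sdiff_subset).trans hER)
  have key : ∀ x, x ∈ ball (0 : V) 1 \ E ∧ inner ℝ x e < t ∧
      refl e t x ∈ (E \ ball 0 1) \ ball 0 (1 + η) →
      η / 2 ≤ t ∧ (x ∈ ball 0 1 ∧ x ∈ gainSet e t E ∧ refl e t x ∉ ball 0 1 ∧
        η / 2 ≤ t - inner ℝ x e) := by
    rintro x ⟨⟨hx1, hxE⟩, hxt, ⟨hrE, hr1⟩, hr2⟩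
    have hx : ‖x‖ < 1 := by simpa using hx1
    have hr : 1 + η ≤ ‖refl e t x‖ := by simpa using hr2
    have h1 : η / 2 ≤ t - inner ℝ x e := by
      have : ‖refl e t x‖ ≤ ‖x‖ + 2 * (t - inner ℝ x e) := by
        refine (norm_add_le _ _).trans ?_
        rw [norm_smul, he, mul_one, Real.norm_of_nonneg (by linarith)]
      linarith
    have h2 := norm_refl_sq he t x
    have h3 : 0 < t := by
      by_contra h
      have : 4 * t * (t - inner ℝ x e) ≤ 0 := by nlinarith
      nlinarith [norm_nonneg x]
    have h4 := abs_real_inner_le_norm x e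
    rw [he, mul_one, abs_le] at h4
    have h5 : ‖refl e t x‖ ^ 2 ≤ (‖x‖ + 2 * t) ^ 2 := by
      rw [h2]; nlinarith
    have h6 := abs_le_of_sq_le_sq h5 (by positivity)
    rw [abs_le] at h6
    exact ⟨by linarith, hx1, ⟨hxt, hxE, hrE⟩, hr1, h1⟩
  have hPm : m ≤ volume.real (ball (0 : V) 1 \ E) := by
    rwa [← volume_real_sdiff_comm hE measurableSet_ball hv hf]
  have hQm : m / 2 ≤ volume.real ((E \ ball 0 1) \ ball 0 (1 + η)) := by
    have h1 := measureReal_sdiff_add_inter (μ := (volume : Measure V)) (s := E \ ball 0 1)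
      (t := ball 0 (1 + η)) measurableSet_ball (measure_ne_top_of_subset Set.sdiff_subset hf)
    have h2 : volume.real ((E \ ball 0 1) ∩ ball 0 (1 + η)) ≤
        volume.real (ball (0 : V) (1 + η) \ ball 0 1) :=
      measureReal_mono (fun x hx => ⟨hx.2, hx.1.2⟩)
        (measure_ne_top_of_subset Set.sdiff_subset measure_ball_lt_top.ne)
    linarith
  have hprod : m * (m / 2) ≤ C * volume.real {x | x ∈ ball (0 : V) 1 \ E ∧ inner ℝ x e < t ∧
      refl e t x ∈ (E \ ball 0 1) \ ball 0 (1 + η)} :=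
    (mul_le_mul hPm hQm (by positivity) measureReal_nonneg).trans hle
  have hc : m * (m / 2) / C ≤ volume.real {x | x ∈ ball (0 : V) 1 \ E ∧ inner ℝ x e < t ∧
      refl e t x ∈ (E \ ball 0 1) \ ball 0 (1 + η)} := by
    rwa [div_le_iff₀' hC]
  refine ⟨e, t, he, ?_, hc.trans (measureReal_mono (fun x hx => (key x hx).2)
    (measure_ne_top_of_subset (fun x hx => hx.1) (measure_ball_lt_top (x := (0 : V)) (r := 1)).ne))⟩
  have : (0 : ℝ) < volume.real {x | x ∈ ball (0 : V) 1 \ E ∧ inner ℝ x e < t ∧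
      refl e t x ∈ (E \ ball 0 1) \ ball 0 (1 + η)} := lt_of_lt_of_le (by positivity) hc
  obtain ⟨x, hx⟩ := nonempty_of_measureReal_ne_zero this.ne'
  exact (key x hx).1

lemma norm_le_norm_refl {e : V} (he : ‖e‖ = 1) {t : ℝ} (ht : 0 ≤ t) {x : V}
    (hx : inner ℝ x e < t) : ‖x‖ ≤ ‖refl e t x‖ := by
  have h := norm_refl_sq he t x
  rw [← sq_le_sq₀ (norm_nonneg _) (norm_nonneg _), h]
  nlinarith [mul_nonneg ht (sub_pos.2 hx).le]

lemma polarize_subset_ball {e : V} (he : ‖e‖ = 1) {t : ℝ} (ht : 0 ≤ t) {E : Set V} {R : ℝ}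
    (hE : E ⊆ ball 0 R) : polarize e t E ⊆ ball 0 R := by
  rintro x (hx | hx)
  · exact hE hx.1
  · have h1 : ‖refl e t x‖ < R := by simpa using hE hx.2.2
    simpa using (norm_le_norm_refl he ht hx.1).trans_lt h1

/-- Polarization towards the origin decreases the part of `E` outside the unit ball. -/
lemma volume_polarize_sdiff_le {e : V} (he : ‖e‖ = 1) {t : ℝ} (ht : 0 ≤ t) {E : Set V}
    (hE : MeasurableSet E) (hf : volume E ≠ ⊤) {S : Set V}
    (hS : ∀ x ∈ S, x ∈ ball 0 1 ∧ x ∈ gainSet e t E ∧ refl e t x ∉ ball 0 1)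
    (hSm : MeasurableSet S) :
    volume.real (polarize e t E \ ball 0 1) + volume.real S ≤ volume.real (E \ ball 0 1) := by
  set G := gainSet e t E with hG
  have mG : MeasurableSet G := measurableSet_gainSet t hE
  have mB : MeasurableSet (refl e t ⁻¹' G) := measurableSet_preimage_gainSet t hE
  have hre : Measurable (refl e t) := (continuous_refl e t).measurable
  have BE : refl e t ⁻¹' G ⊆ E := preimage_gainSet_subset he t
  have fB : volume (refl e t ⁻¹' G) ≠ ⊤ := measure_ne_top_of_subset BE hf
  have fG : volume G ≠ ⊤ := by rwa [← volume_preimage_refl he t mG]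
  have mD : MeasurableSet (G \ ball 0 1) := mG.diff measurableSet_ball
  have real_pre : ∀ X : Set V, MeasurableSet X → volume.real (refl e t ⁻¹' X) = volume.real X :=
    fun X hX => by rw [Measure.real, volume_preimage_refl he t hX]; rfl
  have h1 : volume.real (polarize e t E \ ball 0 1) ≤
      volume.real ((E \ refl e t ⁻¹' G) \ ball 0 1) + volume.real (G \ ball 0 1) := by
    rw [polarize, Set.union_sdiff_distrib]
    exact measureReal_union_le _ _
  have h2 : volume.real (refl e t ⁻¹' (G \ ball 0 1)) + volume.real (refl e t ⁻¹' S) ≤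
      volume.real (refl e t ⁻¹' G \ ball 0 1) := by
    rw [← measureReal_union _ (hre hSm) (measure_ne_top_of_subset
        (Set.preimage_mono Set.sdiff_subset) fB)
      (measure_ne_top_of_subset (Set.preimage_mono fun x hx => (hS x hx).2.1) fB)]
    · refine measureReal_mono ?_ (measure_ne_top_of_subset Set.sdiff_subset fB)
      rintro x (hx | hx)
      · refine ⟨hx.1, fun hb => hx.2 ?_⟩
        have h3 := norm_le_norm_refl he ht hx.1.1
        rw [refl_refl he] at h3
        simp only [mem_ball, dist_zero_right] at hb ⊢
        exact h3.trans_lt hb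
      · have := (hS _ hx).2.2
        rw [refl_refl he] at this
        exact ⟨(hS _ hx).2.1, this⟩
    · exact Set.disjoint_left.2 fun x hx hx' => hx.2 (hS _ hx').1
  have h3 : volume.real ((E \ refl e t ⁻¹' G) \ ball 0 1) +
      volume.real (refl e t ⁻¹' G \ ball 0 1) = volume.real (E \ ball 0 1) := by
    rw [← measureReal_union _ (mB.diff measurableSet_ball)
      (measure_ne_top_of_subset (Set.sdiff_subset.trans Set.sdiff_subset) hf)
      (measure_ne_top_of_subset Set.sdiff_subset fB), ← Set.union_sdiff_distrib,
      Set.sdiff_union_of_subset BE]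
    exact Set.disjoint_left.2 fun x hx hx' => hx.1.2 hx'.1
  rw [real_pre _ mD, real_pre _ hSm] at h2
  linarith

lemma cross_sub_le (hk : RadialKernel V k) {E E' : Set V} (hE : MeasurableSet E)
    (hE' : MeasurableSet E') (hf : volume E ≠ ⊤) (hf' : volume E' ≠ ⊤) {M : ℝ}
    (hM : ∀ x, pot k E x ≤ M) (hM' : ∀ x, pot k E' x ≤ M) :
    cross k E' E' - cross k E E ≤ 2 * M * volume.real (E' \ E) := by
  rw [hk.cross_sub_cross hE hE' hf hf']
  have h1 : 0 ≤ ∫ x in E \ E', (pot k E x + pot k E' x) :=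
    integral_nonneg fun x => add_nonneg (hk.pot_nonneg _ _) (hk.pot_nonneg _ _)
  have fD : volume (E' \ E) ≠ ⊤ := measure_ne_top_of_subset Set.sdiff_subset hf'
  have h2 : (∫ x in E' \ E, (pot k E x + pot k E' x)) ≤ ∫ x in E' \ E, 2 * M :=
    setIntegral_mono_on ((hk.integrableOn_pot hE fD hf).add (hk.integrableOn_pot hE' fD hf'))
      (integrableOn_const fD) (hE'.diff hE) fun x _ => by linarith [hM x, hM' x]
  have h3 : ∫ x in E' \ E, 2 * M = 2 * M * volume.real (E' \ E) := by simp [mul_comm]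
  linarith

lemma riesz_of_subset_ball [Nontrivial V] (hk : RadialKernel V k) {R : ℝ} (hR : 1 ≤ R)
    {E : Set V} (hE : MeasurableSet E) (hER : E ⊆ ball 0 R)
    (hv : volume E = volume (ball (0 : V) 1)) :
    cross k E E ≤ cross k (ball (0 : V) 1) (ball 0 1) := by
  set T : Set ℝ := {m | ∃ E' : Set V, MeasurableSet E' ∧ E' ⊆ ball 0 R ∧
    volume E' = volume (ball (0 : V) 1) ∧ cross k E E ≤ cross k E' E' ∧
    m = volume.real (E' \ ball 0 1)} with hT
  have hne : T.Nonempty := ⟨_, E, hE, hER, hv, le_rfl, rfl⟩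
  have hbd : BddBelow T := ⟨0, by rintro _ ⟨E', -, -, -, -, rfl⟩; exact measureReal_nonneg⟩
  have hinf : sInf T ≤ 0 := by
    by_contra! hpos
    obtain ⟨h, hh, c, hc, H⟩ := exists_good_refl (V := V) hR hpos
    obtain ⟨_, ⟨E', hE', hER', hv', hF, rfl⟩, hlt⟩ :=
      exists_lt_of_csInf_lt hne (lt_add_of_pos_right (sInf T) hc)
    have hf' : volume E' ≠ ⊤ := measure_ne_top_of_subset hER' measure_ball_lt_top.ne
    obtain ⟨e, t, he, ht, hcS⟩ := H E' hE' hER' hv'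
      (csInf_le hbd ⟨E', hE', hER', hv', hF, rfl⟩)
    have ht0 : 0 ≤ t := hh.le.trans ht
    have hSh : MeasurableSet {x : V | h ≤ t - inner ℝ x e} :=
      measurableSet_le measurable_const (by fun_prop)
    have hSm : MeasurableSet {x : V | x ∈ ball 0 1 ∧ x ∈ gainSet e t E' ∧
        refl e t x ∉ ball 0 1 ∧ h ≤ t - inner ℝ x e} :=
      measurableSet_ball.inter ((measurableSet_gainSet t hE').inter
        ((((continuous_refl e t).measurable measurableSet_ball).compl).inter
          hSh))
    have h1 := volume_polarize_sdiff_le he ht0 hE' hf' (fun x hx => ⟨hx.1, hx.2.1, hx.2.2.1⟩) hSm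
    have h2 : volume.real (polarize e t E' \ ball 0 1) ∈ T :=
      ⟨_, measurableSet_polarize t hE', polarize_subset_ball he ht0 hER',
        (volume_polarize he t hE').trans hv', hF.trans (cross_le_polarize he t hk hE' hf'), rfl⟩
    linarith [csInf_le hbd h2]
  obtain ⟨M, hM, HM⟩ := hk.exists_pot_le (V := V) (volume.real (ball (0 : V) 1))
  refine le_of_forall_pos_le_add fun ε hε => ?_
  obtain ⟨_, ⟨E', hE', hER', hv', hF, rfl⟩, hlt⟩ :=
    exists_lt_of_csInf_lt hne (hinf.trans_lt (show 0 < ε / (2 * M) by positivity))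
  have hf' : volume E' ≠ ⊤ := measure_ne_top_of_subset hER' measure_ball_lt_top.ne
  have h1 := cross_sub_le hk measurableSet_ball hE' measure_ball_lt_top.ne hf'
    (HM _ measurableSet_ball measure_ball_lt_top.ne le_rfl)
    (HM _ hE' hf' (by simp [Measure.real, hv']))
  rw [lt_div_iff₀ (by positivity)] at hlt
  linarith

/-- Bounded measurable sets have measurable subsets of every smaller measure. -/
lemma exists_subset_volume_eq [Nontrivial V] {S : Set V} (hS : MeasurableSet S) {R : ℝ}
    (hR : 0 ≤ R) (hSR : S ⊆ ball 0 R) {a : ℝ} (ha : 0 ≤ a) (haS : a ≤ volume.real S) :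
    ∃ W ⊆ S, MeasurableSet W ∧ volume.real W = a := by
  have fS : volume S ≠ ⊤ := measure_ne_top_of_subset hSR measure_ball_lt_top.ne
  set v : ℝ → ℝ := fun τ => max τ 0 ^ Module.finrank ℝ V * volume.real (ball (0 : V) 1) with hv
  have hvc : Continuous v := by fun_prop
  have hvb : ∀ τ, volume.real (ball (0 : V) τ) = v τ := by
    intro τ
    rcases lt_or_ge 0 τ with h | h
    · simp only [hv]; rw [volume_real_ball 0 h, max_eq_left h.le]
    · simp [hv, ball_eq_empty.2 h, max_eq_right h, Module.finrank_pos.ne']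
  set g : ℝ → ℝ := fun τ => volume.real (S ∩ ball 0 τ) with hg
  have hmono : ∀ σ τ, σ ≤ τ → |g τ - g σ| ≤ |v τ - v σ| := by
    intro σ τ h
    have hb : ball (0 : V) σ ⊆ ball 0 τ := ball_subset_ball h
    have h1 : g σ ≤ g τ := measureReal_mono (Set.inter_subset_inter_right _ hb)
      (measure_ne_top_of_subset Set.inter_subset_left fS)
    have h2 : g τ ≤ g σ + volume.real (ball (0 : V) τ \ ball 0 σ) := by
      refine (measureReal_mono ?_ ?_).trans (measureReal_union_le _ _)
      · intro x hx
        by_cases hxσ : x ∈ ball (0 : V) σ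
        · exact Or.inl ⟨hx.1, hxσ⟩
        · exact Or.inr ⟨hx.2, hxσ⟩
      · exact ne_of_lt ((measure_union_le _ _).trans_lt (ENNReal.add_lt_top.2
          ⟨(measure_ne_top_of_subset Set.inter_subset_left fS).lt_top,
            (measure_ne_top_of_subset Set.sdiff_subset measure_ball_lt_top.ne).lt_top⟩))
    rw [measureReal_sdiff hb measurableSet_ball measure_ball_lt_top.ne, hvb, hvb] at h2
    rw [abs_of_nonneg (by linarith)]
    exact (by linarith : g τ - g σ ≤ v τ - v σ).trans (le_abs_self _)
  have hgc : Continuous g := by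
    refine continuous_iff_continuousAt.2 fun σ => ?_
    rw [ContinuousAt, tendsto_iff_dist_tendsto_zero]
    have hv0 := tendsto_iff_dist_tendsto_zero.1 (hvc.tendsto σ)
    refine squeeze_zero (fun _ => dist_nonneg) (fun τ => ?_) hv0
    rw [Real.dist_eq, Real.dist_eq]
    rcases le_total σ τ with h | h
    · exact hmono σ τ h
    · rw [abs_sub_comm, abs_sub_comm (v τ)]; exact hmono τ σ h
  have h0 : g 0 = 0 := by simp [hg]
  have h1 : g R = volume.real S := by simp only [hg]; rw [Set.inter_eq_self_of_subset_left hSR]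
  obtain ⟨τ, -, hτ⟩ := intermediate_value_Icc hR hgc.continuousOn
    (show a ∈ Set.Icc (g 0) (g R) by rw [h0, h1]; exact ⟨ha, haS⟩)
  exact ⟨_, Set.inter_subset_left, hS.inter measurableSet_ball, hτ⟩

section Translate

variable (z : V)

lemma volume_preimage_add {S : Set V} (hS : MeasurableSet S) :
    volume ((fun x => x + z) ⁻¹' S) = volume S :=
  (measurePreserving_add_right volume z).measure_preimage hS.nullMeasurableSet

lemma setIntegral_preimage_add (f : V → ℝ) (S : Set V) :
    ∫ x in (fun x => x + z) ⁻¹' S, f (x + z) = ∫ x in S, f x :=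
  (measurePreserving_add_right volume z).setIntegral_preimage_emb
    (MeasurableEquiv.addRight z).measurableEmbedding f S

lemma cross_preimage_add (S T : Set V) :
    cross k ((fun x => x + z) ⁻¹' S) ((fun x => x + z) ⁻¹' T) = cross k S T := by
  have h : pot k ((fun x => x + z) ⁻¹' T) = fun x => pot k T (x + z) := by
    funext x
    simp only [pot]
    rw [← setIntegral_preimage_add z (fun y => k ‖y - (x + z)‖) T]
    simp
  simp only [cross]
  rw [← setIntegral_preimage_add z (pot k T) S, h]

end Translate

/-- Cut off the part of `E` far from `x` and put the lost mass into the unit ball around `x`. -/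
lemma exists_truncation [Nontrivial V] {E : Set V} (hE : MeasurableSet E)
    (hv : volume E = volume (ball (0 : V) 1)) (x : V) {R : ℝ} (hR : 1 ≤ R) :
    ∃ E' : Set V, MeasurableSet E' ∧ E' ⊆ ball x R ∧ volume E' = volume (ball (0 : V) 1) ∧
      volume.real (E \ E') ≤ volume.real (E \ ball x R) ∧
      volume.real (E' \ E) ≤ volume.real (E \ ball x R) := by
  have hf : volume E ≠ ⊤ := hv ▸ measure_ball_lt_top.ne
  have hvx : volume E = volume (ball x 1) := by
    rw [hv, Measure.addHaar_ball_center volume x]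
  have hle : volume.real (E \ ball x R) ≤ volume.real (ball x 1 \ E) := by
    rw [← volume_real_sdiff_comm hE measurableSet_ball hvx hf]
    exact measureReal_mono (Set.sdiff_subset_sdiff_right (ball_subset_ball hR))
      (measure_ne_top_of_subset Set.sdiff_subset hf)
  obtain ⟨W, hWS, hWm, hW⟩ := exists_subset_volume_eq (measurableSet_ball.diff hE)
    (R := ‖x‖ + 1) (by positivity)
    (Set.sdiff_subset.trans (ball_subset_ball' (by rw [dist_zero_right]; linarith)))
    measureReal_nonneg hle
  have fW : volume W ≠ ⊤ := measure_ne_top_of_subset (hWS.trans Set.sdiff_subset)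
    measure_ball_lt_top.ne
  have fI : volume (E ∩ ball x R) ≠ ⊤ := measure_ne_top_of_subset Set.inter_subset_left hf
  have hd : Disjoint (E ∩ ball x R) W := Set.disjoint_left.2 fun y hy hy' => (hWS hy').2 hy.1
  have hreal : volume.real ((E ∩ ball x R) ∪ W) = volume.real E := by
    rw [measureReal_union hd hWm fI fW, hW]
    have := measureReal_sdiff_add_inter (μ := (volume : Measure V)) (s := E) (t := ball x R)
      measurableSet_ball hf
    linarith
  refine ⟨(E ∩ ball x R) ∪ W, (hE.inter measurableSet_ball).union hWm, ?_, ?_, ?_, ?_⟩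
  · exact Set.union_subset Set.inter_subset_right
      ((hWS.trans Set.sdiff_subset).trans (ball_subset_ball hR))
  · rw [← hv]
    have fU : volume ((E ∩ ball x R) ∪ W) ≠ ⊤ :=
      ne_of_lt ((measure_union_le _ _).trans_lt (ENNReal.add_lt_top.2 ⟨fI.lt_top, fW.lt_top⟩))
    exact (ENNReal.toReal_eq_toReal_iff' fU hf).1 hreal
  · refine measureReal_mono (fun y hy => ⟨hy.1, fun h => hy.2 (Or.inl ⟨hy.1, h⟩)⟩)
      (measure_ne_top_of_subset Set.sdiff_subset hf)
  · rw [← hW]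
    refine measureReal_mono ?_ fW
    rintro y ⟨hy | hy, hyE⟩
    · exact absurd hy.1 hyE
    · exact hy

lemma exists_volume_sdiff_ball_lt {E : Set V} (hf : volume E ≠ ⊤) {ε : ℝ}
    (hε : 0 < ε) : ∃ R : ℝ, 1 ≤ R ∧ volume.real (E \ ball 0 R) < ε := by
  have h1 : Filter.Tendsto (fun n : ℕ => volume.real (E ∩ ball 0 n)) Filter.atTop
      (nhds (volume.real E)) := by
    have h2 : Monotone fun n : ℕ => E ∩ ball (0 : V) n := fun a b hab =>
      Set.inter_subset_inter_right _ (ball_subset_ball (by exact_mod_cast hab))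
    have h3 := tendsto_measure_iUnion_atTop (μ := (volume : Measure V)) h2
    rw [← Set.inter_iUnion, iUnion_ball_nat, Set.inter_univ] at h3
    exact (ENNReal.tendsto_toReal hf).comp h3
  obtain ⟨n, hn⟩ := ((h1.eventually_const_lt (show volume.real E - ε < volume.real E by
    linarith)).and (Filter.eventually_ge_atTop 1)).exists
  refine ⟨n, by exact_mod_cast hn.2, ?_⟩
  have := measureReal_sdiff_add_inter (μ := (volume : Measure V)) (s := E) (t := ball 0 n)
    measurableSet_ball hf
  linarith [hn.1]

/-- The Riesz inequality: balls maximise the energy among sets of given measure. -/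
theorem riesz [Nontrivial V] (hk : RadialKernel V k) {E : Set V} (hE : MeasurableSet E)
    (hv : volume E = volume (ball (0 : V) 1)) :
    cross k E E ≤ cross k (ball (0 : V) 1) (ball 0 1) := by
  have hf : volume E ≠ ⊤ := hv ▸ measure_ball_lt_top.ne
  obtain ⟨M, hM, HM⟩ := hk.exists_pot_le (V := V) (volume.real (ball (0 : V) 1))
  refine le_of_forall_pos_le_add fun ε hε => ?_
  obtain ⟨R, hR, hlt⟩ := exists_volume_sdiff_ball_lt hf
    (show 0 < ε / (2 * M) by positivity)
  obtain ⟨E', hE', hER', hv', h1, -⟩ := exists_truncation hE hv 0 hR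
  have hf' : volume E' ≠ ⊤ := hv' ▸ measure_ball_lt_top.ne
  have h2 := cross_sub_le hk hE' hE hf' hf (HM _ hE' hf' (by simp [Measure.real, hv']))
    (HM _ hE hf (by simp [Measure.real, hv]))
  have h3 := riesz_of_subset_ball hk hR hE' hER' hv'
  have h4 := h1.trans_lt hlt
  rw [lt_div_iff₀ (by positivity)] at h4
  linarith

lemma RadialKernel.truncate (hk : RadialKernel V k) (a : ℝ) (ha : 0 ≤ a) :
    RadialKernel V (fun r => max (k r - a) 0) where
  measurable := (hk.measurable.sub measurable_const).max measurable_const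
  nonneg _ := le_max_right _ _
  antitone _ hx _ hy hxy := max_le_max (sub_le_sub_right (hk.antitone hx hy hxy) _) le_rfl
  integrableOn := by
    refine Integrable.mono hk.integrableOn ?_ (ae_of_all _ fun x => ?_)
    · exact (((hk.measurable.comp measurable_norm).sub measurable_const).max
        measurable_const).aestronglyMeasurable
    · rw [Real.norm_of_nonneg (le_max_right _ _), Real.norm_of_nonneg (hk.nonneg _)]
      exact max_le (by linarith) (hk.nonneg _)

/-- Sets with small deficit have most of their mass in some ball of radius `3`. -/
lemma exists_tight [Nontrivial V] (hk : RadialKernel V k) (h23 : k 3 < k 2) : ∃ C : ℝ, 0 < C ∧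
    ∀ E : Set V, MeasurableSet E → volume E = volume (ball (0 : V) 1) → ∃ x : V,
      volume.real (E \ ball x 3) ≤ C * (cross k (ball (0 : V) 1) (ball 0 1) - cross k E E) := by
  set k' : ℝ → ℝ := fun r => max (k r - k 2) 0 with hk'
  have rk' : RadialKernel V k' := hk.truncate _ (hk.nonneg 2)
  set ω := volume.real (ball (0 : V) 1) with hω
  have ωpos : 0 < ω := volume_real_ball_pos
  have hc : 0 < k 2 - k 3 := by linarith
  refine ⟨(ω * (k 2 - k 3))⁻¹, by positivity, fun E hE hv => ?_⟩
  have hf : volume E ≠ ⊤ := hv ▸ measure_ball_lt_top.ne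
  have hvr : volume.real E = ω := by simp [Measure.real, hv, hω]
  let H : Set V → V → ℝ := fun T x => k 2 * ω - pot k T x + pot k' T x
  have HI : ∀ T : Set V, MeasurableSet T → volume T ≠ ⊤ → volume.real T = ω →
      IntegrableOn (H T) T ∧ ∫ x in T, H T x = k 2 * ω * ω - cross k T T + cross k' T T := by
    intro T mT fT hT
    have i1 : IntegrableOn (fun _ : V => k 2 * ω) T := integrableOn_const fT
    have i2 := hk.integrableOn_pot mT fT fT
    have i3 := rk'.integrableOn_pot mT fT fT
    refine ⟨(i1.sub i2).add i3, ?_⟩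
    simp only [H]
    have e1 : ∫ x in T, (k 2 * ω - pot k T x + pot k' T x) =
      (∫ x in T, (k 2 * ω - pot k T x)) + ∫ x in T, pot k' T x := integral_add (i1.sub i2) i3
    have e2 : ∫ x in T, (k 2 * ω - pot k T x) = (∫ x in T, k 2 * ω) - ∫ x in T, pot k T x :=
      integral_sub i1 i2
    rw [e1, e2]
    simp only [cross, setIntegral_const, smul_eq_mul, hT]
    ring
  have HE : ∀ T : Set V, MeasurableSet T → volume T ≠ ⊤ → volume.real T = ω → ∀ x,
      IntegrableOn (fun y => k 2 - k ‖y - x‖ + k' ‖y - x‖) T ∧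
      H T x = ∫ y in T, (k 2 - k ‖y - x‖ + k' ‖y - x‖) := by
    intro T mT fT hT x
    have i1 : IntegrableOn (fun _ : V => k 2) T := integrableOn_const fT
    have i2 := hk.integrableOn_shift fT x
    have i3 := rk'.integrableOn_shift fT x
    refine ⟨(i1.sub i2).add i3, ?_⟩
    have e1 : ∫ y in T, (k 2 - k ‖y - x‖ + k' ‖y - x‖) =
      (∫ y in T, (k 2 - k ‖y - x‖)) + ∫ y in T, k' ‖y - x‖ := integral_add (i1.sub i2) i3
    have e2 : ∫ y in T, (k 2 - k ‖y - x‖) = (∫ y in T, k 2) - ∫ y in T, k ‖y - x‖ :=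
      integral_sub i1 i2
    rw [e1, e2]
    simp only [H, pot, setIntegral_const, smul_eq_mul, hT]
    ring
  have HB : ∫ x in ball (0 : V) 1, H (ball 0 1) x = 0 := by
    refine (setIntegral_congr_fun (g := fun _ => (0 : ℝ)) measurableSet_ball
      fun x hx => ?_).trans (by simp)
    rw [(HE _ measurableSet_ball measure_ball_lt_top.ne rfl x).2]
    have : ∀ᵐ y : V, y ≠ x := by simp [ae_iff]
    refine (setIntegral_congr_ae measurableSet_ball (g := fun _ => (0 : ℝ)) ?_).trans (by simp)
    filter_upwards [this] with y hyx hy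
    have h0 : 0 < ‖y - x‖ := norm_pos_iff.2 (sub_ne_zero.2 hyx)
    have h2 : ‖y - x‖ ≤ 2 := by
      have h3 : ‖x‖ < 1 := by simpa using hx
      have h4 : ‖y‖ < 1 := by simpa using hy
      linarith [norm_sub_le y x]
    have := hk.antitone h0 (show (0 : ℝ) < 2 by norm_num) h2
    simp only [hk']
    rw [max_eq_left (by linarith)]
    ring
  have h1 := (HI _ measurableSet_ball measure_ball_lt_top.ne rfl).2
  obtain ⟨iE, h2⟩ := HI E hE hf hvr
  have h3 := riesz rk' hE hv
  have hEpos : volume E ≠ 0 := hv ▸ (measure_ball_pos _ _ one_pos).ne'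
  obtain ⟨x, -, hx⟩ := exists_le_setAverage hEpos hf iE
  refine ⟨x, ?_⟩
  rw [setAverage_eq, hvr, smul_eq_mul] at hx
  have hlow : (k 2 - k 3) * volume.real (E \ ball x 3) ≤ H E x := by
    obtain ⟨i, e⟩ := HE E hE hf hvr x
    rw [e]
    have nonneg : ∀ r, 0 ≤ k 2 - k r + k' r := fun r => by
      simp only [hk']
      linarith [le_max_left (k r - k 2) 0]
    calc (k 2 - k 3) * volume.real (E \ ball x 3) = ∫ y in E \ ball x 3, (k 2 - k 3) := by
          simp [mul_comm]
      _ ≤ ∫ y in E \ ball x 3, (k 2 - k ‖y - x‖ + k' ‖y - x‖) := by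
          refine setIntegral_mono_on (integrableOn_const (measure_ne_top_of_subset
            Set.sdiff_subset hf)) (i.mono_set Set.sdiff_subset) (hE.diff measurableSet_ball)
            fun y hy => ?_
          have h3 : 3 ≤ ‖y - x‖ := by simpa [dist_eq_norm] using hy.2
          have h4 := hk.antitone (show (0 : ℝ) < 3 by norm_num)
            (show (0 : ℝ) < ‖y - x‖ by linarith) h3
          have h5 : 0 ≤ k' ‖y - x‖ := le_max_right _ _
          linarith
      _ ≤ _ := setIntegral_mono_set i (ae_of_all _ fun _ => nonneg _)
          (ae_of_all _ Set.sdiff_subset)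
  have h4 : ∫ a in E, H E a ≤ cross k (ball (0 : V) 1) (ball 0 1) - cross k E E := by
    linarith
  have h5 : ω * H E x ≤ cross k (ball (0 : V) 1) (ball 0 1) - cross k E E := by
    have := mul_le_mul_of_nonneg_left hx ωpos.le
    rw [← mul_assoc, mul_inv_cancel₀ ωpos.ne', one_mul] at this
    linarith
  rw [le_inv_mul_iff₀ (by positivity)]
  nlinarith [mul_le_mul_of_nonneg_left hlow ωpos.le]

lemma volume_real_symmDiff {S T : Set V} (hS : MeasurableSet S) (hT : MeasurableSet T)
    (fS : volume S ≠ ⊤) (fT : volume T ≠ ⊤) :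
    volume.real (S ∆ T) = volume.real (S \ T) + volume.real (T \ S) :=
  measureReal_symmDiff_eq hS hT fS fT

/-- Up to a translation and an error controlled by the deficit, sets may be assumed to be
contained in a fixed ball and to have barycentre at the origin. -/
lemma exists_bounded_centered [Nontrivial V] (hk : RadialKernel V k) (h23 : k 3 < k 2) :
    ∃ C : ℝ, 0 < C ∧ ∀ E : Set V, MeasurableSet E → volume E = volume (ball (0 : V) 1) →
      ∃ (z : V) (E' : Set V), MeasurableSet E' ∧ volume E' = volume (ball (0 : V) 1) ∧
        E' ⊆ ball 0 6 ∧ (∀ e : V, ∫ x in E', inner ℝ x e = 0) ∧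
        cross k (ball (0 : V) 1) (ball 0 1) - cross k E' E' ≤
          C * (cross k (ball (0 : V) 1) (ball 0 1) - cross k E E) ∧
        volume.real (((fun x => x + z) ⁻¹' E) ∆ E') ≤
          C * (cross k (ball (0 : V) 1) (ball 0 1) - cross k E E) := by
  obtain ⟨C, hC, H⟩ := exists_tight (V := V) hk h23
  obtain ⟨M, hM, HM⟩ := hk.exists_pot_le (V := V) (volume.real (ball (0 : V) 1))
  refine ⟨1 + 2 * M * C + 2 * C, by positivity, fun E hE hv => ?_⟩
  have hf : volume E ≠ ⊤ := hv ▸ measure_ball_lt_top.ne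
  have hD : 0 ≤ cross k (ball (0 : V) 1) (ball 0 1) - cross k E E := sub_nonneg.2 (riesz hk hE hv)
  obtain ⟨x₀, hx₀⟩ := H E hE hv
  obtain ⟨T, hT, hTb, hvT, h1, h2⟩ := exists_truncation hE hv x₀ (R := 3) (by norm_num)
  have fT : volume T ≠ ⊤ := hvT ▸ measure_ball_lt_top.ne
  set ω := volume.real (ball (0 : V) 1) with hω
  have ωpos : 0 < ω := volume_real_ball_pos
  have hTr : volume.real T = ω := by simp [Measure.real, hvT, hω]
  have iT : IntegrableOn (fun x : V => x) T := by
    have : IntegrableOn (fun x : V => x) (closedBall x₀ 3) :=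
      ContinuousOn.integrableOn_compact (isCompact_closedBall _ _) (by fun_prop)
    exact this.mono_set (hTb.trans ball_subset_closedBall)
  set z : V := ω⁻¹ • ∫ x in T, x with hz
  have hzx : ‖z - x₀‖ ≤ 3 := by
    have e1 : z - x₀ = ω⁻¹ • ∫ x in T, (x - x₀) := by
      rw [integral_sub iT (integrableOn_const fT), setIntegral_const, hTr, smul_sub, smul_smul,
        inv_mul_cancel₀ ωpos.ne', one_smul]
    have e2 : ‖∫ x in T, (x - x₀)‖ ≤ 3 * volume.real T :=
      norm_setIntegral_le_of_norm_le_const fT.lt_top fun x hx => by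
        have := hTb hx
        rw [mem_ball, dist_eq_norm] at this
        exact this.le
    rw [e1, norm_smul, norm_inv, Real.norm_of_nonneg ωpos.le, inv_mul_le_iff₀ ωpos]
    rw [hTr] at e2
    linarith
  refine ⟨z, (fun x => x + z) ⁻¹' T, (measurable_add_const z) hT,
    (volume_preimage_add z hT).trans hvT, ?_, ?_, ?_, ?_⟩
  · intro y hy
    have h3 := hTb hy
    rw [mem_ball, dist_eq_norm] at h3
    have h4 : y = (y + z - x₀) - (z - x₀) := by abel
    have h5 := norm_sub_le (y + z - x₀) (z - x₀)
    rw [← h4] at h5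
    rw [mem_ball, dist_zero_right]
    linarith
  · intro e
    have h3 := setIntegral_preimage_add z (fun x => inner ℝ (x - z) e) T
    simp only [add_sub_cancel_right] at h3
    rw [h3]
    have h4 : ∀ x : V, inner ℝ (x - z) e = inner ℝ e (x - z) := fun x => real_inner_comm _ _
    simp only [h4]
    have i4 : IntegrableOn (fun x : V => x - z) T := iT.sub (integrableOn_const fT)
    rw [integral_inner i4, integral_sub iT (integrableOn_const fT), setIntegral_const, hTr, hz,
      smul_smul, mul_inv_cancel₀ ωpos.ne', one_smul, sub_self, inner_zero_right]
  · rw [cross_preimage_add]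
    have h3 := cross_sub_le hk hT hE fT hf (HM _ hT fT hTr.le)
      (HM _ hE hf (by simp [Measure.real, hv, hω]))
    have h4 : 2 * M * volume.real (E \ T) ≤
        2 * M * (C * (cross k (ball (0 : V) 1) (ball 0 1) - cross k E E)) :=
      mul_le_mul_of_nonneg_left (h1.trans hx₀) (by positivity)
    nlinarith [mul_nonneg hC.le hD]
  · have h3 : ((fun x => x + z) ⁻¹' E) ∆ ((fun x => x + z) ⁻¹' T) =
        (fun x => x + z) ⁻¹' (E ∆ T) := rfl
    rw [h3, Measure.real, volume_preimage_add z (hE.symmDiff hT), ← Measure.real,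
      volume_real_symmDiff hE hT hf fT]
    nlinarith [mul_nonneg (mul_nonneg hM.le hC.le) hD, h1, h2, hx₀]

/-- The Riesz kernel profile `r ↦ r ^ (-l)`, extended evenly to negative `r`. -/
noncomputable def rk (l : ℝ) (r : ℝ) : ℝ := |r| ^ (-l)

lemma rk_of_pos {l r : ℝ} (hr : 0 < r) : rk l r = r ^ (-l) := by rw [rk, abs_of_pos hr]

lemma rk_nonneg (l r : ℝ) : 0 ≤ rk l r := Real.rpow_nonneg (abs_nonneg r) _

lemma measurable_rk (l : ℝ) : Measurable (rk l) := by unfold rk; fun_prop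

/-- Tangent line inequality for the convex function `r ↦ r ^ (-l)`. -/
lemma rk_tangent {l a b : ℝ} (hl : 0 ≤ l) (ha : 0 < a) (hb : 0 < b) :
    l * (b - a) * rk (l + 1) b ≤ rk l a - rk l b := by
  rw [rk_of_pos ha, rk_of_pos hb, rk_of_pos hb]
  have h1 : b ^ (-(l + 1)) = b ^ (-l) / b := by
    rw [neg_add, Real.rpow_add hb, Real.rpow_neg_one]; rfl
  have h2 : a ^ (-l) = b ^ (-l) * Real.exp (l * Real.log (b / a)) := by
    rw [Real.rpow_def_of_pos ha, Real.rpow_def_of_pos hb, ← Real.exp_add,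
      Real.log_div hb.ne' ha.ne']
    congr 1; ring
  have h3 : 1 - a / b ≤ Real.log (b / a) := by
    have := Real.one_sub_inv_le_log_of_pos (div_pos hb ha)
    rwa [inv_div] at this
  have h4 := Real.add_one_le_exp (l * Real.log (b / a))
  have h5 := mul_le_mul_of_nonneg_left h3 hl
  have h6 : 0 < b ^ (-l) := Real.rpow_pos_of_pos hb _
  rw [h1, h2]
  have h7 : l * (b - a) * (b ^ (-l) / b) = b ^ (-l) * (l * (1 - a / b)) := by
    field_simp
  rw [h7]
  nlinarith [mul_le_mul_of_nonneg_left (h5.trans (by linarith : l * Real.log (b / a) ≤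
    Real.exp (l * Real.log (b / a)) - 1)) h6.le]

lemma rk_antitone {l : ℝ} (hl : 0 ≤ l) : AntitoneOn (rk l) (Set.Ioi 0) := by
  intro a ha b hb hab
  have h1 := rk_tangent hl ha hb
  have := mul_nonneg (mul_nonneg hl (sub_nonneg.2 hab)) (rk_nonneg (l + 1) b)
  linarith

lemma abs_rk_sub_le {l a b : ℝ} (hl : 0 ≤ l) (ha : 0 < a) (hb : 0 < b) :
    |rk l a - rk l b| ≤ l * |a - b| * (rk (l + 1) a + rk (l + 1) b) := by
  have h1 := rk_tangent hl ha hb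
  have h2 := rk_tangent hl hb ha
  have ha' := rk_nonneg (l + 1) a
  have hb' := rk_nonneg (l + 1) b
  have h3 : l * (b - a) ≤ l * |a - b| :=
    mul_le_mul_of_nonneg_left (by rw [abs_sub_comm]; exact le_abs_self _) hl
  have h4 : l * (a - b) ≤ l * |a - b| := mul_le_mul_of_nonneg_left (le_abs_self _) hl
  have h5 : 0 ≤ l * |a - b| := by positivity
  rw [abs_le]
  constructor
  · nlinarith [mul_le_mul_of_nonneg_right h4 hb', mul_nonneg h5 ha']
  · nlinarith [mul_le_mul_of_nonneg_right h3 ha', mul_nonneg h5 hb']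

lemma exists_rk_sub_ge {l L : ℝ} (hl : 0 < l) (hL : 0 < L) : ∃ c : ℝ, 0 < c ∧
    ∀ a b : ℝ, 0 < a → a ≤ b → b ≤ L → c * (b ^ 2 - a ^ 2) ≤ rk l a - rk l b := by
  have hLpos : 0 < rk (l + 1) L := by rw [rk_of_pos hL]; positivity
  refine ⟨l * rk (l + 1) L / (2 * L), by positivity, fun a b ha hab hbL => ?_⟩
  have hb := ha.trans_le hab
  have h1 := rk_tangent hl.le ha hb
  have h2 : rk (l + 1) L ≤ rk (l + 1) b := rk_antitone (by linarith) hb hL hbL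
  have h3 : l * (b - a) * rk (l + 1) L ≤ l * (b - a) * rk (l + 1) b :=
    mul_le_mul_of_nonneg_left h2 (mul_nonneg hl.le (sub_nonneg.2 hab))
  have h4 : l * rk (l + 1) L / (2 * L) * (b ^ 2 - a ^ 2) ≤ l * (b - a) * rk (l + 1) L := by
    have h5 : b ^ 2 - a ^ 2 ≤ 2 * L * (b - a) := by nlinarith
    calc l * rk (l + 1) L / (2 * L) * (b ^ 2 - a ^ 2)
        ≤ l * rk (l + 1) L / (2 * L) * (2 * L * (b - a)) :=
          mul_le_mul_of_nonneg_left h5 (by positivity)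
      _ = l * (b - a) * rk (l + 1) L := by field_simp
  linarith

lemma rk_three_lt_two {l : ℝ} (hl : 0 < l) : rk l 3 < rk l 2 := by
  obtain ⟨c, hc, H⟩ := exists_rk_sub_ge hl (show (0 : ℝ) < 3 by norm_num)
  have := H 2 3 (by norm_num) (by norm_num) le_rfl
  nlinarith

lemma radialKernel_rk [Nontrivial V] {l : ℝ} (hl : 0 ≤ l) (hn : l < Module.finrank ℝ V) :
    RadialKernel V (rk l) where
  measurable := measurable_rk l
  nonneg := rk_nonneg l
  antitone := rk_antitone hl
  integrableOn := by
    rw [integrableOn_fun_norm_addHaar]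
    have h1 : IntegrableOn (fun y : ℝ => y ^ ((Module.finrank ℝ V : ℝ) - 1 - l)) (Set.Ioo 0 1) := by
      rw [intervalIntegral.integrableOn_Ioo_rpow_iff zero_lt_one]
      linarith
    refine h1.congr_fun (fun y hy => ?_) measurableSet_Ioo
    have hpos : 0 < Module.finrank ℝ V := Module.finrank_pos
    simp only [smul_eq_mul]
    rw [rk_of_pos hy.1, ← Real.rpow_natCast, ← Real.rpow_add hy.1, Nat.cast_sub hpos]
    congr 1
    push_cast
    ring

lemma gainSet_ball_eq_empty {e : V} (he : ‖e‖ = 1) {t : ℝ} (ht : 0 ≤ t) :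
    gainSet e t (ball (0 : V) 1) = ∅ := by
  refine Set.eq_empty_of_forall_notMem fun x hx => hx.2.1 ?_
  have h1 : ‖refl e t x‖ < 1 := by simpa using hx.2.2
  simpa using (norm_le_norm_refl he ht hx.1).trans_lt h1

/-- The potential of the ball decreases under reflection away from the origin. -/
lemma pot_ball_sub_refl (hk : RadialKernel V k) {e : V} (he : ‖e‖ = 1) {t : ℝ} (ht : 0 ≤ t)
    (x : V) : pot k (ball 0 1) x - pot k (ball 0 1) (refl e t x) =
      ∫ y in keepSet e t (ball 0 1), (k ‖y - x‖ - k ‖y - refl e t x‖) := by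
  set A := keepSet e t (ball (0 : V) 1) with hA
  set S := (ball (0 : V) 1 \ refl e t ⁻¹' gainSet e t (ball 0 1)) \ A with hS
  have mA : MeasurableSet A := measurableSet_keepSet t measurableSet_ball
  have fA : volume A ≠ ⊤ := measure_ne_top_of_subset (fun y hy => hy.2.1)
    (measure_ball_lt_top (x := (0 : V)) (r := 1)).ne
  have fS : volume S ≠ ⊤ := measure_ne_top_of_subset (Set.sdiff_subset.trans Set.sdiff_subset)
    (measure_ball_lt_top (x := (0 : V)) (r := 1)).ne
  have hB : ball (0 : V) 1 = S ∪ A := by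
    conv_lhs => rw [polarize_decomp he t (E := ball (0 : V) 1)]
    rw [gainSet_ball_eq_empty he ht]
    simp [hS, hA, gainSet_ball_eq_empty he ht]
  have hSS : refl e t ⁻¹' S = S := symmetric_part he t
  have h1 : ∀ z, pot k (ball 0 1) z = pot k S z + pot k A z := fun z => by
    rw [hB]; exact hk.pot_union mA fS fA Set.disjoint_sdiff_left z
  have h2 : pot k S x = pot k S (refl e t x) := by
    rw [← pot_preimage_refl he t S x, hSS]
  have h3 : ∫ y in A, (k ‖y - x‖ - k ‖y - refl e t x‖) = pot k A x - pot k A (refl e t x) :=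
    integral_sub (hk.integrableOn_shift fA x) (hk.integrableOn_shift fA _)
  rw [h1, h1, h2, h3]
  ring

lemma kernel_refl_le_ae (hk : RadialKernel V k) {e : V} (he : ‖e‖ = 1) {t : ℝ} {x : V}
    (hx : inner ℝ x e < t) :
    ∀ᵐ y, y ∈ keepSet e t (ball 0 1) → 0 ≤ k ‖y - x‖ - k ‖y - refl e t x‖ := by
  have : ∀ᵐ y : V, y ≠ x := by
    rcases subsingleton_or_nontrivial V with h | h
    · exact absurd (by simp [Subsingleton.elim e 0]) (he.trans_ne one_ne_zero)
    · simp [ae_iff]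
  filter_upwards [this] with y hyx hy
  exact sub_nonneg.2 (kernel_refl_le he t hk hx hy.1 hyx)

lemma pot_ball_refl_le (hk : RadialKernel V k) {e : V} (he : ‖e‖ = 1) {t : ℝ} (ht : 0 ≤ t)
    {x : V} (hx : inner ℝ x e < t) :
    pot k (ball 0 1) (refl e t x) ≤ pot k (ball 0 1) x := by
  rw [← sub_nonneg, pot_ball_sub_refl hk he ht]
  exact setIntegral_nonneg_of_ae_restrict
    ((ae_restrict_iff' (measurableSet_keepSet t measurableSet_ball)).2
      (kernel_refl_le_ae hk he hx))

lemma pot_ball_anti (hk : RadialKernel V k) {x y : V} (hxy : ‖x‖ ≤ ‖y‖) :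
    pot k (ball 0 1) y ≤ pot k (ball 0 1) x := by
  rcases eq_or_ne x y with rfl | hne
  · exact le_rfl
  have hd : 0 < ‖y - x‖ := norm_pos_iff.2 (sub_ne_zero.2 hne.symm)
  set e : V := ‖y - x‖⁻¹ • (y - x) with he'
  have he : ‖e‖ = 1 := by
    rw [he', norm_smul, norm_inv, norm_norm, inv_mul_cancel₀ hd.ne']
  set t : ℝ := (‖y‖ ^ 2 - ‖x‖ ^ 2) / (2 * ‖y - x‖) with ht'
  have ht : 0 ≤ t := by
    have : ‖x‖ ^ 2 ≤ ‖y‖ ^ 2 := by gcongr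
    exact div_nonneg (by linarith) (by positivity)
  have h1 : t - inner ℝ x e = ‖y - x‖ / 2 := by
    rw [he', ht', inner_smul_right, inner_sub_right, real_inner_self_eq_norm_sq]
    have h2 := norm_sub_sq_real y x
    rw [real_inner_comm] at h2
    field_simp
    linarith
  have h2 : refl e t x = y := by
    rw [refl, h1, he', smul_smul]
    have : 2 * (‖y - x‖ / 2) * ‖y - x‖⁻¹ = 1 := by field_simp
    rw [this, one_smul]; abel
  rw [← h2]
  exact pot_ball_refl_le hk he ht (by linarith)

/-- The potential of the unit ball has definite radial slope away from the origin. -/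
lemma exists_pot_ball_slope (hk : RadialKernel V k) {L : ℝ}
    {c : ℝ} (hc : 0 < c)
    (hkc : ∀ a b : ℝ, 0 < a → a ≤ b → b ≤ 1 + L → c * (b ^ 2 - a ^ 2) ≤ k a - k b) :
    ∃ c' : ℝ, 0 < c' ∧ ∀ (θ : V) (r s : ℝ), ‖θ‖ = 1 → 0 ≤ r → r ≤ s → 1 / 2 ≤ s → s ≤ L →
      c' * (s - r) ≤ pot k (ball 0 1) (r • θ) - pot k (ball 0 1) (s • θ) := by
  have hvpos : 0 < volume.real (ball (0 : V) (1 / 4)) :=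
    ENNReal.toReal_pos (measure_ball_pos _ _ (by norm_num)).ne' measure_ball_lt_top.ne
  refine ⟨c * volume.real (ball (0 : V) (1 / 4)), by positivity,
    fun θ r s hθ hr hrs hs hsL => ?_⟩
  rcases hrs.eq_or_lt with rfl | hlt
  · simp
  set t : ℝ := (r + s) / 2 with ht'
  have ht : 0 ≤ t := by linarith
  have hin : ∀ a : ℝ, inner ℝ (a • θ) θ = a := fun a => by
    rw [inner_smul_left, real_inner_self_eq_norm_sq, hθ]; simp
  have href : refl θ t (r • θ) = s • θ := by
    rw [refl, hin, ← add_smul]; congr 1; linarith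
  have hx : inner ℝ (r • θ) θ < t := by rw [hin]; linarith
  have hsub : ∀ y ∈ ball ((-(3 / 4) : ℝ) • θ) (1 / 4), inner ℝ y θ < -(1 / 2) ∧ ‖y‖ < 1 := by
    intro y hy
    rw [mem_ball, dist_eq_norm] at hy
    constructor
    · have h1 := real_inner_le_norm (y - (-(3 / 4) : ℝ) • θ) θ
      rw [inner_sub_left, hin, hθ] at h1
      linarith
    · have h1 := norm_sub_norm_le y ((-(3 / 4) : ℝ) • θ)
      rw [norm_smul, hθ, mul_one, Real.norm_eq_abs, abs_of_neg (by norm_num)] at h1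
      linarith
  have hkeep : ball ((-(3 / 4) : ℝ) • θ) (1 / 4) ⊆ keepSet θ t (ball 0 1) := by
    intro y hy
    obtain ⟨h1, h2⟩ := hsub y hy
    refine ⟨by linarith, by simpa using h2, fun h3 => ?_⟩
    have h4 : ‖refl θ t y‖ < 1 := by simpa using h3
    have h5 := real_inner_le_norm (refl θ t y) θ
    rw [inner_refl hθ, hθ] at h5
    linarith
  have fA : volume (keepSet θ t (ball (0 : V) 1)) ≠ ⊤ :=
    measure_ne_top_of_subset (fun y hy => hy.2.1) (measure_ball_lt_top (x := (0 : V)) (r := 1)).ne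
  have iA : IntegrableOn (fun y => k ‖y - r • θ‖ - k ‖y - s • θ‖) (keepSet θ t (ball (0 : V) 1)) :=
    (hk.integrableOn_shift fA _).sub (hk.integrableOn_shift fA _)
  have key := pot_ball_sub_refl hk hθ ht (r • θ)
  have hae := kernel_refl_le_ae hk hθ hx
  rw [href] at key hae
  rw [key]
  calc c * volume.real (ball (0 : V) (1 / 4)) * (s - r)
      = ∫ y in ball ((-(3 / 4) : ℝ) • θ) (1 / 4), c * (s - r) := by
        rw [setIntegral_const, smul_eq_mul,
          volume_real_ball ((-(3 / 4) : ℝ) • θ) (r := 1 / 4) (by norm_num),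
          volume_real_ball (0 : V) (r := 1 / 4) (by norm_num)]
        ring
    _ ≤ ∫ y in ball ((-(3 / 4) : ℝ) • θ) (1 / 4), (k ‖y - r • θ‖ - k ‖y - s • θ‖) := by
        refine setIntegral_mono_on_ae (integrableOn_const measure_ball_lt_top.ne)
          (iA.mono_set hkeep) measurableSet_ball ?_
        have hne : ∀ᵐ y : V, y ≠ r • θ := by
          have : Nontrivial V := ⟨⟨θ, 0, by rintro rfl; simp at hθ⟩⟩
          simp [ae_iff]
        filter_upwards [hne] with y hyx hy
        obtain ⟨h1, h2⟩ := hsub y hy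
        have h0 : 0 < ‖y - r • θ‖ := norm_pos_iff.2 (sub_ne_zero.2 hyx)
        have h3 := norm_sub_le_norm_sub_refl hθ t hx (show inner ℝ y θ < t by linarith)
        have h4 := norm_sub_refl_sq hθ t (r • θ) y
        rw [href] at h3 h4
        have h5 : ‖y - s • θ‖ ≤ 1 + L := by
          refine (norm_sub_le _ _).trans ?_
          rw [norm_smul, hθ, mul_one, Real.norm_of_nonneg (by linarith)]
          linarith
        have h6 := hkc _ _ h0 h3 h5
        rw [h4, hin] at h6
        refine le_trans ?_ h6
        have h7 : s - r ≤ 4 * (t - r) * (t - inner ℝ y θ) := by nlinarith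
        calc c * (s - r) ≤ c * (4 * (t - r) * (t - inner ℝ y θ)) :=
              mul_le_mul_of_nonneg_left h7 hc.le
          _ = _ := by ring
    _ ≤ _ := by
        refine setIntegral_mono_set iA ?_ (ae_of_all _ hkeep)
        exact (ae_restrict_iff' (measurableSet_keepSet t measurableSet_ball)).2 hae

lemma pot_sub_pot_ball (hk : RadialKernel V k) {T : Set V} (hT : MeasurableSet T)
    (fT : volume T ≠ ⊤) (x : V) : pot k T x =
      pot k (ball 0 1) x + pot k (T \ ball 0 1) x - pot k (ball 0 1 \ T) x := by
  have fB : volume (ball (0 : V) 1) ≠ ⊤ := measure_ball_lt_top.ne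
  have h1 : pot k T x = pot k (T ∩ ball 0 1) x + pot k (T \ ball 0 1) x :=
    (integral_inter_add_sdiff measurableSet_ball (hk.integrableOn_shift fT x)).symm
  have h2 : pot k (ball 0 1) x = pot k (ball 0 1 ∩ T) x + pot k (ball 0 1 \ T) x :=
    (integral_inter_add_sdiff hT (hk.integrableOn_shift fB x)).symm
  rw [Set.inter_comm] at h2
  linarith

/-- The Riesz potential of a set is Lipschitz. -/
lemma abs_pot_sub_pot_le {l : ℝ} (hl : 0 ≤ l) (hn : l + 1 < Module.finrank ℝ V) {T : Set V}
    (fT : volume T ≠ ⊤) (x y : V) : |pot (rk l) T x - pot (rk l) T y| ≤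
      l * ‖x - y‖ * (pot (rk (l + 1)) T x + pot (rk (l + 1)) T y) := by
  have : Nontrivial V := Module.nontrivial_of_finrank_pos (R := ℝ) (by
    have : (0 : ℝ) < Module.finrank ℝ V := by linarith
    exact_mod_cast this)
  have hk := radialKernel_rk (V := V) hl (by linarith)
  have hk' := radialKernel_rk (V := V) (show 0 ≤ l + 1 by linarith) hn
  have e1 : pot (rk l) T x - pot (rk l) T y = ∫ z in T, (rk l ‖z - x‖ - rk l ‖z - y‖) :=
    (integral_sub (hk.integrableOn_shift fT x) (hk.integrableOn_shift fT y)).symm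
  have e2 : l * ‖x - y‖ * (pot (rk (l + 1)) T x + pot (rk (l + 1)) T y) =
      ∫ z in T, l * ‖x - y‖ * (rk (l + 1) ‖z - x‖ + rk (l + 1) ‖z - y‖) := by
    rw [integral_const_mul]
    congr 1
    exact (integral_add (hk'.integrableOn_shift fT x) (hk'.integrableOn_shift fT y)).symm
  rw [e1, e2]
  refine (abs_integral_le_integral_abs).trans (integral_mono_ae
    ((hk.integrableOn_shift fT x).sub (hk.integrableOn_shift fT y)).abs
    (((hk'.integrableOn_shift fT x).add (hk'.integrableOn_shift fT y)).const_mul _) ?_)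
  have h1 : ∀ᵐ z : V, z ≠ x := by simp [ae_iff]
  have h2 : ∀ᵐ z : V, z ≠ y := by simp [ae_iff]
  filter_upwards [ae_restrict_of_ae h1, ae_restrict_of_ae h2] with z hx hy
  have h3 : 0 < ‖z - x‖ := norm_pos_iff.2 (sub_ne_zero.2 hx)
  have h4 : 0 < ‖z - y‖ := norm_pos_iff.2 (sub_ne_zero.2 hy)
  refine (abs_rk_sub_le hl h3 h4).trans ?_
  have h5 : |‖z - x‖ - ‖z - y‖| ≤ ‖x - y‖ := by
    refine (abs_norm_sub_norm_le _ _).trans (le_of_eq ?_)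
    rw [norm_sub_rev x y]; congr 1; abel
  exact mul_le_mul_of_nonneg_right (mul_le_mul_of_nonneg_left h5 hl)
    (add_nonneg (rk_nonneg _ _) (rk_nonneg _ _))

/-- Sets close to the unit ball have potentials with definite radial slope. -/
lemma exists_pot_slope {l : ℝ} (hl : 0 < l) (hn : l + 1 < Module.finrank ℝ V) {L : ℝ}
    (hL : 0 < L) : ∃ c : ℝ, 0 < c ∧ ∃ δ : ℝ, 0 < δ ∧ ∀ T : Set V, MeasurableSet T →
      volume T = volume (ball (0 : V) 1) → volume.real (T \ ball 0 1) ≤ δ →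
      ∀ (θ : V) (r s : ℝ), ‖θ‖ = 1 → 0 ≤ r → r ≤ s → 1 / 2 ≤ s → s ≤ L →
        c * (s - r) ≤ pot (rk l) T (r • θ) - pot (rk l) T (s • θ) := by
  have : Nontrivial V := Module.nontrivial_of_finrank_pos (R := ℝ) (by
    have : (0 : ℝ) < Module.finrank ℝ V := by linarith
    exact_mod_cast this)
  have hk := radialKernel_rk (V := V) hl.le (by linarith)
  have hk' := radialKernel_rk (V := V) (show 0 ≤ l + 1 by linarith) hn
  obtain ⟨c, hc, hkc⟩ := exists_rk_sub_ge hl (show 0 < 1 + L by linarith)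
  obtain ⟨c', hc', H⟩ := exists_pot_ball_slope (V := V) hk hc hkc
  obtain ⟨δ, hδ, Hδ⟩ := hk'.exists_pot_small (V := V) (show 0 < c' / (8 * l) by positivity)
  refine ⟨c' / 2, by positivity, δ, hδ, fun T hT hv hTδ θ r s hθ hr hrs hs hsL => ?_⟩
  have fB : volume (ball (0 : V) 1) ≠ ⊤ := measure_ball_lt_top.ne
  have fT : volume T ≠ ⊤ := hv ▸ fB
  have h0 := H θ r s hθ hr hrs hs hsL
  have hdist : ‖r • θ - s • θ‖ = s - r := by
    rw [← sub_smul, norm_smul, hθ, mul_one, Real.norm_eq_abs, abs_sub_comm,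
      abs_of_nonneg (by linarith)]
  have lip : ∀ S : Set V, MeasurableSet S → volume S ≠ ⊤ → volume.real S ≤ δ →
      |pot (rk l) S (r • θ) - pot (rk l) S (s • θ)| ≤ c' / 4 * (s - r) := by
    intro S hS fS hSδ
    have h1 := abs_pot_sub_pot_le hl.le hn fS (r • θ) (s • θ)
    rw [hdist] at h1
    have h2 := Hδ S hS fS hSδ (r • θ)
    have h3 := Hδ S hS fS hSδ (s • θ)
    refine h1.trans ?_
    have h4 : l * (s - r) * (pot (rk (l + 1)) S (r • θ) + pot (rk (l + 1)) S (s • θ)) ≤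
        l * (s - r) * (c' / (8 * l) + c' / (8 * l)) :=
      mul_le_mul_of_nonneg_left (by linarith) (mul_nonneg hl.le (by linarith))
    refine h4.trans (le_of_eq ?_)
    field_simp
    ring
  have h1 := lip (T \ ball 0 1) (hT.diff measurableSet_ball)
    (measure_ne_top_of_subset Set.sdiff_subset fT) hTδ
  have h2 := lip (ball 0 1 \ T) (measurableSet_ball.diff hT)
    (measure_ne_top_of_subset Set.sdiff_subset fB)
    (by rwa [← volume_real_sdiff_comm hT measurableSet_ball hv fT])
  rw [pot_sub_pot_ball hk hT fT (r • θ), pot_sub_pot_ball hk hT fT (s • θ)]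
  rw [abs_le] at h1 h2
  linarith [h1.1, h2.2]

/-- Bounded centred sets with small deficit are close to the unit ball. -/
lemma exists_close [Nontrivial V] (hk : RadialKernel V k) {c' : ℝ} (hc' : 0 < c')
    (hkc : ∀ a b : ℝ, 0 < a → a ≤ b → b ≤ 12 → c' * (b ^ 2 - a ^ 2) ≤ k a - k b)
    {m : ℝ} (hm : 0 < m) : ∃ D₀ : ℝ, 0 < D₀ ∧ ∀ E : Set V, MeasurableSet E →
      volume E = volume (ball (0 : V) 1) → E ⊆ ball 0 6 →
      (∀ e : V, ∫ x in E, inner ℝ x e = 0) →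
      cross k (ball (0 : V) 1) (ball 0 1) - cross k E E < D₀ →
      volume.real (E \ ball 0 1) < m := by
  obtain ⟨h, hh, c, hc, H⟩ := exists_good_refl (V := V) (show (1 : ℝ) ≤ 6 by norm_num) hm
  have hω := volume_real_ball_pos (V := V)
  set ω := volume.real (ball (0 : V) 1) with hωd
  refine ⟨8 * c' * (h * ω) * (h * c), by positivity, fun E hE hv hE6 hbar hD => ?_⟩
  by_contra! hmE
  obtain ⟨e, t, he, hht, hS⟩ := H E hE hE6 hv hmE
  have fB : volume (ball (0 : V) 1) ≠ ⊤ := measure_ball_lt_top.ne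
  have fE : volume E ≠ ⊤ := hv ▸ fB
  have hG6 : gainSet e t E ⊆ ball 0 6 := fun x hx => by
    have h1 := norm_le_norm_refl he (hh.le.trans hht) hx.1
    have h2 : ‖refl e t x‖ < 6 := by simpa using hE6 hx.2.2
    simpa using h1.trans_lt h2
  have iG := integrableOn_height he t hG6
  have hg : h * c ≤ ∫ x in gainSet e t E, (t - inner ℝ x e) := by
    set S := {x | x ∈ ball (0 : V) 1 ∧ x ∈ gainSet e t E ∧ refl e t x ∉ ball 0 1 ∧
      h ≤ t - inner ℝ x e} with hSd
    have hSG : S ⊆ gainSet e t E := fun x hx => hx.2.1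
    have hSm : MeasurableSet S := by
      have m1 : MeasurableSet {x : V | refl e t x ∉ ball (0 : V) 1} :=
        (continuous_refl e t).measurable measurableSet_ball.compl
      have m2 : MeasurableSet {x : V | h ≤ t - inner ℝ x e} := by
        have : Continuous fun x : V => t - inner ℝ x e := by fun_prop
        exact this.measurable measurableSet_Ici
      exact measurableSet_ball.inter ((measurableSet_gainSet t hE).inter (m1.inter m2))
    have fS : volume S ≠ ⊤ := measure_ne_top_of_subset (fun x hx => hx.1) fB
    calc h * c ≤ h * volume.real S := mul_le_mul_of_nonneg_left hS hh.le
      _ = ∫ x in S, h := by rw [setIntegral_const, smul_eq_mul, mul_comm]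
      _ ≤ ∫ x in S, (t - inner ℝ x e) :=
        setIntegral_mono_on (integrableOn_const fS) (iG.mono_set hSG) hSm fun x hx => hx.2.2.2
      _ ≤ _ := setIntegral_mono_set iG ((ae_restrict_iff' (measurableSet_gainSet t hE)).2
          (ae_of_all _ fun x hx => by
            have : inner ℝ x e < t := hx.1
            simp only [Pi.zero_apply]; linarith)) (ae_of_all _ hSG)
  have hmom := moment_keepSet_sub_gainSet he t hE hE6
  have h_int : ∫ x in E, (t - inner ℝ x e) = t * ω := by
    have i1 := integrableOn_height he t hE6
    have i2 := integrableOn_height he 0 hE6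
    have : ∫ x in E, (t - inner ℝ x e) = (∫ x in E, t) - ∫ x in E, inner ℝ x e := by
      refine integral_sub (integrableOn_const fE) ?_
      have i3 : IntegrableOn (fun x : V => inner ℝ x e) E := by simpa using i2.neg
      exact i3
    rw [this, hbar e, setIntegral_const, smul_eq_mul, sub_zero, mul_comm, hωd,
      Measure.real, hv, ← Measure.real]
  rw [h_int] at hmom
  have hA : h * ω ≤ ∫ x in keepSet e t E, (t - inner ℝ x e) := by
    have : h * ω ≤ t * ω := mul_le_mul_of_nonneg_right hht hω.le
    have : 0 ≤ h * c := by positivity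
    linarith
  have hpol := polarize_gain he t hk hE hE6 (c := c') (fun a b ha hab hb =>
    hkc a b ha hab (by linarith))
  have hr := riesz hk (measurableSet_polarize t hE) ((volume_polarize he t hE).trans hv)
  have hprod : 8 * c' * (h * ω) * (h * c) ≤ 8 * c' * (∫ x in keepSet e t E, (t - inner ℝ x e)) *
      (∫ y in gainSet e t E, (t - inner ℝ y e)) := by
    have h0 : 0 ≤ h * c := by positivity
    have h1 : 0 ≤ h * ω := by positivity
    have h2 : 0 ≤ 8 * c' := by positivity
    exact mul_le_mul (mul_le_mul_of_nonneg_left hA h2) hg h0 (mul_nonneg h2 (h1.trans hA))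
  linarith

lemma setIntegral_sub_setIntegral {f : V → ℝ} {S T : Set V} (hS : MeasurableSet S)
    (hT : MeasurableSet T) (fS : IntegrableOn f S) (fT : IntegrableOn f T) :
    (∫ x in T, f x) - ∫ x in S, f x = (∫ x in T \ S, f x) - ∫ x in S \ T, f x := by
  rw [← integral_inter_add_sdiff hS fT, ← integral_inter_add_sdiff hT fS, Set.inter_comm]
  ring

lemma exists_filled {l : ℝ} (hl : 0 < l) (hn : l + 1 < Module.finrank ℝ V) {δ : ℝ}
    (hδ : 0 < δ) : ∃ C : ℝ, 0 < C ∧ ∃ D₀ : ℝ, 0 < D₀ ∧ ∀ E : Set V, MeasurableSet E →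
      volume E = volume (ball (0 : V) 1) → E ⊆ ball 0 6 →
      (∀ e : V, ∫ x in E, inner ℝ x e = 0) →
      cross (rk l) (ball (0 : V) 1) (ball 0 1) - cross (rk l) E E < D₀ →
      ∃ E' : Set V, MeasurableSet E' ∧ volume E' = volume (ball (0 : V) 1) ∧ E' ⊆ ball 0 6 ∧
        ball 0 (1 / 2) ⊆ E' ∧ volume.real (E' \ ball 0 1) ≤ δ ∧
        cross (rk l) E E ≤ cross (rk l) E' E' ∧
        volume.real (E ∆ E') ≤
          C * (cross (rk l) (ball (0 : V) 1) (ball 0 1) - cross (rk l) E E) ∧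
        ∀ e : V, ‖e‖ = 1 → |∫ x in E', inner ℝ x e| ≤
          C * (cross (rk l) (ball (0 : V) 1) (ball 0 1) - cross (rk l) E E) := by
  have : Nontrivial V := Module.nontrivial_of_finrank_pos (R := ℝ) (by
    have : (0 : ℝ) < Module.finrank ℝ V := by linarith
    exact_mod_cast this)
  have hk := radialKernel_rk (V := V) hl.le (by linarith)
  obtain ⟨c₁, hc₁, hkc₁⟩ := exists_rk_sub_ge hl (show (0 : ℝ) < 12 by norm_num)
  obtain ⟨c, hc, H⟩ := exists_pot_ball_slope (V := V) (L := 1) hk hc₁ (fun a b ha hab hb =>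
    hkc₁ a b ha hab (by linarith))
  obtain ⟨δ', hδ', Hδ⟩ := hk.exists_pot_small (V := V) (show 0 < c / 16 by positivity)
  obtain ⟨D₀, hD₀, HD⟩ := exists_close (V := V) hk hc₁ hkc₁ (show 0 < min δ δ' from lt_min hδ hδ')
  refine ⟨24 / c, by positivity, D₀, hD₀, fun E hE hv hE6 hbar hD => ?_⟩
  have hclose := HD E hE hv hE6 hbar hD
  have fB : volume (ball (0 : V) 1) ≠ ⊤ := measure_ball_lt_top.ne
  have fE : volume E ≠ ⊤ := hv ▸ fB
  set P : Set V := ball 0 (1 / 2) \ E with hPd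
  have mP : MeasurableSet P := measurableSet_ball.diff hE
  have hPB : P ⊆ ball 0 1 \ E := Set.sdiff_subset_sdiff_left (ball_subset_ball (by norm_num))
  have fP : volume P ≠ ⊤ := measure_ne_top_of_subset (hPB.trans Set.sdiff_subset) fB
  have hPle : volume.real P ≤ volume.real (E \ ball 0 1) := by
    rw [volume_real_sdiff_comm hE measurableSet_ball hv fE]
    exact measureReal_mono hPB (measure_ne_top_of_subset Set.sdiff_subset fB)
  obtain ⟨Q, hQE, mQ, hQP⟩ := exists_subset_volume_eq (V := V) (hE.diff measurableSet_ball)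
    (show (0 : ℝ) ≤ 6 by norm_num) (Set.sdiff_subset.trans hE6) measureReal_nonneg hPle
  have hQE' : Q ⊆ E := hQE.trans Set.sdiff_subset
  have fQ : volume Q ≠ ⊤ := measure_ne_top_of_subset hQE' fE
  have dPE : Disjoint E P := Set.disjoint_sdiff_right
  set E' : Set V := (E \ Q) ∪ P with hE'd
  have mE' : MeasurableSet E' := (hE.diff mQ).union mP
  have fEQ : volume (E \ Q) ≠ ⊤ := measure_ne_top_of_subset Set.sdiff_subset fE
  have fE' : volume E' ≠ ⊤ := measure_union_ne_top fEQ fP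
  have hE'E : E' \ E = P := by
    ext x
    have : x ∈ P → x ∉ E := fun h => h.2
    simp only [hE'd, Set.mem_sdiff, Set.mem_union]; tauto
  have hEE' : E \ E' = Q := by
    ext x
    have h1 : x ∈ P → x ∉ E := fun h => h.2
    have h2 : x ∈ Q → x ∈ E := fun h => hQE' h
    simp only [hE'd, Set.mem_sdiff, Set.mem_union]; tauto
  have hvr : volume.real E' = volume.real E := by
    have h1 := measureReal_sdiff_add_inter (μ := volume) (s := E') hE fE'
    have h2 := measureReal_sdiff_add_inter (μ := volume) (s := E) mE' fE
    rw [hE'E] at h1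
    rw [hEE', Set.inter_comm] at h2
    linarith
  have hv' : volume E' = volume (ball (0 : V) 1) := by
    rw [← hv]; exact (measureReal_eq_measureReal_iff fE' fE).1 hvr
  have hP6 : P ⊆ ball 0 6 := Set.sdiff_subset.trans (ball_subset_ball (by norm_num))
  have hE'6 : E' ⊆ ball 0 6 := Set.union_subset (Set.sdiff_subset.trans hE6) hP6
  have hE'B : E' \ ball 0 1 ⊆ E \ ball 0 1 := by
    rintro x ⟨h1 | h1, h2⟩
    · exact ⟨h1.1, h2⟩
    · exact absurd (hPB h1).1 h2
  have hcl : volume.real (E' \ ball 0 1) ≤ volume.real (E \ ball 0 1) :=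
    measureReal_mono hE'B (measure_ne_top_of_subset Set.sdiff_subset fE)
  obtain ⟨θ, hθ⟩ := exists_norm_eq V (zero_le_one (α := ℝ))
  set A := pot (rk l) (ball 0 1) ((1 / 2 : ℝ) • θ) with hA
  have hslope := H θ (1 / 2) 1 hθ (by norm_num) (by norm_num) (by norm_num) le_rfl
  have hdev : ∀ T : Set V, MeasurableSet T → volume T = volume (ball (0 : V) 1) →
      volume.real (T \ ball 0 1) ≤ volume.real (E \ ball 0 1) →
      ∀ x, |pot (rk l) T x - pot (rk l) (ball 0 1) x| ≤ c / 16 := by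
    intro T mT vT hT x
    have fT : volume T ≠ ⊤ := vT ▸ fB
    have h0 := pot_sub_pot_ball hk mT fT x
    have h1 : volume.real (T \ ball 0 1) ≤ δ' :=
      hT.trans (hclose.le.trans (min_le_right _ _))
    have h2 : volume.real (ball 0 1 \ T) ≤ δ' := by
      rwa [← volume_real_sdiff_comm mT measurableSet_ball vT fT]
    have h3 := Hδ _ (mT.diff measurableSet_ball)
      (measure_ne_top_of_subset Set.sdiff_subset fT) h1 x
    have h4 := Hδ _ (measurableSet_ball.diff mT)
      (measure_ne_top_of_subset Set.sdiff_subset fB) h2 x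
    have h5 := hk.pot_nonneg (T \ ball 0 1) x
    have h6 := hk.pot_nonneg (ball 0 1 \ T) x
    rw [abs_le]; constructor <;> linarith
  have hdE := hdev E hE hv le_rfl
  have hdE' := hdev E' mE' hv' hcl
  have hψP : ∀ x ∈ P, 2 * A - c / 8 ≤ pot (rk l) E x + pot (rk l) E' x := by
    intro x hx
    have h1 : ‖x‖ ≤ ‖(1 / 2 : ℝ) • θ‖ := by
      rw [norm_smul, hθ]
      have : ‖x‖ < 1 / 2 := by simpa using hx.1
      norm_num
      linarith
    have h2 := pot_ball_anti hk h1
    have h3 := abs_le.1 (hdE x)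
    have h4 := abs_le.1 (hdE' x)
    linarith [h3.1, h4.1]
  have hψQ : ∀ x ∈ Q, pot (rk l) E x + pot (rk l) E' x ≤ 2 * A - c + c / 8 := by
    intro x hx
    have h1 : ‖(1 : ℝ) • θ‖ ≤ ‖x‖ := by
      rw [norm_smul, hθ]
      have : ¬ ‖x‖ < 1 := by simpa using (hQE hx).2
      norm_num
      linarith
    have h2 := pot_ball_anti hk h1
    have h3 := abs_le.1 (hdE x)
    have h4 := abs_le.1 (hdE' x)
    linarith [h3.2, h4.2]
  have hiP : IntegrableOn (fun x => pot (rk l) E x + pot (rk l) E' x) P :=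
    (hk.integrableOn_pot hE fP fE).add (hk.integrableOn_pot mE' fP fE')
  have hiQ : IntegrableOn (fun x => pot (rk l) E x + pot (rk l) E' x) Q :=
    (hk.integrableOn_pot hE fQ fE).add (hk.integrableOn_pot mE' fQ fE')
  have hgain := hk.cross_sub_cross hE mE' fE fE'
  rw [hE'E, hEE'] at hgain
  have g1 : (2 * A - c / 8) * volume.real P ≤
      ∫ x in P, (pot (rk l) E x + pot (rk l) E' x) := by
    have := setIntegral_mono_on (integrableOn_const fP) hiP mP hψP
    rwa [setIntegral_const, smul_eq_mul, mul_comm] at this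
  have g2 : (∫ x in Q, (pot (rk l) E x + pot (rk l) E' x)) ≤
      (2 * A - c + c / 8) * volume.real P := by
    have := setIntegral_mono_on hiQ (integrableOn_const fQ) mQ hψQ
    rwa [setIntegral_const, smul_eq_mul, mul_comm, hQP] at this
  have hPn : 0 ≤ volume.real P := measureReal_nonneg
  have hr := riesz hk mE' hv'
  set D := cross (rk l) (ball (0 : V) 1) (ball 0 1) - cross (rk l) E E with hDd
  have hcP : 0 ≤ c * volume.real P := by positivity
  have hPD : c / 2 * volume.real P ≤ D := by nlinarith
  have hPD' : 12 * volume.real P ≤ 24 / c * D := by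
    calc 12 * volume.real P = 24 / c * (c / 2 * volume.real P) := by field_simp; ring
      _ ≤ _ := mul_le_mul_of_nonneg_left hPD (by positivity)
  refine ⟨E', mE', hv', hE'6, ?_, hcl.trans (hclose.le.trans (min_le_left _ _)), by nlinarith,
    ?_, fun e he => ?_⟩
  · intro x hx
    by_cases hxE : x ∈ E
    · refine Or.inl ⟨hxE, fun hxQ => (hQE hxQ).2 (ball_subset_ball (by norm_num) hx)⟩
    · exact Or.inr ⟨hx, hxE⟩
  · rw [volume_real_symmDiff hE mE' fE fE', hE'E, hEE', hQP]
    linarith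
  · have hI : ∀ S : Set V, S ⊆ ball 0 6 → IntegrableOn (fun x : V => inner ℝ x e) S := by
      intro S hS
      simpa using (integrableOn_height he 0 hS).neg
    have hbd : ∀ S : Set V, S ⊆ ball 0 6 → |∫ x in S, inner ℝ x e| ≤ 6 * volume.real S := by
      intro S hS
      rw [← Real.norm_eq_abs]
      refine norm_setIntegral_le_of_norm_le_const
        (measure_ne_top_of_subset hS measure_ball_lt_top.ne).lt_top fun x hx => ?_
      refine (norm_inner_le_norm x e).trans ?_
      have : ‖x‖ < 6 := by simpa using hS hx
      rw [he]; linarith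
    have h1 := setIntegral_sub_setIntegral hE mE' (hI E hE6) (hI E' hE'6)
    rw [hE'E, hEE', hbar e, sub_zero] at h1
    rw [h1]
    have h2 := hbd P hP6
    have h3 := hbd Q (hQE'.trans hE6)
    rw [hQP] at h3
    refine (abs_sub _ _).trans ?_
    linarith

/-- The (normalised) mass of the set `E` on the ray through `x`, up to radius `R`. -/
noncomputable def rayMass (R : ℝ) (E : Set V) (x : V) : ℝ :=
  ∫ r in Set.Ioo 0 R, (Module.finrank ℝ V : ℝ) * r ^ (Module.finrank ℝ V - 1) *
    E.indicator (fun _ => (1 : ℝ)) (r • ‖x‖⁻¹ • x)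

/-- The set whose intersection with the ray through `x` is the interval of mass `p x`. -/
def starSet (p : V → ℝ) : Set V := {x | ‖x‖ ^ Module.finrank ℝ V < p x}

lemma integral_Ioo_pow {n : ℕ} (hn : 0 < n) {a : ℝ} (ha : 0 ≤ a) :
    ∫ r in Set.Ioo 0 a, (n : ℝ) * r ^ (n - 1) = a ^ n := by
  rw [← integral_Ioc_eq_integral_Ioo, ← intervalIntegral.integral_of_le ha,
    intervalIntegral.integral_const_mul, integral_pow]
  have h1 : n - 1 + 1 = n := by omega
  have h2 : ((n - 1 : ℕ) : ℝ) + 1 = n := by exact_mod_cast h1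
  have h3 : (n : ℝ) ≠ 0 := by exact_mod_cast hn.ne'
  rw [h1, h2, zero_pow hn.ne', sub_zero]
  field_simp

lemma integrableOn_Ioo_pow (n : ℕ) (a : ℝ) :
    IntegrableOn (fun r : ℝ => (n : ℝ) * r ^ (n - 1)) (Set.Ioo 0 a) :=
  ((by fun_prop : Continuous fun r : ℝ => (n : ℝ) * r ^ (n - 1)).integrableOn_Icc
    (a := 0) (b := a)).mono_set Set.Ioo_subset_Icc_self

lemma lintegral_Ioo_pow {n : ℕ} (hn : 0 < n) {a : ℝ} (ha : 0 ≤ a) :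
    ∫⁻ r in Set.Ioo 0 a, ENNReal.ofReal (r ^ (n - 1)) = ENNReal.ofReal (a ^ n / n) := by
  have h3 : (n : ℝ) ≠ 0 := by exact_mod_cast hn.ne'
  have h1 : IntegrableOn (fun r : ℝ => r ^ (n - 1)) (Set.Ioo 0 a) :=
    ((by fun_prop : Continuous fun r : ℝ => r ^ (n - 1)).integrableOn_Icc
      (a := 0) (b := a)).mono_set Set.Ioo_subset_Icc_self
  rw [← ofReal_integral_eq_lintegral_ofReal h1 ((ae_restrict_iff' measurableSet_Ioo).2
    (ae_of_all _ fun r hr => pow_nonneg hr.1.le _))]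
  congr 1
  have h2 := integral_Ioo_pow hn ha
  rw [integral_const_mul] at h2
  field_simp
  linarith

section rayMass
variable {R : ℝ} {E : Set V}

lemma rayMass_smul {s : ℝ} (hs : 0 < s) (x : V) : rayMass R E (s • x) = rayMass R E x := by
  have : ‖s • x‖⁻¹ • s • x = ‖x‖⁻¹ • x := by
    rw [norm_smul, Real.norm_of_nonneg hs.le, smul_smul, mul_inv, mul_right_comm,
      inv_mul_cancel₀ hs.ne', one_mul]
  simp only [rayMass, this]

lemma measurable_rayMass (hE : MeasurableSet E) : Measurable (rayMass R E) := by
  have h1 : Measurable fun p : V × ℝ => (Module.finrank ℝ V : ℝ) *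
      p.2 ^ (Module.finrank ℝ V - 1) *
      E.indicator (fun _ => (1 : ℝ)) (p.2 • ‖p.1‖⁻¹ • p.1) := by
    have h2 : Measurable (E.indicator (fun _ : V => (1 : ℝ))) := measurable_const.indicator hE
    have h3 : Measurable fun p : V × ℝ => p.2 • ‖p.1‖⁻¹ • p.1 := by fun_prop
    have h4 := h2.comp h3
    have h5 : Measurable fun p : V × ℝ => (Module.finrank ℝ V : ℝ) *
      p.2 ^ (Module.finrank ℝ V - 1) := by fun_prop
    exact h5.mul h4
  exact (h1.stronglyMeasurable.integral_prod_right (ν := volume.restrict (Set.Ioo 0 R))).measurable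

lemma integrableOn_ray (hE : MeasurableSet E) (x : V) : IntegrableOn (fun r : ℝ =>
    (Module.finrank ℝ V : ℝ) * r ^ (Module.finrank ℝ V - 1) *
    E.indicator (fun _ => (1 : ℝ)) (r • x)) (Set.Ioo 0 R) := by
  have h2 : Measurable (E.indicator (fun _ : V => (1 : ℝ))) := measurable_const.indicator hE
  have h3 : Measurable fun r : ℝ => r • x := by fun_prop
  refine (integrableOn_Ioo_pow (Module.finrank ℝ V) R).mul_bdd (c := 1)
    (h2.comp h3).aestronglyMeasurable (ae_of_all _ fun r => ?_)
  refine (norm_indicator_le_norm_self _ _).trans ?_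
  simp

lemma indicator_one_le (x : V) : E.indicator (fun _ => (1 : ℝ)) x ≤ 1 :=
  Set.indicator_apply_le' (fun _ => le_rfl) (fun _ => zero_le_one)

lemma indicator_one_nonneg (x : V) : 0 ≤ E.indicator (fun _ => (1 : ℝ)) x :=
  Set.indicator_nonneg (fun _ _ => zero_le_one) _

lemma rayMass_nonneg (x : V) : 0 ≤ rayMass R E x :=
  setIntegral_nonneg measurableSet_Ioo fun _ hr =>
    mul_nonneg (mul_nonneg (Nat.cast_nonneg _) (pow_nonneg hr.1.le _)) (indicator_one_nonneg _)

lemma rayMass_le [Nontrivial V] (hR : 0 ≤ R) (hE : MeasurableSet E) (x : V) :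
    rayMass R E x ≤ R ^ Module.finrank ℝ V := by
  rw [← integral_Ioo_pow (Module.finrank_pos (R := ℝ) (M := V)) hR]
  refine setIntegral_mono_on (integrableOn_ray hE _) (integrableOn_Ioo_pow _ _)
    measurableSet_Ioo fun r hr => ?_
  exact mul_le_of_le_one_right (mul_nonneg (Nat.cast_nonneg _) (pow_nonneg hr.1.le _))
    (indicator_one_le _)

lemma le_rayMass [Nontrivial V] {a : ℝ} (ha : 0 ≤ a) (haR : a ≤ R) (hE : MeasurableSet E)
    (h : ball 0 a ⊆ E) (x : V) : a ^ Module.finrank ℝ V ≤ rayMass R E x := by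
  rw [← integral_Ioo_pow (Module.finrank_pos (R := ℝ) (M := V)) ha]
  have h1 : ∫ r in Set.Ioo 0 a, (Module.finrank ℝ V : ℝ) * r ^ (Module.finrank ℝ V - 1) =
      ∫ r in Set.Ioo 0 a, (Module.finrank ℝ V : ℝ) * r ^ (Module.finrank ℝ V - 1) *
        E.indicator (fun _ => (1 : ℝ)) (r • ‖x‖⁻¹ • x) := by
    refine setIntegral_congr_fun measurableSet_Ioo fun r hr => ?_
    have : r • ‖x‖⁻¹ • x ∈ E := h (by
      rw [mem_ball_zero_iff, norm_smul, norm_smul, norm_inv, norm_norm,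
        Real.norm_of_nonneg hr.1.le]
      refine lt_of_le_of_lt (mul_le_of_le_one_right hr.1.le ?_) hr.2
      exact inv_mul_le_one)
    simp [Set.indicator_of_mem this]
  rw [h1]
  refine setIntegral_mono_set (integrableOn_ray hE _) ?_
    (ae_of_all _ (Set.Ioo_subset_Ioo_right haR))
  exact (ae_restrict_iff' measurableSet_Ioo).2 (ae_of_all _ fun r hr => mul_nonneg
    (mul_nonneg (Nat.cast_nonneg _) (pow_nonneg hr.1.le _)) (indicator_one_nonneg _))

lemma lintegral_ray [Nontrivial V] (hE : MeasurableSet E) (hER : E ⊆ ball 0 R) {θ : V}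
    (hθ : ‖θ‖ = 1) :
    ∫⁻ r in Set.Ioi (0 : ℝ), ENNReal.ofReal (r ^ (Module.finrank ℝ V - 1)) *
      E.indicator (fun _ => (1 : ENNReal)) (r • θ) =
    ENNReal.ofReal (rayMass R E θ / Module.finrank ℝ V) := by
  have hn : (0 : ℝ) < Module.finrank ℝ V := by exact_mod_cast Module.finrank_pos
  have h1 := integrableOn_ray (R := R) hE θ
  have h0 : rayMass R E θ / Module.finrank ℝ V = ∫ r in Set.Ioo 0 R,
      r ^ (Module.finrank ℝ V - 1) * E.indicator (fun _ => (1 : ℝ)) (r • θ) := by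
    rw [rayMass, hθ, inv_one, one_smul, ← integral_div]
    congr 1; ext r; field_simp
  have h2 : IntegrableOn (fun r : ℝ => r ^ (Module.finrank ℝ V - 1) *
      E.indicator (fun _ => (1 : ℝ)) (r • θ)) (Set.Ioo 0 R) := by
    have := h1.div_const (Module.finrank ℝ V : ℝ)
    refine this.congr (ae_of_all _ fun r => ?_)
    simp only; field_simp
  rw [h0, ofReal_integral_eq_lintegral_ofReal h2 ((ae_restrict_iff' measurableSet_Ioo).2
    (ae_of_all _ fun r hr => mul_nonneg (pow_nonneg hr.1.le _) (indicator_one_nonneg _)))]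
  rw [← lintegral_indicator measurableSet_Ioi, ← lintegral_indicator measurableSet_Ioo]
  refine lintegral_congr fun r => ?_
  by_cases hr : 0 < r
  · rw [Set.indicator_of_mem (show r ∈ Set.Ioi (0 : ℝ) from hr)]
    by_cases hrE : r • θ ∈ E
    · have : r < R := by
        have := hER hrE
        rwa [mem_ball_zero_iff, norm_smul, hθ, mul_one, Real.norm_of_nonneg hr.le] at this
      rw [Set.indicator_of_mem (show r ∈ Set.Ioo 0 R from ⟨hr, this⟩), Set.indicator_of_mem hrE,
        Set.indicator_of_mem hrE, mul_one, mul_one]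
    · rw [Set.indicator_of_notMem hrE, mul_zero]
      by_cases hrR : r ∈ Set.Ioo 0 R
      · rw [Set.indicator_of_mem hrR, Set.indicator_of_notMem hrE, mul_zero, ENNReal.ofReal_zero]
      · rw [Set.indicator_of_notMem hrR]
  · rw [Set.indicator_of_notMem (show r ∉ Set.Ioi (0 : ℝ) from hr),
      Set.indicator_of_notMem fun h => hr h.1]

lemma setLIntegral_homogeneous [Nontrivial V] (hE : MeasurableSet E) {h : V → ENNReal}
    (hh : Measurable h) (hhom : ∀ (s : ℝ) (x : V), 0 < s → h (s • x) = h x) :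
    ∫⁻ x in E, h x = ∫⁻ θ : sphere (0 : V) 1, h θ * (∫⁻ r in Set.Ioi (0 : ℝ),
      ENNReal.ofReal (r ^ (Module.finrank ℝ V - 1)) *
        E.indicator (fun _ => (1 : ENNReal)) (r • (θ : V))) ∂(volume : Measure V).toSphere := by
  rw [← lintegral_indicator hE, lintegral_polar (hh.indicator hE)]
  refine lintegral_congr fun θ => ?_
  have hm : Measurable fun r : ℝ => ENNReal.ofReal (r ^ (Module.finrank ℝ V - 1)) *
      E.indicator (fun _ => (1 : ENNReal)) (r • (θ : V)) := by
    have h2 : Measurable (E.indicator (fun _ : V => (1 : ENNReal))) :=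
      measurable_const.indicator hE
    have h3 : Measurable fun r : ℝ => r • (θ : V) := by fun_prop
    have h4 : Measurable fun r : ℝ => ENNReal.ofReal (r ^ (Module.finrank ℝ V - 1)) := by fun_prop
    exact h4.mul (h2.comp h3)
  rw [← lintegral_const_mul _ hm]
  refine setLIntegral_congr_fun measurableSet_Ioi fun r hr => ?_
  by_cases hrE : r • (θ : V) ∈ E
  · rw [Set.indicator_of_mem hrE, Set.indicator_of_mem hrE, hhom r θ hr, mul_one, mul_comm]
  · rw [Set.indicator_of_notMem hrE, Set.indicator_of_notMem hrE, mul_zero, mul_zero]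

lemma setLIntegral_rayMass [Nontrivial V] (hE : MeasurableSet E) (hER : E ⊆ ball 0 R)
    {h : V → ENNReal}
    (hh : Measurable h) (hhom : ∀ (s : ℝ) (x : V), 0 < s → h (s • x) = h x) :
    ∫⁻ x in E, h x = ∫⁻ θ : sphere (0 : V) 1,
      h θ * ENNReal.ofReal (rayMass R E θ / Module.finrank ℝ V) ∂(volume : Measure V).toSphere := by
  rw [setLIntegral_homogeneous hE hh hhom]
  refine lintegral_congr fun θ => ?_
  rw [lintegral_ray hE hER (by simp)]

lemma measurableSet_starSet {p : V → ℝ} (hp : Measurable p) : MeasurableSet (starSet p) :=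
  measurableSet_lt (by fun_prop) hp

lemma setLIntegral_starSet [Nontrivial V] {p : V → ℝ} (hp : Measurable p)
    (hphom : ∀ (s : ℝ) (x : V), 0 < s → p (s • x) = p x) {h : V → ENNReal}
    (hh : Measurable h) (hhom : ∀ (s : ℝ) (x : V), 0 < s → h (s • x) = h x) :
    ∫⁻ x in starSet p, h x = ∫⁻ θ : sphere (0 : V) 1,
      h θ * ENNReal.ofReal (p θ / Module.finrank ℝ V) ∂(volume : Measure V).toSphere := by
  rw [setLIntegral_homogeneous (measurableSet_starSet hp) hh hhom]
  refine lintegral_congr fun θ => ?_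
  congr 1
  have hθ : ‖(θ : V)‖ = 1 := by simp
  have hn : 0 < Module.finrank ℝ V := Module.finrank_pos
  have hn' : Module.finrank ℝ V ≠ 0 := hn.ne'
  have hray : ∀ r : ℝ, 0 < r → (r • (θ : V) ∈ starSet p ↔ r ^ Module.finrank ℝ V < p θ) := by
    intro r hr
    simp only [starSet, Set.mem_ofPred_eq]
    rw [hphom r _ hr, norm_smul, hθ, mul_one, Real.norm_of_nonneg hr.le]
  set a : ℝ := (max (p θ) 0) ^ ((Module.finrank ℝ V : ℝ)⁻¹) with ha
  have ha0 : 0 ≤ a := Real.rpow_nonneg (le_max_right _ _) _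
  have han : a ^ Module.finrank ℝ V = max (p θ) 0 :=
    Real.rpow_inv_natCast_pow (le_max_right _ _) hn'
  have hmem : ∀ r : ℝ, 0 < r → (r ^ Module.finrank ℝ V < p θ ↔ r < a) := by
    intro r hr
    have h1 : 0 < r ^ Module.finrank ℝ V := pow_pos hr _
    rw [← pow_lt_pow_iff_left₀ hr.le ha0 hn', han, lt_max_iff]
    constructor
    · exact Or.inl
    · rintro (h | h)
      · exact h
      · exact absurd h (not_lt.2 h1.le)
  have hlast : ENNReal.ofReal (p θ / Module.finrank ℝ V) =
      ENNReal.ofReal (a ^ Module.finrank ℝ V / Module.finrank ℝ V) := by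
    rw [han]
    rcases le_total 0 (p θ) with h | h
    · rw [max_eq_left h]
    · rw [max_eq_right h, zero_div, ENNReal.ofReal_zero, ENNReal.ofReal_of_nonpos]
      exact div_nonpos_of_nonpos_of_nonneg h (Nat.cast_nonneg _)
  rw [hlast, ← lintegral_Ioo_pow hn ha0, ← lintegral_indicator measurableSet_Ioi,
    ← lintegral_indicator measurableSet_Ioo]
  refine lintegral_congr fun r => ?_
  by_cases hr : 0 < r
  · rw [Set.indicator_of_mem (show r ∈ Set.Ioi (0 : ℝ) from hr)]
    by_cases hra : r < a
    · rw [Set.indicator_of_mem (show r ∈ Set.Ioo 0 a from ⟨hr, hra⟩),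
        Set.indicator_of_mem ((hray r hr).2 ((hmem r hr).2 hra)), mul_one]
    · rw [Set.indicator_of_notMem (show r ∉ Set.Ioo 0 a from fun h => hra h.2),
        Set.indicator_of_notMem fun h => hra ((hmem r hr).1 ((hray r hr).1 h)), mul_zero]
  · rw [Set.indicator_of_notMem (show r ∉ Set.Ioi (0 : ℝ) from hr),
      Set.indicator_of_notMem fun h => hr h.1]

lemma ball_eq_starSet [Nontrivial V] : ball (0 : V) 1 = starSet fun _ => 1 := by
  have hn' : Module.finrank ℝ V ≠ 0 := (Module.finrank_pos (R := ℝ) (M := V)).ne'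
  ext x
  simp only [mem_ball_zero_iff, starSet, Set.mem_ofPred_eq]
  rw [pow_lt_one_iff_of_nonneg (norm_nonneg _) hn']

end rayMass

section starSet
variable {R : ℝ} {E : Set V}

lemma setLIntegral_starSet_rayMass [Nontrivial V] (hE : MeasurableSet E) (hER : E ⊆ ball 0 R)
    {h : V → ENNReal}
    (hh : Measurable h) (hhom : ∀ (s : ℝ) (x : V), 0 < s → h (s • x) = h x) :
    ∫⁻ x in starSet (rayMass R E), h x = ∫⁻ x in E, h x := by
  rw [setLIntegral_starSet (measurable_rayMass hE) (fun s x hs => rayMass_smul hs x) hh hhom,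
    setLIntegral_rayMass hE hER hh hhom]

lemma volume_starSet_rayMass [Nontrivial V] (hE : MeasurableSet E) (hER : E ⊆ ball 0 R) :
    volume (starSet (rayMass R E)) = volume E := by
  have := setLIntegral_starSet_rayMass hE hER (measurable_const (a := (1 : ENNReal)))
    (fun _ _ _ => rfl)
  simpa using this

lemma rayMass_mono {E' : Set V} (hE : MeasurableSet E) (hE' : MeasurableSet E') (h : E ⊆ E')
    (x : V) : rayMass R E x ≤ rayMass R E' x :=
  setIntegral_mono_on (integrableOn_ray hE _) (integrableOn_ray hE' _) measurableSet_Ioo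
    fun _ hr => mul_le_mul_of_nonneg_left
      (Set.indicator_le_indicator_of_subset h (fun _ => zero_le_one) _)
      (mul_nonneg (Nat.cast_nonneg _) (pow_nonneg hr.1.le _))

lemma volume_starSet_sdiff_le [Nontrivial V] (hR : 1 ≤ R) (hE : MeasurableSet E)
    (hER : E ⊆ ball 0 R) :
    volume.real (starSet (rayMass R E) \ ball 0 1) ≤ volume.real (E \ ball 0 1) := by
  have fE : volume E ≠ ⊤ := measure_ne_top_of_subset hER measure_ball_lt_top.ne
  have fB : volume (ball (0 : V) 1) ≠ ⊤ := measure_ball_lt_top.ne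
  have mF : MeasurableSet (E ∪ ball 0 1) := hE.union measurableSet_ball
  have hF : E ∪ ball 0 1 ⊆ ball 0 R := Set.union_subset hER (ball_subset_ball hR)
  have fF : volume (E ∪ ball 0 1) ≠ ⊤ := measure_union_ne_top fE fB
  have hv := volume_starSet_rayMass mF hF
  have hs1 : starSet (rayMass R E) ⊆ starSet (rayMass R (E ∪ ball 0 1)) := fun x hx =>
    lt_of_lt_of_le hx (rayMass_mono hE mF Set.subset_union_left x)
  have hs2 : ball (0 : V) 1 ⊆ starSet (rayMass R (E ∪ ball 0 1)) := by
    intro x hx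
    rw [ball_eq_starSet] at hx
    have hx' : ‖x‖ ^ Module.finrank ℝ V < 1 := hx
    have := le_rayMass zero_le_one hR mF Set.subset_union_right x
    rw [one_pow] at this
    exact hx'.trans_le this
  have fS : volume (starSet (rayMass R (E ∪ ball 0 1))) ≠ ⊤ := hv ▸ fF
  have h1 := measureReal_sdiff_add_inter (μ := volume)
    (s := starSet (rayMass R (E ∪ ball 0 1))) (measurableSet_ball (x := (0 : V)) (ε := 1)) fS
  have h2 := measureReal_sdiff_add_inter (μ := volume)
    (s := E ∪ ball 0 1) (measurableSet_ball (x := (0 : V)) (ε := 1)) fF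
  rw [Set.inter_eq_right.2 hs2, Measure.real, Measure.real, Measure.real, hv] at h1
  rw [Set.inter_eq_right.2 Set.subset_union_right, Set.union_sdiff_right, Measure.real,
    Measure.real, Measure.real] at h2
  refine (measureReal_mono (Set.sdiff_subset_sdiff_left hs1)
    (measure_ne_top_of_subset Set.sdiff_subset fS)).trans ?_
  simp only [Measure.real]
  linarith

lemma volume_thin_le [Nontrivial V] {p : V → ℝ} (hp : Measurable p)
    (hphom : ∀ (s : ℝ) (x : V), 0 < s → p (s • x) = p x) (hf : volume (starSet p) ≠ ⊤)
    {s : ℝ} (hs : 0 ≤ s) : volume {x : V | |‖x‖ ^ Module.finrank ℝ V - p x| < s} ≤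
      ENNReal.ofReal (2 * s) * volume (ball (0 : V) 1) := by
  have key : ∀ q : V → ℝ, Measurable q → (∀ (s : ℝ) (x : V), 0 < s → q (s • x) = q x) →
      volume (starSet q) = ∫⁻ θ : sphere (0 : V) 1,
        ENNReal.ofReal (q θ / Module.finrank ℝ V) ∂(volume : Measure V).toSphere := by
    intro q hq hq'
    have := setLIntegral_starSet hq hq' (measurable_const (a := (1 : ENNReal)))
      (fun _ _ _ => rfl)
    simpa using this
  have hU := key (fun x => p x + s) (hp.add_const s) (fun r x hr => by simp only [hphom r x hr])
  have hL := key (fun x => p x - s) (hp.sub_const s) (fun r x hr => by simp only [hphom r x hr])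
  have hB := key (fun _ => 1) measurable_const (fun _ _ _ => rfl)
  rw [← ball_eq_starSet] at hB
  have hLp : starSet (fun x => p x - s) ⊆ starSet p := fun x hx => by
    have : ‖x‖ ^ Module.finrank ℝ V < p x - s := hx
    show ‖x‖ ^ Module.finrank ℝ V < p x
    linarith
  have hLU : starSet (fun x => p x - s) ⊆ starSet (fun x => p x + s) := fun x hx => by
    have : ‖x‖ ^ Module.finrank ℝ V < p x - s := hx
    show ‖x‖ ^ Module.finrank ℝ V < p x + s
    linarith
  have hsub : {x : V | |‖x‖ ^ Module.finrank ℝ V - p x| < s} ⊆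
      starSet (fun x => p x + s) \ starSet (fun x => p x - s) := by
    intro x hx
    have hx' : |‖x‖ ^ Module.finrank ℝ V - p x| < s := hx
    rw [abs_lt] at hx'
    refine ⟨?_, fun h => ?_⟩
    · show ‖x‖ ^ Module.finrank ℝ V < p x + s
      linarith
    · have : ‖x‖ ^ Module.finrank ℝ V < p x - s := h
      linarith
  refine (measure_mono hsub).trans ?_
  rw [measure_sdiff hLU (measurableSet_starSet (hp.sub_const s)).nullMeasurableSet
    (measure_ne_top_of_subset hLp hf), tsub_le_iff_left, hU, hL, hB,
    ← lintegral_const_mul' _ _ ENNReal.ofReal_ne_top, ← lintegral_add_left]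
  · refine lintegral_mono fun θ => ?_
    rw [← ENNReal.ofReal_mul (by linarith)]
    refine le_trans (ENNReal.ofReal_le_ofReal (le_of_eq ?_)) ENNReal.ofReal_add_le
    ring
  · have : Measurable fun x : V => ENNReal.ofReal ((p x - s) / Module.finrank ℝ V) := by
      fun_prop
    exact this.comp measurable_subtype_coe

end starSet

lemma pow_sub_pow_le_mul {L : ℝ} (hL : 1 ≤ L) (n : ℕ) {a b : ℝ} (hb : 0 ≤ b) (hba : b ≤ a)
    (haL : a ≤ L) : a ^ n - b ^ n ≤ n * L ^ n * (a - b) := by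
  induction n with
  | zero => simp
  | succ n ih =>
    have ha : 0 ≤ a := hb.trans hba
    have h1 : b ^ n ≤ L ^ n := pow_le_pow_left₀ hb (hba.trans haL) n
    have h2 : L ^ n ≤ L ^ (n + 1) := pow_le_pow_right₀ hL (Nat.le_succ n)
    have h0 : 0 ≤ a - b := by linarith
    have h3 : 0 ≤ n * L ^ n * (a - b) := by
      have : 0 ≤ L := by linarith
      positivity
    calc a ^ (n + 1) - b ^ (n + 1) = a * (a ^ n - b ^ n) + b ^ n * (a - b) := by ring
      _ ≤ a * (n * L ^ n * (a - b)) + L ^ (n + 1) * (a - b) := by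
        refine add_le_add (mul_le_mul_of_nonneg_left ih ha)
          (mul_le_mul_of_nonneg_right (h1.trans h2) h0)
      _ ≤ L * (n * L ^ n * (a - b)) + L ^ (n + 1) * (a - b) := by
        gcongr
      _ = _ := by push_cast; ring

/-- Making a set starshaped by sorting its mass along rays costs at most the square root of
the deficit. -/
lemma exists_sorted {l : ℝ} (hl : 0 < l) (hn : l + 1 < Module.finrank ℝ V) :
    ∃ C : ℝ, 0 < C ∧ ∃ δ : ℝ, 0 < δ ∧ ∀ E : Set V, MeasurableSet E →
      volume E = volume (ball (0 : V) 1) → E ⊆ ball 0 6 → ball 0 (1 / 2) ⊆ E →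
      volume.real (E \ ball 0 1) ≤ δ →
      volume.real (E \ starSet (rayMass 6 E)) ^ 2 ≤
        C * (cross (rk l) (ball (0 : V) 1) (ball 0 1) - cross (rk l) E E) := by
  have : Nontrivial V := Module.nontrivial_of_finrank_pos (R := ℝ) (by
    have : (0 : ℝ) < Module.finrank ℝ V := by linarith
    exact_mod_cast this)
  have hk := radialKernel_rk (V := V) hl.le (by linarith)
  obtain ⟨c, hc, δ, hδ, H⟩ := exists_pot_slope (V := V) hl hn (show (0 : ℝ) < 6 by norm_num)
  have hω := volume_real_ball_pos (V := V)
  set ω := volume.real (ball (0 : V) 1) with hωd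
  obtain ⟨M, hM, HM⟩ := hk.exists_pot_le (V := V) ω
  have hN : 0 < Module.finrank ℝ V := Module.finrank_pos
  set n := Module.finrank ℝ V with hnd
  have hn' : n ≠ 0 := hN.ne'
  set K : ℝ := n * 6 ^ n with hK
  have hKpos : 0 < K := by positivity
  refine ⟨4 * ω * K / c, by positivity, δ, hδ, fun E hE hv hE6 hhalf hEδ => ?_⟩
  have fB : volume (ball (0 : V) 1) ≠ ⊤ := measure_ball_lt_top.ne
  have fE : volume E ≠ ⊤ := hv ▸ fB
  set q := rayMass 6 E with hq
  have mq : Measurable q := measurable_rayMass hE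
  have hqhom : ∀ (s : ℝ) (x : V), 0 < s → q (s • x) = q x := fun s x hs => rayMass_smul hs x
  set T := starSet q with hT
  have mT : MeasurableSet T := measurableSet_starSet mq
  have vT : volume T = volume (ball (0 : V) 1) := (volume_starSet_rayMass hE hE6).trans hv
  have fT : volume T ≠ ⊤ := vT ▸ fB
  have hTδ : volume.real (T \ ball 0 1) ≤ δ :=
    (volume_starSet_sdiff_le (by norm_num) hE hE6).trans hEδ
  set ρ : V → ℝ := fun x => q x ^ ((n : ℝ)⁻¹) with hρ
  have hq0 : ∀ x, (1 / 2) ^ n ≤ q x := fun x =>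
    le_rayMass (by norm_num) (by norm_num) hE hhalf x
  have hq6 : ∀ x, q x ≤ 6 ^ n := fun x => rayMass_le (by norm_num) hE x
  have hqn : ∀ x, 0 ≤ q x := fun x => rayMass_nonneg x
  have hρ0 : ∀ x, 0 ≤ ρ x := fun x => Real.rpow_nonneg (hqn x) _
  have hρn : ∀ x, ρ x ^ n = q x := fun x => Real.rpow_inv_natCast_pow (hqn x) hn'
  have hρ1 : ∀ x, 1 / 2 ≤ ρ x := fun x =>
    (pow_le_pow_iff_left₀ (by norm_num) (hρ0 x) hn').1 (by rw [hρn]; exact hq0 x)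
  have hρ6 : ∀ x, ρ x ≤ 6 := fun x =>
    (pow_le_pow_iff_left₀ (hρ0 x) (by norm_num) hn').1 (by rw [hρn]; exact hq6 x)
  set ψ : V → ℝ := fun x => pot (rk l) E x + pot (rk l) T x with hψ
  have mψ : Measurable ψ :=
    (hk.stronglyMeasurable_pot E).measurable.add (hk.stronglyMeasurable_pot T).measurable
  have hψ0 : ∀ x, 0 ≤ ψ x := fun x => add_nonneg (hk.pot_nonneg E x) (hk.pot_nonneg T x)
  have hψM : ∀ x, ψ x ≤ M + M := fun x => by
    refine add_le_add (HM E hE fE ?_ x) (HM T mT fT ?_ x)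
    · rw [hωd, Measure.real, Measure.real, hv]
    · rw [hωd, Measure.real, Measure.real, vT]
  set h : V → ℝ := fun x => ψ (ρ x • ‖x‖⁻¹ • x) with hh
  have mh : Measurable h := mψ.comp (by fun_prop)
  have hhhom : ∀ (s : ℝ) (x : V), 0 < s → h (s • x) = h x := by
    intro s x hs
    have h1 : ‖s • x‖⁻¹ • s • x = ‖x‖⁻¹ • x := by
      rw [norm_smul, Real.norm_of_nonneg hs.le, smul_smul, mul_inv, mul_right_comm,
        inv_mul_cancel₀ hs.ne', one_mul]
    simp only [hh, hρ, hqhom s x hs, h1]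
  have hh0 : ∀ x, 0 ≤ h x := fun x => hψ0 _
  have ih : ∀ S : Set V, volume S ≠ ⊤ → IntegrableOn h S := fun S fS =>
    Measure.integrableOn_of_bounded (M := M + M) fS mh.aestronglyMeasurable
      (ae_of_all _ fun x => by rw [Real.norm_of_nonneg (hh0 x)]; exact hψM _)
  have iψ : ∀ S : Set V, volume S ≠ ⊤ → IntegrableOn ψ S := fun S fS =>
    Measure.integrableOn_of_bounded (M := M + M) fS mψ.aestronglyMeasurable
      (ae_of_all _ fun x => by rw [Real.norm_of_nonneg (hψ0 x)]; exact hψM _)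
  have hh_eq : ∫ x in T, h x = ∫ x in E, h x := by
    rw [integral_eq_lintegral_of_nonneg_ae (ae_of_all _ hh0) mh.aestronglyMeasurable,
      integral_eq_lintegral_of_nonneg_ae (ae_of_all _ hh0) mh.aestronglyMeasurable]
    congr 1
    exact setLIntegral_starSet_rayMass hE hE6 mh.ennreal_ofReal
      fun s x hs => by rw [hhhom s x hs]
  have hsplit := setIntegral_sub_setIntegral hE mT (ih E fE) (ih T fT)
  rw [hh_eq, sub_self] at hsplit
  have hgain := hk.cross_sub_cross hE mT fE fT
  have fTE : volume (T \ E) ≠ ⊤ := measure_ne_top_of_subset Set.sdiff_subset fT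
  have fET : volume (E \ T) ≠ ⊤ := measure_ne_top_of_subset Set.sdiff_subset fE
  have hunit : ∀ x : V, x ≠ 0 → ‖‖x‖⁻¹ • x‖ = 1 ∧ ‖x‖ • ‖x‖⁻¹ • x = x := by
    intro x hx
    have hx' : ‖x‖ ≠ 0 := norm_ne_zero_iff.2 hx
    refine ⟨?_, ?_⟩
    · rw [norm_smul, norm_inv, norm_norm, inv_mul_cancel₀ hx']
    · rw [smul_smul, mul_inv_cancel₀ hx', one_smul]
  have hg1 : ∫ x in T \ E, h x ≤ ∫ x in T \ E, ψ x := by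
    refine setIntegral_mono_on (ih _ fTE) (iψ _ fTE) (mT.diff hE) fun x hx => ?_
    have hx0 : x ≠ 0 := by
      rintro rfl
      exact hx.2 (hhalf (by simp))
    obtain ⟨h1, h2⟩ := hunit x hx0
    have h3 : ‖x‖ ≤ ρ x := by
      refine (pow_le_pow_iff_left₀ (norm_nonneg _) (hρ0 x) hn').1 ?_
      rw [hρn]
      exact (show ‖x‖ ^ n < q x from hx.1).le
    have h4 := H E hE hv hEδ _ ‖x‖ (ρ x) h1 (norm_nonneg x) h3 (hρ1 x) (hρ6 x)
    have h5 := H T mT vT hTδ _ ‖x‖ (ρ x) h1 (norm_nonneg x) h3 (hρ1 x) (hρ6 x)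
    rw [h2] at h4 h5
    have h6 : 0 ≤ c * (ρ x - ‖x‖) := mul_nonneg hc.le (by linarith)
    simp only [hh, hψ]
    linarith
  have hg2 : ∀ x ∈ E \ T, 2 * c / K * |‖x‖ ^ n - q x| ≤ h x - ψ x := by
    intro x hx
    have h3' : q x ≤ ‖x‖ ^ n := not_lt.1 hx.2
    have h3 : ρ x ≤ ‖x‖ := by
      refine (pow_le_pow_iff_left₀ (hρ0 x) (norm_nonneg _) hn').1 ?_
      rwa [hρn]
    have hx0 : x ≠ 0 := by
      rintro rfl
      have := hρ1 (0 : V)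
      rw [norm_zero] at h3
      linarith
    obtain ⟨h1, h2⟩ := hunit x hx0
    have hx6 : ‖x‖ ≤ 6 := by
      have := hE6 hx.1
      rw [mem_ball_zero_iff] at this
      exact this.le
    have h4 := H E hE hv hEδ _ (ρ x) ‖x‖ h1 (hρ0 x) h3 ((hρ1 x).trans h3) hx6
    have h5 := H T mT vT hTδ _ (ρ x) ‖x‖ h1 (hρ0 x) h3 ((hρ1 x).trans h3) hx6
    rw [h2] at h4 h5
    have h6 := pow_sub_pow_le_mul (show (1 : ℝ) ≤ 6 by norm_num) n (hρ0 x) h3 hx6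
    rw [hρn, ← hK] at h6
    have h7 : 2 * c / K * |‖x‖ ^ n - q x| ≤ 2 * (c * (‖x‖ - ρ x)) := by
      rw [abs_of_nonneg (by linarith)]
      calc 2 * c / K * (‖x‖ ^ n - q x) ≤ 2 * c / K * (K * (‖x‖ - ρ x)) :=
            mul_le_mul_of_nonneg_left h6 (by positivity)
        _ = _ := by field_simp
    simp only [hh, hψ]
    linarith
  have hr := riesz hk mT vT
  set D := cross (rk l) (ball (0 : V) 1) (ball 0 1) - cross (rk l) E E with hD
  have hD1 : ∫ x in E \ T, (h x - ψ x) ≤ D := by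
    rw [integral_sub (ih _ fET) (iψ _ fET)]
    linarith
  set a := volume.real (E \ T) with ha
  have ha0 : 0 ≤ a := measureReal_nonneg
  set s := a / (4 * ω) with hs
  have hs0 : 0 ≤ s := by positivity
  set W := {x : V | |‖x‖ ^ n - q x| < s} with hW
  have mW : MeasurableSet W := by
    have : Measurable fun x : V => |‖x‖ ^ n - q x| := by
      have : Measurable fun x : V => ‖x‖ ^ n - q x := by fun_prop
      exact this.abs
    exact this measurableSet_Iio
  have hWle : volume.real W ≤ 2 * s * ω := by
    have h1 := volume_thin_le mq hqhom fT hs0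
    have h2 := ENNReal.toReal_mono (ENNReal.mul_ne_top ENNReal.ofReal_ne_top fB) h1
    rwa [ENNReal.toReal_mul, ENNReal.toReal_ofReal (by linarith)] at h2
  have fW : volume W ≠ ⊤ := ((volume_thin_le mq hqhom fT hs0).trans_lt
    (ENNReal.mul_lt_top ENNReal.ofReal_lt_top fB.lt_top)).ne
  have hcut : a / 2 ≤ volume.real ((E \ T) \ W) := by
    have h1 := measureReal_sdiff_add_inter (μ := volume) (s := E \ T) mW fET
    have h2 : volume.real ((E \ T) ∩ W) ≤ volume.real W :=
      measureReal_mono Set.inter_subset_right fW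
    have h3 : 2 * s * ω = a / 2 := by rw [hs]; field_simp; ring
    linarith
  have fC : volume ((E \ T) \ W) ≠ ⊤ := measure_ne_top_of_subset Set.sdiff_subset fET
  have hlow : 2 * c / K * s * (a / 2) ≤ D := by
    calc 2 * c / K * s * (a / 2) ≤ 2 * c / K * s * volume.real ((E \ T) \ W) :=
          mul_le_mul_of_nonneg_left hcut (by positivity)
      _ = ∫ x in (E \ T) \ W, 2 * c / K * s := by rw [setIntegral_const, smul_eq_mul, mul_comm]
      _ ≤ ∫ x in (E \ T) \ W, (h x - ψ x) := by
        refine setIntegral_mono_on (integrableOn_const fC) ((ih _ fC).sub (iψ _ fC))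
          ((hE.diff mT).diff mW) fun x hx => ?_
        refine le_trans ?_ (hg2 x hx.1)
        exact mul_le_mul_of_nonneg_left (not_lt.1 hx.2) (by positivity)
      _ ≤ ∫ x in E \ T, (h x - ψ x) := by
        refine setIntegral_mono_set ((ih _ fET).sub (iψ _ fET)) ?_
          (ae_of_all _ Set.sdiff_subset)
        refine (ae_restrict_iff' (hE.diff mT)).2 (ae_of_all _ fun x hx => ?_)
        exact le_trans (mul_nonneg (by positivity) (abs_nonneg _)) (hg2 x hx)
      _ ≤ D := hD1
  calc a ^ 2 = 4 * ω * K / c * (2 * c / K * s * (a / 2)) := by rw [hs]; field_simp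
    _ ≤ _ := mul_le_mul_of_nonneg_left hlow (by positivity)

lemma norm_refl_zero {e : V} (he : ‖e‖ = 1) (x : V) : ‖refl e 0 x‖ = ‖x‖ := by
  have h := norm_refl_sq he 0 x
  rw [mul_zero, zero_mul, add_zero] at h
  exact (sq_eq_sq₀ (norm_nonneg _) (norm_nonneg _)).1 h

lemma refl_zero_smul (e : V) (r : ℝ) (x : V) : refl e 0 (r • x) = r • refl e 0 x := by
  simp only [refl, inner_smul_left, smul_add, smul_smul]
  congr 2
  simp only [conj_trivial]
  ring

lemma gainSet_subset_ball {e : V} (he : ‖e‖ = 1) {E : Set V} {R : ℝ} (hR : E ⊆ ball 0 R) :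
    gainSet e 0 E ⊆ ball 0 R := fun x hx => by
  have := hR hx.2.2
  rw [mem_ball_zero_iff, norm_refl_zero he] at this
  exact mem_ball_zero_iff.2 this

lemma exists_reflection_moment_le {l : ℝ} (hl : 0 < l) (hn : l + 1 < Module.finrank ℝ V)
    {C₀ : ℝ} (hC₀ : 0 < C₀) :
    ∃ C : ℝ, 0 < C ∧ ∀ E : Set V, MeasurableSet E → volume E = volume (ball (0 : V) 1) →
      E ⊆ ball 0 6 → ∀ D : ℝ, D ≤ 1 →
      cross (rk l) (ball (0 : V) 1) (ball 0 1) - cross (rk l) E E ≤ D →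
      ∀ e : V, ‖e‖ = 1 → |∫ x in E, inner ℝ x e| ≤ C₀ * D →
      (∫ x in keepSet e 0 E, (0 - inner ℝ x e)) + (∫ x in gainSet e 0 E, (0 - inner ℝ x e)) ≤
        C * Real.sqrt D := by
  have : Nontrivial V := Module.nontrivial_of_finrank_pos (R := ℝ) (by
    have : (0 : ℝ) < Module.finrank ℝ V := by linarith
    exact_mod_cast this)
  have hk := radialKernel_rk (V := V) hl.le (by linarith)
  obtain ⟨c, hc, H⟩ := exists_rk_sub_ge hl (show (0 : ℝ) < 2 * 6 by norm_num)
  refine ⟨2 * (Real.sqrt (8 * c)⁻¹ + C₀), by positivity, fun E hE hv hE6 D hD1 hD e he hm => ?_⟩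
  have h1 := polarize_gain he 0 hk hE hE6 H
  have h2 := riesz hk (measurableSet_polarize (e := e) 0 hE)
    ((volume_polarize he 0 hE).trans hv)
  have h0 := riesz hk hE hv
  have hD0 : 0 ≤ D := by linarith
  have h3 := moment_keepSet_sub_gainSet he 0 hE hE6
  have h4 : ∫ x in E, (0 - inner ℝ x e) = -∫ x in E, inner ℝ x e := by
    rw [← integral_neg]
    simp only [zero_sub]
  rw [h4] at h3
  set a := ∫ x in keepSet e 0 E, (0 - inner ℝ x e) with ha
  set b := ∫ x in gainSet e 0 E, (0 - inner ℝ x e) with hb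
  have ha0 : 0 ≤ a := setIntegral_nonneg (measurableSet_keepSet 0 hE) fun x hx => by
    linarith [hx.1]
  have hb0 : 0 ≤ b := setIntegral_nonneg (measurableSet_gainSet 0 hE) fun x hx => by
    linarith [hx.1]
  have hab : a * b ≤ (8 * c)⁻¹ * D := by
    rw [inv_mul_eq_div, le_div_iff₀ (by positivity)]
    linarith
  have hs1 : D ≤ Real.sqrt D := by
    rw [Real.le_sqrt hD0 hD0]
    nlinarith
  have hdiff : |a - b| ≤ C₀ * Real.sqrt D := by
    rw [h3, abs_neg]
    exact hm.trans (mul_le_mul_of_nonneg_left hs1 hC₀.le)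
  rw [abs_le] at hdiff
  have hmin : ∀ u v : ℝ, 0 ≤ u → u ≤ v → u * v ≤ (8 * c)⁻¹ * D →
      u ≤ Real.sqrt (8 * c)⁻¹ * Real.sqrt D := by
    intro u v hu huv h
    rw [← Real.sqrt_mul (by positivity)]
    refine Real.le_sqrt_of_sq_le ?_
    nlinarith
  rcases le_total a b with h | h
  · have := hmin a b ha0 h hab
    nlinarith
  · have := hmin b a hb0 h (by rwa [mul_comm])
    nlinarith

lemma lintegral_reflection_le {e : V} (he : ‖e‖ = 1) {E : Set V} (hE : MeasurableSet E)
    {R : ℝ} (hR : E ⊆ ball 0 R) :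
    ∫⁻ x, ENNReal.ofReal (|inner ℝ x e| *
      |E.indicator (fun _ => (1 : ℝ)) x - E.indicator (fun _ => (1 : ℝ)) (refl e 0 x)|) ≤
    ENNReal.ofReal (2 * ((∫ x in keepSet e 0 E, (0 - inner ℝ x e)) +
      ∫ x in gainSet e 0 E, (0 - inner ℝ x e))) := by
  set A := keepSet e 0 E with hA
  set G := gainSet e 0 E with hG
  have mA : MeasurableSet A := measurableSet_keepSet 0 hE
  have mG : MeasurableSet G := measurableSet_gainSet 0 hE
  have md : Measurable fun x : V => ENNReal.ofReal (0 - inner ℝ x e) := by fun_prop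
  set φ : V → ENNReal := fun x => A.indicator (fun x => ENNReal.ofReal (0 - inner ℝ x e)) x +
    G.indicator (fun x => ENNReal.ofReal (0 - inner ℝ x e)) x with hφ
  have mφ : Measurable φ := (md.indicator mA).add (md.indicator mG)
  have hpt : ∀ x : V, ENNReal.ofReal (|inner ℝ x e| * |E.indicator (fun _ => (1 : ℝ)) x -
      E.indicator (fun _ => (1 : ℝ)) (refl e 0 x)|) ≤ φ x + φ (refl e 0 x) := by
    have key : ∀ x : V, inner ℝ x e < 0 → ENNReal.ofReal (|inner ℝ x e| *
        |E.indicator (fun _ => (1 : ℝ)) x - E.indicator (fun _ => (1 : ℝ)) (refl e 0 x)|) ≤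
        φ x := by
      intro x hx
      by_cases h1 : x ∈ E <;> by_cases h2 : refl e 0 x ∈ E
      · simp [h1, h2]
      · have h3 : x ∈ A := ⟨hx, h1, h2⟩
        simp only [hφ, Set.indicator_of_mem h3, Set.indicator_of_mem h1,
          Set.indicator_of_notMem h2]
        refine le_trans (le_of_eq ?_) le_self_add
        rw [abs_of_neg hx]
        simp
      · have h3 : x ∈ G := ⟨hx, h1, h2⟩
        simp only [hφ, Set.indicator_of_mem h3, Set.indicator_of_notMem h1,
          Set.indicator_of_mem h2]
        refine le_trans (le_of_eq ?_) le_add_self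
        rw [abs_of_neg hx]
        simp
      · simp [h1, h2]
    intro x
    rcases lt_trichotomy (inner ℝ x e) 0 with h | h | h
    · exact (key x h).trans le_self_add
    · simp [h]
    · have h1 := inner_refl he 0 x
      rw [mul_zero, zero_sub] at h1
      have h2 := key (refl e 0 x) (by rw [h1]; linarith)
      rw [refl_refl he, h1, abs_neg, abs_sub_comm] at h2
      exact h2.trans le_add_self
  have h_int : ∀ S : Set V, MeasurableSet S → S ⊆ ball 0 R → (∀ x ∈ S, inner ℝ x e < 0) →
      ∫⁻ x, S.indicator (fun x => ENNReal.ofReal (0 - inner ℝ x e)) x =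
        ENNReal.ofReal (∫ x in S, (0 - inner ℝ x e)) := by
    intro S mS hS hneg
    have hi : IntegrableOn (fun x : V => 0 - inner ℝ x e) S := integrableOn_height he 0 hS
    rw [lintegral_indicator mS, ofReal_integral_eq_lintegral_ofReal hi]
    refine (ae_restrict_iff' mS).2 (ae_of_all _ fun x hx => ?_)
    have := hneg x hx
    show 0 ≤ 0 - inner ℝ x e
    linarith
  have ha0 : 0 ≤ ∫ x in A, (0 - inner ℝ x e) := setIntegral_nonneg mA fun x hx => by
    linarith [hx.1]
  have hb0 : 0 ≤ ∫ x in G, (0 - inner ℝ x e) := setIntegral_nonneg mG fun x hx => by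
    linarith [hx.1]
  refine (lintegral_mono hpt).trans (le_of_eq ?_)
  rw [lintegral_add_left mφ, (measurePreserving_refl he 0).lintegral_comp mφ, ← two_mul,
    ENNReal.ofReal_mul zero_le_two, ENNReal.ofReal_add ha0 hb0, hφ,
    lintegral_add_left (md.indicator mA),
    h_int A mA (fun x hx => hR hx.2.1) (fun x hx => hx.1),
    h_int G mG (gainSet_subset_ball he hR) (fun x hx => hx.1)]
  simp

/-- The asymmetry of the mass along rays under a linear reflection is controlled by that of
the set. -/
lemma lintegral_rayMass_refl_le [Nontrivial V] {e : V} (he : ‖e‖ = 1) {E : Set V}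
    (hE : MeasurableSet E) {R : ℝ} (hhalf : ball 0 (1 / 2) ⊆ E) :
    ∫⁻ x in ball (0 : V) 1, ENNReal.ofReal (|rayMass R E x - rayMass R E (refl e 0 x)| *
      |inner ℝ (‖x‖⁻¹ • x) e|) ≤
    2 * ∫⁻ x, ENNReal.ofReal (|inner ℝ x e| *
      |E.indicator (fun _ => (1 : ℝ)) x - E.indicator (fun _ => (1 : ℝ)) (refl e 0 x)|) := by
  set n := Module.finrank ℝ V with hnd
  have hn : 0 < n := Module.finrank_pos
  have hn' : (n : ℝ) ≠ 0 := by exact_mod_cast hn.ne'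
  have mI : Measurable (E.indicator (fun _ : V => (1 : ℝ))) := measurable_const.indicator hE
  have mq := measurable_rayMass (R := R) hE
  have mσ : Measurable (refl e 0 : V → V) := (continuous_refl e 0).measurable
  have mg : Measurable fun x : V => ENNReal.ofReal (|inner ℝ x e| *
      |E.indicator (fun _ => (1 : ℝ)) x - E.indicator (fun _ => (1 : ℝ)) (refl e 0 x)|) := by
    have h1 : Measurable fun x : V => |E.indicator (fun _ => (1 : ℝ)) x -
        E.indicator (fun _ => (1 : ℝ)) (refl e 0 x)| := (mI.sub (mI.comp mσ)).abs
    have h2 : Measurable fun x : V => |inner ℝ x e| := by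
      have : Measurable fun x : V => inner ℝ x e := by fun_prop
      exact this.abs
    exact (h2.mul h1).ennreal_ofReal
  have mF : Measurable fun x : V => ENNReal.ofReal (|rayMass R E x - rayMass R E (refl e 0 x)| *
      |inner ℝ (‖x‖⁻¹ • x) e|) := by
    have h2 : Measurable fun x : V => |inner ℝ (‖x‖⁻¹ • x) e| := by
      have : Measurable fun x : V => inner ℝ (‖x‖⁻¹ • x) e := by fun_prop
      exact this.abs
    exact ((mq.sub (mq.comp mσ)).abs.mul h2).ennreal_ofReal
  have hFhom : ∀ (s : ℝ) (x : V), 0 < s →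
      ENNReal.ofReal (|rayMass R E (s • x) - rayMass R E (refl e 0 (s • x))| *
        |inner ℝ (‖s • x‖⁻¹ • s • x) e|) =
      ENNReal.ofReal (|rayMass R E x - rayMass R E (refl e 0 x)| *
        |inner ℝ (‖x‖⁻¹ • x) e|) := by
    intro s x hs
    have : ‖s • x‖⁻¹ • s • x = ‖x‖⁻¹ • x := by
      rw [norm_smul, Real.norm_of_nonneg hs.le, smul_smul, mul_inv, mul_right_comm,
        inv_mul_cancel₀ hs.ne', one_mul]
    rw [refl_zero_smul, rayMass_smul hs, rayMass_smul hs, this]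
  rw [ball_eq_starSet, setLIntegral_starSet measurable_const (fun _ _ _ => rfl) mF hFhom,
    lintegral_polar mg, ← lintegral_const_mul' _ _ (by norm_num)]
  refine lintegral_mono fun θ => ?_
  have hθ : ‖(θ : V)‖ = 1 := by simp
  have hσθ : ‖refl e 0 (θ : V)‖ = 1 := by rw [norm_refl_zero he, hθ]
  rw [← lintegral_const_mul' _ _ (by norm_num)]
  have hq : ∀ v : V, ‖v‖ = 1 → rayMass R E v = ∫ r in Set.Ioo 0 R, (n : ℝ) * r ^ (n - 1) *
      E.indicator (fun _ => (1 : ℝ)) (r • v) := by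
    intro v hv
    rw [rayMass, hv, inv_one, one_smul]
  have hsub : rayMass R E θ - rayMass R E (refl e 0 (θ : V)) =
      ∫ r in Set.Ioo 0 R, (n : ℝ) * r ^ (n - 1) * (E.indicator (fun _ => (1 : ℝ)) (r • (θ : V)) -
        E.indicator (fun _ => (1 : ℝ)) (refl e 0 (r • (θ : V)))) := by
    rw [hq _ hθ, hq _ hσθ, ← integral_sub (integrableOn_ray hE _) (integrableOn_ray hE _)]
    refine integral_congr_ae (ae_of_all _ fun r => ?_)
    simp only [refl_zero_smul]
    ring
  have hle : ENNReal.ofReal |rayMass R E θ - rayMass R E (refl e 0 (θ : V))| ≤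
      ∫⁻ r in Set.Ioo 0 R, ENNReal.ofReal (n * r ^ (n - 1) *
        |E.indicator (fun _ => (1 : ℝ)) (r • (θ : V)) -
          E.indicator (fun _ => (1 : ℝ)) (refl e 0 (r • (θ : V)))|) := by
    rw [hsub, ← Real.norm_eq_abs, ofReal_norm]
    refine (enorm_integral_le_lintegral_enorm _).trans ?_
    refine setLIntegral_mono' measurableSet_Ioo fun r hr => ?_
    rw [← ofReal_norm, norm_mul, Real.norm_of_nonneg
      (mul_nonneg (Nat.cast_nonneg _) (pow_nonneg hr.1.le _)), Real.norm_eq_abs]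
  rw [hθ, inv_one, one_smul, ENNReal.ofReal_mul (abs_nonneg _), mul_assoc,
    ← ENNReal.ofReal_mul (abs_nonneg _)]
  calc _ ≤ (∫⁻ r in Set.Ioo 0 R, ENNReal.ofReal (n * r ^ (n - 1) *
        |E.indicator (fun _ => (1 : ℝ)) (r • (θ : V)) -
          E.indicator (fun _ => (1 : ℝ)) (refl e 0 (r • (θ : V)))|)) *
          ENNReal.ofReal (|inner ℝ (θ : V) e| * (1 / n)) := by gcongr
    _ = ∫⁻ r in Set.Ioo 0 R, ENNReal.ofReal (n * r ^ (n - 1) *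
        |E.indicator (fun _ => (1 : ℝ)) (r • (θ : V)) -
          E.indicator (fun _ => (1 : ℝ)) (refl e 0 (r • (θ : V)))|) *
          ENNReal.ofReal (|inner ℝ (θ : V) e| * (1 / n)) :=
        (lintegral_mul_const' _ _ ENNReal.ofReal_ne_top).symm
    _ ≤ ∫⁻ r in Set.Ioo 0 R, 2 * (ENNReal.ofReal (r ^ (n - 1)) *
        ENNReal.ofReal (|inner ℝ (r • (θ : V)) e| *
        |E.indicator (fun _ => (1 : ℝ)) (r • (θ : V)) -
          E.indicator (fun _ => (1 : ℝ)) (refl e 0 (r • (θ : V)))|)) := by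
      refine setLIntegral_mono' measurableSet_Ioo fun r hr => ?_
      have hr0 : 0 ≤ r ^ (n - 1) := pow_nonneg hr.1.le _
      rw [← ENNReal.ofReal_mul (mul_nonneg (mul_nonneg (Nat.cast_nonneg _) hr0) (abs_nonneg _)),
        ← ENNReal.ofReal_mul hr0, ← ENNReal.ofReal_ofNat 2, ← ENNReal.ofReal_mul zero_le_two]
      refine ENNReal.ofReal_le_ofReal ?_
      rcases lt_or_ge r (1 / 2) with h | h
      · have h1 : r • (θ : V) ∈ E := hhalf (by
          rw [mem_ball_zero_iff, norm_smul, hθ, mul_one, Real.norm_of_nonneg hr.1.le]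
          exact h)
        have h2 : refl e 0 (r • (θ : V)) ∈ E := hhalf (by
          rw [mem_ball_zero_iff, norm_refl_zero he, norm_smul, hθ, mul_one,
            Real.norm_of_nonneg hr.1.le]
          exact h)
        rw [Set.indicator_of_mem h1, Set.indicator_of_mem h2]
        simp
      · rw [inner_smul_left, conj_trivial, abs_mul, abs_of_nonneg hr.1.le]
        set z := |E.indicator (fun _ => (1 : ℝ)) (r • (θ : V)) -
          E.indicator (fun _ => (1 : ℝ)) (refl e 0 (r • (θ : V)))| with hz
        have hz0 : 0 ≤ z := abs_nonneg _
        calc n * r ^ (n - 1) * z * (|inner ℝ (θ : V) e| * (1 / n))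
            = 1 * (r ^ (n - 1) * z * |inner ℝ (θ : V) e|) := by field_simp
          _ ≤ (2 * r) * (r ^ (n - 1) * z * |inner ℝ (θ : V) e|) := by
            gcongr
            linarith
          _ = _ := by ring
    _ ≤ _ := lintegral_mono_set Set.Ioo_subset_Ioi_self

section Mirror

variable {u : V} (hu : ‖u‖ = 1)

include hu in
lemma norm_sub_norm_smul_sq (y : V) :
    ‖y - ‖y‖ • u‖ ^ 2 = -2 * ‖y‖ * inner ℝ u (y - ‖y‖ • u) := by
  rw [norm_sub_sq_real, inner_sub_right, inner_smul_right, inner_smul_right, norm_smul, norm_norm,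
    hu, real_inner_self_eq_norm_sq, hu, real_inner_comm u y]
  ring

include hu in
lemma inner_sub_norm_smul (y : V) : inner ℝ u (y - ‖y‖ • u) = inner ℝ u y - ‖y‖ := by
  rw [inner_sub_right, inner_smul_right, real_inner_self_eq_norm_sq, hu]
  ring

include hu in
lemma injOn_sub_norm_smul {Z : Set V} (hcos : ∀ y ∈ Z, inner ℝ u y < ‖y‖) :
    Set.InjOn (fun y : V => y - ‖y‖ • u) Z := by
  intro y hy y' hy' h
  have h' : y - ‖y‖ • u = y' - ‖y'‖ • u := h
  have h1 := norm_sub_norm_smul_sq hu y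
  have h2 := norm_sub_norm_smul_sq hu y'
  rw [← h'] at h2
  have h3 : inner ℝ u (y - ‖y‖ • u) < 0 := by
    rw [inner_sub_norm_smul hu]
    linarith [hcos y hy]
  have h4 : ‖y‖ = ‖y'‖ := by
    refine mul_right_cancel₀ h3.ne ?_
    linarith
  rw [h4] at h'
  exact sub_left_injective h'

lemma hasFDerivAt_sub_norm_smul (u : V) {y : V} (hy : y ≠ 0) :
    HasFDerivAt (fun y : V => y - ‖y‖ • u)
      (ContinuousLinearMap.id ℝ V - (‖y‖⁻¹ • innerSL ℝ y).smulRight u) y := by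
  have h1 : HasFDerivAt (fun y : V => ‖y‖) (‖y‖⁻¹ • innerSL ℝ y) y := by
    have h := ((hasStrictFDerivAt_norm_sq y).hasFDerivAt).sqrt
      (pow_ne_zero 2 (norm_ne_zero_iff.2 hy))
    simp only [Real.sqrt_sq (norm_nonneg _)] at h
    convert h using 1
    have : ‖y‖ ≠ 0 := norm_ne_zero_iff.2 hy
    ext z
    simp
    field_simp
  exact (hasFDerivAt_id y).sub (h1.smul_const u)

lemma det_id_sub_smulRight (f : V →L[ℝ] ℝ) (u : V) :
    (ContinuousLinearMap.id ℝ V - f.smulRight u).det = 1 - f u := by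
  have h : ((ContinuousLinearMap.id ℝ V - f.smulRight u : V →L[ℝ] V) : V →ₗ[ℝ] V) =
      LinearMap.transvection (-(f : V →ₗ[ℝ] ℝ)) u := by
    ext z
    simp [LinearMap.transvection.apply, sub_eq_add_neg]
  rw [ContinuousLinearMap.det, h, LinearMap.transvection.det]
  simp [sub_eq_add_neg]

include hu in
/-- Change of variables in the map sending a point to the normal of the linear hyperplane
in which its direction is the mirror image of `u`. -/
lemma setLIntegral_sub_norm_smul_le {Z : Set V} (mZ : MeasurableSet Z) (hZ : Z ⊆ ball 0 1)
    (h0 : (0 : V) ∉ Z) (hcos : ∀ y ∈ Z, inner ℝ u y ≤ 4 / 5 * ‖y‖) (g : V → ENNReal) :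
    ∫⁻ y in Z, g (y - ‖y‖ • u) ≤ 5 * ∫⁻ e in ball (0 : V) 2, g e := by
  have hpos : ∀ y ∈ Z, 0 < ‖y‖ := fun y hy => norm_pos_iff.2 fun h => h0 (h ▸ hy)
  have hcos' : ∀ y ∈ Z, inner ℝ u y < ‖y‖ := fun y hy => by
    linarith [hpos y hy, hcos y hy]
  have key := lintegral_image_eq_lintegral_abs_det_fderiv_mul (volume : Measure V) mZ
    (fun y hy => (hasFDerivAt_sub_norm_smul u (norm_pos_iff.1 (hpos y hy))).hasFDerivWithinAt)
    (injOn_sub_norm_smul hu hcos') g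
  have himg : (fun y : V => y - ‖y‖ • u) '' Z ⊆ ball 0 2 := by
    rintro _ ⟨y, hy, rfl⟩
    have := hZ hy
    rw [mem_ball_zero_iff] at this ⊢
    refine (norm_sub_le _ _).trans_lt ?_
    rw [norm_smul, norm_norm, hu]
    linarith
  refine le_trans ?_ (mul_le_mul_right (lintegral_mono_set himg) 5)
  rw [key, ← lintegral_const_mul' _ _ (by norm_num)]
  refine setLIntegral_mono' mZ fun y hy => ?_
  rw [det_id_sub_smulRight, ← mul_assoc]
  refine le_mul_of_one_le_left (zero_le) ?_
  have h1 : (1 : ℝ) / 5 ≤ 1 - (‖y‖⁻¹ • innerSL ℝ y) u := by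
    have h2 : (‖y‖⁻¹ • innerSL ℝ y) u = inner ℝ u y / ‖y‖ := by
      simp [real_inner_comm, div_eq_inv_mul]
    rw [h2]
    have := (div_le_iff₀ (hpos y hy)).2 (hcos y hy)
    linarith
  rw [← ENNReal.ofReal_ofNat 5, ← ENNReal.ofReal_mul (by norm_num), ← ENNReal.ofReal_one]
  refine ENNReal.ofReal_le_ofReal ?_
  rw [abs_of_nonneg (by linarith)]
  linarith

end Mirror

/-- The reflection whose mirror has normal `y / ‖y‖ - x / ‖x‖` takes the direction of `x` to
that of `y`. -/
lemma refl_direction {x y e : V} (hx : x ≠ 0) (hy : y ≠ 0)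
    (he : e = y - ‖y‖ • ‖x‖⁻¹ • x)
    (hcos : inner ℝ (‖x‖⁻¹ • x) y ≤ 4 / 5 * ‖y‖) :
    e ≠ 0 ∧ refl (‖e‖⁻¹ • e) 0 x = (‖x‖ * ‖y‖⁻¹) • y ∧
      3 / 10 ≤ |inner ℝ (‖x‖⁻¹ • x) (‖e‖⁻¹ • e)| := by
  have hx' : 0 < ‖x‖ := norm_pos_iff.2 hx
  have hy' : 0 < ‖y‖ := norm_pos_iff.2 hy
  set u := ‖x‖⁻¹ • x with hud
  have hu : ‖u‖ = 1 := by
    rw [hud, norm_smul, norm_inv, norm_norm, inv_mul_cancel₀ hx'.ne']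
  have h1 := norm_sub_norm_smul_sq hu y
  have h2 := inner_sub_norm_smul hu y
  rw [← he] at h1 h2
  set p := inner ℝ u e with hp
  have hp1 : p ≤ -(1 / 5) * ‖y‖ := by linarith
  have hp0 : p < 0 := by nlinarith
  have he2 : 0 < ‖e‖ ^ 2 := by rw [h1]; nlinarith
  have he0 : e ≠ 0 := by
    rintro h
    rw [h, norm_zero] at he2
    norm_num at he2
  have he' : 0 < ‖e‖ := norm_pos_iff.2 he0
  have hxu : x = ‖x‖ • u := by rw [hud, smul_smul, mul_inv_cancel₀ hx'.ne', one_smul]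
  refine ⟨he0, ?_, ?_⟩
  · have h3 : inner ℝ x (‖e‖⁻¹ • e) = ‖e‖⁻¹ * (‖x‖ * p) := by
      conv_lhs => rw [hxu]
      rw [inner_smul_left, inner_smul_right, conj_trivial]
      ring
    have h4 : 2 * (0 - ‖e‖⁻¹ * (‖x‖ * p)) * ‖e‖⁻¹ = ‖x‖ * ‖y‖⁻¹ := by
      have : ‖e‖⁻¹ * ‖e‖⁻¹ = (-2 * ‖y‖ * p)⁻¹ := by rw [← h1]; field_simp
      calc 2 * (0 - ‖e‖⁻¹ * (‖x‖ * p)) * ‖e‖⁻¹ = -2 * ‖x‖ * p * (‖e‖⁻¹ * ‖e‖⁻¹) := by ring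
        _ = _ := by rw [this]; field_simp [hp0.ne]
    rw [refl, h3, smul_smul, h4]
    rw [he, smul_sub, smul_smul, mul_assoc, inv_mul_cancel₀ hy'.ne', mul_one, ← hxu]
    abel
  · rw [inner_smul_right, ← hp, abs_mul, abs_of_neg hp0, abs_of_pos (inv_pos.2 he'),
      inv_mul_eq_div, le_div_iff₀ he']
    refine le_of_sq_le_sq ?_ (by linarith)
    rw [mul_pow, h1]
    nlinarith

section Oscillation

variable {q : V → ℝ} (mq : Measurable q)
  (hq : ∀ (s : ℝ) (x : V), 0 < s → q (s • x) = q x) {M : ENNReal}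
  (hM : ∀ e : V, ‖e‖ = 1 → ∫⁻ x in ball (0 : V) 1, ENNReal.ofReal (|q x - q (refl e 0 x)| *
    |inner ℝ (‖x‖⁻¹ • x) e|) ≤ M)

include mq in
lemma measurable_abs_sub : Measurable fun p : V × V => ENNReal.ofReal |q p.2 - q p.1| :=
  ((mq.comp measurable_snd).sub (mq.comp measurable_fst)).abs.ennreal_ofReal

include mq hq hM in
lemma lintegral_lintegral_abs_sub_le {X Z : Set V} (mX : MeasurableSet X) (mZ : MeasurableSet Z)
    (hX : X ⊆ ball 0 1) (hZ : Z ⊆ ball 0 1) (hX0 : (0 : V) ∉ X) (hZ0 : (0 : V) ∉ Z)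
    (hcos : ∀ x ∈ X, ∀ y ∈ Z, inner ℝ (‖x‖⁻¹ • x) y ≤ 4 / 5 * ‖y‖) :
    ∫⁻ y in Z, (∫⁻ x in X, ENNReal.ofReal |q x - q y|) ≤
      20 * volume (ball (0 : V) 2) * M := by
  set Φ : V → V → ENNReal := fun e x => ENNReal.ofReal
    (|q x - q (refl (‖e‖⁻¹ • e) 0 x)| * |inner ℝ (‖x‖⁻¹ • x) (‖e‖⁻¹ • e)|) with hΦ
  have mΦ : Measurable (Function.uncurry Φ) := by
    have h1 : Measurable fun p : V × V => refl (‖p.1‖⁻¹ • p.1) 0 p.2 := by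
      unfold refl
      fun_prop
    have h2 : Measurable fun p : V × V => inner ℝ (‖p.2‖⁻¹ • p.2) (‖p.1‖⁻¹ • p.1) := by
      fun_prop
    exact (((mq.comp measurable_snd).sub (mq.comp h1)).abs.mul h2.abs).ennreal_ofReal
  rw [lintegral_lintegral_swap (measurable_abs_sub mq).aemeasurable]
  calc ∫⁻ x in X, (∫⁻ y in Z, ENNReal.ofReal |q x - q y|)
      ≤ ∫⁻ x in X, 20 * ∫⁻ e in ball (0 : V) 2, Φ e x := by
        refine setLIntegral_mono' mX fun x hx => ?_
        have hx0 : x ≠ 0 := fun h => hX0 (h ▸ hx)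
        have hu : ‖‖x‖⁻¹ • x‖ = 1 := by
          rw [norm_smul, norm_inv, norm_norm, inv_mul_cancel₀ (norm_ne_zero_iff.2 hx0)]
        have h1 := setLIntegral_sub_norm_smul_le hu mZ hZ hZ0 (hcos x hx) (fun e => 4 * Φ e x)
        have h5 : ∫⁻ e in ball (0 : V) 2, 4 * Φ e x = 4 * ∫⁻ e in ball (0 : V) 2, Φ e x :=
          lintegral_const_mul' _ _ (by norm_num)
        have h6 : (5 : ENNReal) * 4 = 20 := by norm_num
        rw [h5, ← mul_assoc, h6] at h1
        refine le_trans (setLIntegral_mono' mZ fun y hy => ?_) h1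
        have hy0 : y ≠ 0 := fun h => hZ0 (h ▸ hy)
        obtain ⟨-, h2, h3⟩ := refl_direction hx0 hy0 rfl (hcos x hx y hy)
        have h4 : 0 < ‖x‖ * ‖y‖⁻¹ :=
          mul_pos (norm_pos_iff.2 hx0) (inv_pos.2 (norm_pos_iff.2 hy0))
        simp only [hΦ, h2, hq _ y h4]
        rw [← ENNReal.ofReal_ofNat 4, ← ENNReal.ofReal_mul (by norm_num)]
        refine ENNReal.ofReal_le_ofReal ?_
        have := mul_le_mul_of_nonneg_left h3 (abs_nonneg (q x - q y))
        linarith [abs_nonneg (q x - q y)]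
    _ = 20 * ∫⁻ e in ball (0 : V) 2, (∫⁻ x in X, Φ e x) := by
        rw [lintegral_const_mul' _ _ (by norm_num), lintegral_lintegral_swap mΦ.aemeasurable]
    _ ≤ 20 * ∫⁻ e in ball (0 : V) 2, M := by
        gcongr with e
        rcases eq_or_ne e 0 with rfl | he
        · simp [hΦ]
        · refine (lintegral_mono_set hX).trans (hM _ ?_)
          rw [norm_smul, norm_inv, norm_norm, inv_mul_cancel₀ (norm_ne_zero_iff.2 he)]
    _ = _ := by rw [setLIntegral_const]; ring

end Oscillation

/-- A degree zero homogeneous function that is almost invariant under all linear reflections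
is almost constant. -/
lemma exists_almost_const [Nontrivial V] : ∃ C : ENNReal, C ≠ ⊤ ∧ ∀ q : V → ℝ, Measurable q →
    (∀ (s : ℝ) (x : V), 0 < s → q (s • x) = q x) → ∀ M : ENNReal,
    (∀ e : V, ‖e‖ = 1 → ∫⁻ x in ball (0 : V) 1, ENNReal.ofReal (|q x - q (refl e 0 x)| *
      |inner ℝ (‖x‖⁻¹ • x) e|) ≤ M) →
    ∃ a : ℝ, ∫⁻ x in ball (0 : V) 1, ENNReal.ofReal |q x - a| ≤ C * M := by
  obtain ⟨e, he⟩ := exists_norm_eq V zero_le_one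
  have hee : inner ℝ e e = 1 := by rw [real_inner_self_eq_norm_sq, he, one_pow]
  set Zp := ball ((3 / 4 : ℝ) • e) (1 / 8) with hZp
  set Zm := ball ((-(3 / 4) : ℝ) • e) (1 / 8) with hZm
  set v₂ := volume (ball (0 : V) 2) with hv₂
  set z := volume (ball (0 : V) (1 / 8)) with hz
  set ω := volume (ball (0 : V) 1) with hω
  have hz0 : z ≠ 0 := (measure_ball_pos _ _ (by norm_num)).ne'
  have hzt : z ≠ ⊤ := measure_ball_lt_top.ne
  have hzi : z⁻¹ ≠ ⊤ := ENNReal.inv_ne_top.2 hz0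
  have hωt : ω ≠ ⊤ := measure_ball_lt_top.ne
  have hv₂t : v₂ ≠ ⊤ := measure_ball_lt_top.ne
  have hZpz : volume Zp = z := Measure.addHaar_ball_center _ _ _
  have hZmz : volume Zm = z := Measure.addHaar_ball_center _ _ _
  set Xm : Set V := {x | x ∈ ball (0 : V) 1 ∧ x ≠ 0 ∧ inner ℝ x e ≤ ‖x‖ / 2} with hXm
  set Xp : Set V := {x | x ∈ ball (0 : V) 1 ∧ x ≠ 0 ∧ inner ℝ x (-e) ≤ ‖x‖ / 2} with hXp
  have mX : ∀ e' : V, MeasurableSet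
      {x : V | x ∈ ball (0 : V) 1 ∧ x ≠ 0 ∧ inner ℝ x e' ≤ ‖x‖ / 2} := fun e' => by
    have h1 : Measurable fun x : V => inner ℝ x e' := by fun_prop
    have h2 : Measurable fun x : V => ‖x‖ / 2 := by fun_prop
    exact measurableSet_ball.inter ((measurableSet_singleton 0).compl.inter
      (measurableSet_le h1 h2))
  have mXm : MeasurableSet Xm := mX e
  have mXp : MeasurableSet Xp := mX (-e)
  have hcap : ∀ e' : V, ‖e'‖ = 1 → ∀ y ∈ ball ((3 / 4 : ℝ) • e') (1 / 8),
      y ∈ ball (0 : V) 1 ∧ y ≠ 0 ∧ inner ℝ y (-e') ≤ ‖y‖ / 2 ∧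
      ∀ x : V, x ≠ 0 → inner ℝ x e' ≤ ‖x‖ / 2 → inner ℝ (‖x‖⁻¹ • x) y ≤ 4 / 5 * ‖y‖ := by
    intro e' he' y hy
    rw [mem_ball_iff_norm] at hy
    have h34 : ‖(3 / 4 : ℝ) • e'‖ = 3 / 4 := by
      rw [norm_smul, he', Real.norm_of_nonneg (by norm_num), mul_one]
    have hdec : y = (y - (3 / 4 : ℝ) • e') + (3 / 4 : ℝ) • e' := by abel
    have h1 : ‖y‖ ≤ ‖y - (3 / 4 : ℝ) • e'‖ + 3 / 4 := by
      have := norm_add_le (y - (3 / 4 : ℝ) • e') ((3 / 4 : ℝ) • e')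
      rwa [← hdec, h34] at this
    have h2 : 3 / 4 - ‖y - (3 / 4 : ℝ) • e'‖ ≤ ‖y‖ := by
      have := norm_sub_norm_le ((3 / 4 : ℝ) • e') y
      rw [h34, norm_sub_rev] at this
      linarith
    have h3 : 5 / 8 ≤ ‖y‖ := by linarith
    refine ⟨?_, ?_, ?_, fun x hx hxe => ?_⟩
    · rw [mem_ball_zero_iff]
      linarith
    · rintro rfl
      rw [norm_zero] at h3
      linarith
    · have h4 : inner ℝ y (-e') = inner ℝ (y - (3 / 4 : ℝ) • e') (-e') - 3 / 4 := by
        rw [inner_sub_left, inner_smul_left, inner_neg_right e' e', real_inner_self_eq_norm_sq, he']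
        simp
      have h5 := real_inner_le_norm (y - (3 / 4 : ℝ) • e') (-e')
      rw [norm_neg, he'] at h5
      linarith
    · have hx' : 0 < ‖x‖ := norm_pos_iff.2 hx
      have hu : ‖‖x‖⁻¹ • x‖ = 1 := by
        rw [norm_smul, norm_inv, norm_norm, inv_mul_cancel₀ hx'.ne']
      have h4 : inner ℝ (‖x‖⁻¹ • x) y =
          inner ℝ (‖x‖⁻¹ • x) (y - (3 / 4 : ℝ) • e') + 3 / 4 * (‖x‖⁻¹ * inner ℝ x e') := by
        conv_lhs => rw [hdec]
        rw [inner_add_right]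
        simp only [inner_smul_left, inner_smul_right, conj_trivial]
      have h5 := real_inner_le_norm (‖x‖⁻¹ • x) (y - (3 / 4 : ℝ) • e')
      rw [hu, one_mul] at h5
      have h6 : ‖x‖⁻¹ * inner ℝ x e' ≤ 1 / 2 := by
        rw [inv_mul_le_iff₀ hx']
        linarith
      linarith
  have hp := hcap e he
  have hm := hcap (-e) (by rw [norm_neg, he])
  rw [smul_neg, ← neg_smul] at hm
  have hZmX : Zm ⊆ Xm := fun y hy => by
    have := (hm y hy).2.2.1
    rw [neg_neg] at this
    exact ⟨(hm y hy).1, (hm y hy).2.1, this⟩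
  have hcover : ball (0 : V) 1 ⊆ (Xm ∪ Xp) ∪ {0} := by
    intro x hx
    by_cases hx0 : x = 0
    · exact Or.inr hx0
    · left
      rcases le_total (inner ℝ x e) 0 with h | h
      · exact Or.inl ⟨hx, hx0, by linarith [norm_nonneg x]⟩
      · refine Or.inr ⟨hx, hx0, ?_⟩
        rw [inner_neg_right]
        linarith [norm_nonneg x]
  set K := z⁻¹ * (20 * v₂) with hK
  set K' := z⁻¹ * (K + 20 * v₂) with hK'
  have hKt : K ≠ ⊤ := ENNReal.mul_ne_top hzi (ENNReal.mul_ne_top (by norm_num) hv₂t)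
  have hKt' : K' ≠ ⊤ := ENNReal.mul_ne_top hzi
    (ENNReal.add_ne_top.2 ⟨hKt, ENNReal.mul_ne_top (by norm_num) hv₂t⟩)
  refine ⟨K + (K' + K' * ω), ENNReal.add_ne_top.2 ⟨hKt, ENNReal.add_ne_top.2
    ⟨hKt', ENNReal.mul_ne_top hKt' hωt⟩⟩, fun q mq hq M hM => ?_⟩
  have hmeas : ∀ X : Set V, Measurable fun y : V => ∫⁻ x in X, ENNReal.ofReal |q x - q y| :=
    fun X => (measurable_abs_sub mq).lintegral_prod_right'
  have hIp : ∫⁻ y in Zp, (∫⁻ x in Xm, ENNReal.ofReal |q x - q y|) ≤ 20 * v₂ * M :=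
    lintegral_lintegral_abs_sub_le mq hq hM mXm measurableSet_ball (fun x hx => hx.1)
      (fun y hy => (hp y hy).1) (fun h => h.2.1 rfl) (fun h => (hp 0 h).2.1 rfl)
      (fun x hx y hy => (hp y hy).2.2.2 x hx.2.1 hx.2.2)
  have hIm : ∫⁻ y in Zm, (∫⁻ x in Xp, ENNReal.ofReal |q x - q y|) ≤ 20 * v₂ * M :=
    lintegral_lintegral_abs_sub_le mq hq hM mXp measurableSet_ball (fun x hx => hx.1)
      (fun y hy => (hm y hy).1) (fun h => h.2.1 rfl) (fun h => (hm 0 h).2.1 rfl)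
      (fun x hx y hy => (hm y hy).2.2.2 x hx.2.1 hx.2.2)
  obtain ⟨y₁, -, hy₁⟩ := exists_le_setLAverage (μ := (volume : Measure V)) (s := Zp)
    (by rwa [hZpz]) (by rwa [hZpz]) (hmeas Xm).aemeasurable
  rw [setLAverage_eq, hZpz, ENNReal.div_eq_inv_mul] at hy₁
  have h1 : ∫⁻ x in Xm, ENNReal.ofReal |q x - q y₁| ≤ K * M := by
    refine hy₁.trans ?_
    rw [hK, mul_assoc]
    gcongr
  have mone : Measurable fun y : V => ENNReal.ofReal |q y - q y₁| :=
    (mq.sub_const _).abs.ennreal_ofReal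
  obtain ⟨y₂, -, hy₂⟩ := exists_le_setLAverage (μ := (volume : Measure V)) (s := Zm)
    (f := fun y => ENNReal.ofReal |q y - q y₁| + ∫⁻ x in Xp, ENNReal.ofReal |q x - q y|)
    (by rwa [hZmz]) (by rwa [hZmz]) (mone.add (hmeas Xp)).aemeasurable
  rw [setLAverage_eq, hZmz, ENNReal.div_eq_inv_mul, lintegral_add_left mone] at hy₂
  have h2 : ENNReal.ofReal |q y₂ - q y₁| + ∫⁻ x in Xp, ENNReal.ofReal |q x - q y₂| ≤
      K' * M := by
    refine hy₂.trans ?_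
    rw [hK', mul_assoc, add_mul]
    gcongr
    exact (lintegral_mono_set hZmX).trans h1
  refine ⟨q y₁, ?_⟩
  have h3 : ∫⁻ x in Xp, ENNReal.ofReal |q x - q y₁| ≤ K' * M + K' * ω * M := by
    calc ∫⁻ x in Xp, ENNReal.ofReal |q x - q y₁|
        ≤ ∫⁻ x in Xp, (ENNReal.ofReal |q x - q y₂| + ENNReal.ofReal |q y₂ - q y₁|) := by
          refine lintegral_mono fun x => ?_
          rw [← ENNReal.ofReal_add (abs_nonneg _) (abs_nonneg _)]
          exact ENNReal.ofReal_le_ofReal (abs_sub_le _ _ _)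
      _ = (∫⁻ x in Xp, ENNReal.ofReal |q x - q y₂|) +
          ENNReal.ofReal |q y₂ - q y₁| * volume Xp := by
          rw [lintegral_add_right _ measurable_const, setLIntegral_const]
      _ ≤ K' * M + K' * M * ω := by
          gcongr
          · exact le_add_self.trans h2
          · exact le_self_add.trans h2
          · exact measure_mono fun x hx => hx.1
      _ = _ := by ring
  calc ∫⁻ x in ball (0 : V) 1, ENNReal.ofReal |q x - q y₁|
      ≤ ∫⁻ x in (Xm ∪ Xp) ∪ {0}, ENNReal.ofReal |q x - q y₁| := lintegral_mono_set hcover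
    _ ≤ ((∫⁻ x in Xm, ENNReal.ofReal |q x - q y₁|) + ∫⁻ x in Xp, ENNReal.ofReal |q x - q y₁|) +
        ∫⁻ x in {(0 : V)}, ENNReal.ofReal |q x - q y₁| := by
        refine (lintegral_union_le _ _ _).trans ?_
        gcongr
        exact lintegral_union_le _ _ _
    _ ≤ (K * M + (K' * M + K' * ω * M)) + 0 := by
        gcongr
        rw [Measure.restrict_eq_zero.2 (measure_singleton _), lintegral_zero_measure]
    _ = _ := by ring

lemma volume_starSet_eq [Nontrivial V] {p : V → ℝ} (hp : Measurable p)
    (hphom : ∀ (s : ℝ) (x : V), 0 < s → p (s • x) = p x) (hp0 : ∀ x, 0 ≤ p x) :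
    volume.real (starSet p) = ∫ x in ball (0 : V) 1, p x := by
  have h1 := setLIntegral_starSet hp hphom (measurable_const (a := (1 : ENNReal)))
    (fun _ _ _ => rfl)
  have h2 := setLIntegral_starSet (V := V) (measurable_const (a := (1 : ℝ))) (fun _ _ _ => rfl)
    hp.ennreal_ofReal (fun s x hs => by rw [hphom s x hs])
  rw [← ball_eq_starSet] at h2
  rw [integral_eq_lintegral_of_nonneg_ae (ae_of_all _ hp0) hp.aestronglyMeasurable, h2,
    Measure.real, ← setLIntegral_one, h1]
  congr 1
  refine lintegral_congr fun θ => ?_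
  rw [one_mul, ← ENNReal.ofReal_mul (hp0 _), mul_one_div]

/-- A starshaped set whose mass along rays is almost constant is close to the ball. -/
lemma volume_starSet_sdiff_ball_le [Nontrivial V] {q : V → ℝ} (mq : Measurable q)
    (hq : ∀ (s : ℝ) (x : V), 0 < s → q (s • x) = q x) (hq0 : ∀ x, 0 ≤ q x) {L : ℝ}
    (hqL : ∀ x, q x ≤ L) (hv : volume (starSet q) = volume (ball (0 : V) 1)) {a m : ℝ}
    (hm : 0 ≤ m)
    (ha : ∫⁻ x in ball (0 : V) 1, ENNReal.ofReal |q x - a| ≤ ENNReal.ofReal m) :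
    volume.real (starSet q \ ball 0 1) ≤ 2 * m := by
  have fB : volume (ball (0 : V) 1) ≠ ⊤ := measure_ball_lt_top.ne
  set ω := volume.real (ball (0 : V) 1) with hω
  have iq : IntegrableOn q (ball (0 : V) 1) :=
    Measure.integrableOn_of_bounded (M := L) fB mq.aestronglyMeasurable
      (ae_of_all _ fun x => by rw [Real.norm_of_nonneg (hq0 x)]; exact hqL x)
  have ic : ∀ b : ℝ, IntegrableOn (fun _ : V => b) (ball (0 : V) 1) := fun b =>
    integrableOn_const fB
  have iqa : ∀ b : ℝ, IntegrableOn (fun x => |q x - b|) (ball (0 : V) 1) := fun b =>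
    (iq.sub (ic b)).abs
  have hI : ∫ x in ball (0 : V) 1, |q x - a| ≤ m := by
    rw [integral_eq_lintegral_of_nonneg_ae (ae_of_all _ fun _ => abs_nonneg _)
      (mq.sub_const a).abs.aestronglyMeasurable]
    exact ENNReal.toReal_le_of_le_ofReal hm ha
  have hqω : ∫ x in ball (0 : V) 1, q x = ω := by
    rw [← volume_starSet_eq mq hq hq0, Measure.real, hv]
    rfl
  have hconst : ∀ b : ℝ, ∫ x in ball (0 : V) 1, b = b * ω := fun b => by
    rw [setIntegral_const, smul_eq_mul, mul_comm]
  have h1 : |1 - a| * ω ≤ m := by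
    have h2 : (1 - a) * ω = ∫ x in ball (0 : V) 1, (q x - a) := by
      rw [integral_sub iq (ic a), hqω, hconst]
      ring
    rw [← abs_of_nonneg (show 0 ≤ ω from measureReal_nonneg), ← abs_mul, h2]
    exact abs_integral_le_integral_abs.trans hI
  have h3 : ∫ x in ball (0 : V) 1, |q x - 1| ≤ 2 * m := by
    calc ∫ x in ball (0 : V) 1, |q x - 1| ≤ ∫ x in ball (0 : V) 1, (|q x - a| + |1 - a|) := by
          refine integral_mono (iqa 1) ((iqa a).add (ic _)) fun x => ?_
          have := abs_sub_le (q x) a 1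
          rwa [abs_sub_comm a 1] at this
      _ ≤ 2 * m := by
          rw [integral_add (iqa a) (ic _), hconst]
          linarith
  set p : V → ℝ := fun x => max (q x) 1 with hp
  have mp : Measurable p := mq.max measurable_const
  have hps : starSet q ∪ ball 0 1 ⊆ starSet p := by
    rintro x (hx | hx)
    · exact lt_max_of_lt_left (show ‖x‖ ^ Module.finrank ℝ V < q x from hx)
    · rw [ball_eq_starSet] at hx
      exact lt_max_of_lt_right (show ‖x‖ ^ Module.finrank ℝ V < 1 from hx)
  have hpq : ∀ x, p x ≤ 1 + |q x - 1| := fun x =>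
    max_le (by linarith [le_abs_self (q x - 1)]) (by linarith [abs_nonneg (q x - 1)])
  have ip : IntegrableOn p (ball (0 : V) 1) := iq.sup (ic 1)
  have hvp := volume_starSet_eq mp (fun s x hs => by simp only [hp, hq s x hs])
    (fun x => zero_le_one.trans (le_max_right _ _))
  have h4 : ∫ x in ball (0 : V) 1, p x ≤ ω + 2 * m := by
    calc ∫ x in ball (0 : V) 1, p x ≤ ∫ x in ball (0 : V) 1, (1 + |q x - 1|) :=
          integral_mono ip ((ic 1).add (iqa 1)) hpq
      _ ≤ ω + 2 * m := by
          rw [integral_add (ic 1) (iqa 1), hconst]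
          linarith
  have fp : volume (starSet p) ≠ ⊤ := by
    have : starSet p ⊆ starSet q ∪ ball 0 1 := by
      intro x hx
      rcases lt_max_iff.1 (show ‖x‖ ^ Module.finrank ℝ V < max (q x) 1 from hx) with h | h
      · exact Or.inl h
      · right
        rw [ball_eq_starSet]
        exact h
    exact measure_ne_top_of_subset this (measure_union_ne_top (hv ▸ fB) fB)
  have h5 : volume.real (starSet q \ ball 0 1) ≤ volume.real (starSet p \ ball 0 1) :=
    measureReal_mono (Set.sdiff_subset_sdiff_left (Set.subset_union_left.trans hps))
      (measure_ne_top_of_subset Set.sdiff_subset fp)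
  have h6 := measureReal_sdiff_add_inter (μ := volume) (s := starSet p)
    (measurableSet_ball (x := (0 : V)) (ε := 1)) fp
  rw [Set.inter_eq_right.2 (Set.subset_union_right.trans hps)] at h6
  linarith

lemma exists_starSet_near_ball {l : ℝ} (hl : 0 < l) (hn : l + 1 < Module.finrank ℝ V)
    {C₀ : ℝ} (hC₀ : 0 < C₀) :
    ∃ C : ℝ, 0 < C ∧ ∀ E : Set V, MeasurableSet E → volume E = volume (ball (0 : V) 1) →
      E ⊆ ball 0 6 → ball 0 (1 / 2) ⊆ E → ∀ D : ℝ, D ≤ 1 →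
      cross (rk l) (ball (0 : V) 1) (ball 0 1) - cross (rk l) E E ≤ D →
      (∀ e : V, ‖e‖ = 1 → |∫ x in E, inner ℝ x e| ≤ C₀ * D) →
      volume.real (starSet (rayMass 6 E) \ ball 0 1) ≤ C * Real.sqrt D := by
  have : Nontrivial V := Module.nontrivial_of_finrank_pos (R := ℝ) (by
    have : (0 : ℝ) < Module.finrank ℝ V := by linarith
    exact_mod_cast this)
  obtain ⟨C₁, hC₁, H₁⟩ := exists_reflection_moment_le (V := V) hl hn hC₀
  obtain ⟨C₂, hC₂, H₂⟩ := exists_almost_const (V := V)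
  refine ⟨2 * (C₂.toReal * (4 * C₁)) + 1, by positivity,
    fun E hE hv hE6 hhalf D hD1 hD hmom => ?_⟩
  have hM : ∀ e : V, ‖e‖ = 1 → ∫⁻ x in ball (0 : V) 1,
      ENNReal.ofReal (|rayMass 6 E x - rayMass 6 E (refl e 0 x)| *
        |inner ℝ (‖x‖⁻¹ • x) e|) ≤ ENNReal.ofReal (4 * C₁ * Real.sqrt D) := by
    intro e he
    refine (lintegral_rayMass_refl_le he hE hhalf).trans ?_
    have h1 := lintegral_reflection_le he hE hE6
    have h2 := H₁ E hE hv hE6 D hD1 hD e he (hmom e he)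
    refine (mul_le_mul_right (h1.trans (ENNReal.ofReal_le_ofReal
      (mul_le_mul_of_nonneg_left h2 zero_le_two))) 2).trans (le_of_eq ?_)
    rw [← ENNReal.ofReal_ofNat 2, ← ENNReal.ofReal_mul zero_le_two]
    congr 1
    ring
  obtain ⟨a, ha⟩ := H₂ _ (measurable_rayMass hE) (fun s x hs => rayMass_smul hs x) _ hM
  rw [← ENNReal.ofReal_toReal hC₂, ← ENNReal.ofReal_mul ENNReal.toReal_nonneg] at ha
  refine (volume_starSet_sdiff_ball_le (measurable_rayMass hE)
    (fun s x hs => rayMass_smul hs x) (fun x => rayMass_nonneg x)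
    (fun x => rayMass_le (by norm_num) hE x) ((volume_starSet_rayMass hE hE6).trans hv)
    (by positivity) ha).trans ?_
  have := Real.sqrt_nonneg D
  linarith

lemma volume_real_ball_symmDiff_preimage_add (z : V) {E : Set V} (hE : MeasurableSet E) :
    volume.real (ball z 1 ∆ E) = volume.real (ball 0 1 ∆ ((fun x => x + z) ⁻¹' E)) := by
  have h : (fun x => x + z) ⁻¹' (ball z 1 ∆ E) = ball 0 1 ∆ ((fun x => x + z) ⁻¹' E) := by
    have : ball (0 : V) 1 = (fun x => x + z) ⁻¹' ball z 1 := by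
      ext x
      simp
    rw [this]
    rfl
  rw [← h, Measure.real, Measure.real, volume_preimage_add z (measurableSet_ball.symmDiff hE)]

/-- Sharp quantitative stability of balls for the Riesz energy with kernel `r ^ (-l)`. -/
theorem exists_ball_symmDiff_le {l : ℝ} (hl : 0 < l) (hn : l + 1 < Module.finrank ℝ V) :
    ∃ C : ℝ, 0 < C ∧ ∀ E : Set V, MeasurableSet E → volume E = volume (ball (0 : V) 1) →
      ∃ z : V, volume.real (ball z 1 ∆ E) ≤
        C * Real.sqrt (cross (rk l) (ball (0 : V) 1) (ball 0 1) - cross (rk l) E E) := by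
  have : Nontrivial V := Module.nontrivial_of_finrank_pos (R := ℝ) (by
    have : (0 : ℝ) < Module.finrank ℝ V := by linarith
    exact_mod_cast this)
  have hk := radialKernel_rk (V := V) hl.le (by linarith)
  obtain ⟨C₁, hC₁, H₁⟩ := exists_bounded_centered (V := V) hk (rk_three_lt_two hl)
  obtain ⟨C₃, hC₃, δ, hδ, H₃⟩ := exists_sorted (V := V) hl hn
  obtain ⟨C₂, hC₂, D₀, hD₀, H₂⟩ := exists_filled (V := V) hl hn hδ
  obtain ⟨C₄, hC₄, H₄⟩ := exists_starSet_near_ball (V := V) hl hn hC₂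
  have hω := volume_real_ball_pos (V := V)
  set ω := volume.real (ball (0 : V) 1) with hωd
  set m := min D₀ 1 with hm
  have hm0 : 0 < m := lt_min hD₀ one_pos
  refine ⟨(1 + C₂ + 2 * Real.sqrt C₃ + 2 * C₄) * Real.sqrt C₁ +
    2 * ω / Real.sqrt m * Real.sqrt C₁, by positivity, fun E hE hv => ?_⟩
  have fB : volume (ball (0 : V) 1) ≠ ⊤ := measure_ball_lt_top.ne
  have fE : volume E ≠ ⊤ := hv ▸ fB
  have hD := riesz hk hE hv
  set D := cross (rk l) (ball (0 : V) 1) (ball 0 1) - cross (rk l) E E with hDd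
  have hD' : 0 ≤ D := by linarith
  rw [add_mul, mul_assoc, mul_assoc, ← Real.sqrt_mul hC₁.le]
  set s := Real.sqrt (C₁ * D) with hs
  have hs0 : 0 ≤ s := Real.sqrt_nonneg _
  rcases le_or_gt m (C₁ * D) with hbig | hsmall
  · refine ⟨0, ?_⟩
    have h1 : volume.real (ball (0 : V) 1 ∆ E) ≤ 2 * ω := by
      rw [volume_real_symmDiff measurableSet_ball hE fB fE]
      have h2 : volume.real (ball (0 : V) 1 \ E) ≤ ω := measureReal_mono Set.sdiff_subset fB
      have h3 : volume.real (E \ ball 0 1) ≤ volume.real E :=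
        measureReal_mono Set.sdiff_subset fE
      rw [Measure.real, Measure.real, hv, ← Measure.real, ← Measure.real] at h3
      linarith
    have h2 : Real.sqrt m ≤ s := Real.sqrt_le_sqrt hbig
    have h3 : 2 * ω ≤ 2 * ω / Real.sqrt m * s := by
      have : 0 < Real.sqrt m := Real.sqrt_pos.2 hm0
      rw [div_mul_eq_mul_div, le_div_iff₀ this]
      exact mul_le_mul_of_nonneg_left h2 (by positivity)
    have h4 : 0 ≤ (1 + C₂ + 2 * Real.sqrt C₃ + 2 * C₄) * s := by positivity
    linarith
  · obtain ⟨z, E₁, mE₁, vE₁, hE₁, cE₁, dE₁, sE₁⟩ := H₁ E hE hv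
    refine ⟨z, ?_⟩
    rw [volume_real_ball_symmDiff_preimage_add z hE]
    set S := (fun x => x + z) ⁻¹' E with hS
    have mS : MeasurableSet S := (measurable_add_const z) hE
    have fS : volume S ≠ ⊤ := by rw [hS, volume_preimage_add z hE]; exact fE
    set D₁ := cross (rk l) (ball (0 : V) 1) (ball 0 1) - cross (rk l) E₁ E₁ with hD₁
    have hD₁0 : 0 ≤ D₁ := by linarith [riesz hk mE₁ vE₁]
    have hD₁m : D₁ < m := dE₁.trans_lt hsmall
    obtain ⟨E₂, mE₂, vE₂, hE₂, hhalf, hout, cE₂, sE₂, momE₂⟩ :=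
      H₂ E₁ mE₁ vE₁ hE₁ cE₁ (hD₁m.trans_le (min_le_left _ _))
    set T := starSet (rayMass 6 E₂) with hT
    have mT : MeasurableSet T := measurableSet_starSet (measurable_rayMass mE₂)
    have vT : volume T = volume (ball (0 : V) 1) := (volume_starSet_rayMass mE₂ hE₂).trans vE₂
    have fE₁ : volume E₁ ≠ ⊤ := vE₁ ▸ fB
    have fE₂ : volume E₂ ≠ ⊤ := vE₂ ▸ fB
    have fT : volume T ≠ ⊤ := vT ▸ fB
    have h3 := H₃ E₂ mE₂ vE₂ hE₂ hhalf hout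
    have h4 := H₄ E₂ mE₂ vE₂ hE₂ hhalf D₁ (hD₁m.le.trans (min_le_right _ _)) (by linarith) momE₂
    have hs1 : Real.sqrt D₁ ≤ s := Real.sqrt_le_sqrt dE₁
    have hs2 : C₁ * D ≤ s := by
      rw [hs, Real.le_sqrt (by positivity) (by positivity)]
      have : C₁ * D ≤ 1 := hsmall.le.trans (min_le_right _ _)
      have : 0 ≤ C₁ * D := by positivity
      nlinarith
    have hST : volume.real (E₂ \ T) ≤ Real.sqrt C₃ * s := by
      rw [hs, ← Real.sqrt_mul hC₃.le]
      refine Real.le_sqrt_of_sq_le (h3.trans (mul_le_mul_of_nonneg_left ?_ hC₃.le))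
      linarith
    have t1 := measureReal_symmDiff_le (μ := (volume : Measure V)) (s := ball 0 1) (t := T) S
      fB fT
    have t2 := measureReal_symmDiff_le (μ := (volume : Measure V)) (s := T) (t := E₂) S
      fT fE₂
    have t3 := measureReal_symmDiff_le (μ := (volume : Measure V)) (s := E₂) (t := E₁) S
      fE₂ fE₁
    rw [symmDiff_comm E₂ E₁, symmDiff_comm E₁ S] at t3
    rw [volume_real_symmDiff mT mE₂ fT fE₂,
      volume_real_sdiff_comm mT mE₂ (vT.trans vE₂.symm) fT] at t2
    rw [volume_real_symmDiff measurableSet_ball mT fB fT,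
      volume_real_sdiff_comm measurableSet_ball mT vT.symm fB] at t1
    have b1 : C₂ * D₁ ≤ C₂ * s := mul_le_mul_of_nonneg_left (dE₁.trans hs2) hC₂.le
    have b2 : C₄ * Real.sqrt D₁ ≤ C₄ * s := mul_le_mul_of_nonneg_left hs1 hC₄.le
    have b3 : 0 ≤ 2 * ω / Real.sqrt m * s := by positivity
    linarith

lemma rieszEnergy_eq_cross (N : ℕ) (α : ℝ) (E : Set (EuclideanSpace ℝ (Fin N))) :
    rieszEnergy N α E = cross (rk (N - α)) E E := by
  simp only [rieszEnergy, cross, pot, rk, abs_norm, neg_sub]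

end RieszStability

theorem sharp_stability_riesz (N : ℕ) (hN : 2 ≤ N) (α : ℝ) (hα₁ : 1 < α) (hα₂ : α < N) :
    ∃ C : ℝ, 0 < C ∧ ∀ E : Set (EuclideanSpace ℝ (Fin N)), MeasurableSet E →
      volume E = volume (ball (0 : EuclideanSpace ℝ (Fin N)) 1) →
      asymmetry N E ≤ C * Real.sqrt (deficit N α E) := by
  have hfr : Module.finrank ℝ (EuclideanSpace ℝ (Fin N)) = N := finrank_euclideanSpace_fin
  obtain ⟨C, hC, H⟩ := RieszStability.exists_ball_symmDiff_le (V := EuclideanSpace ℝ (Fin N))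
    (l := N - α) (by linarith) (by rw [hfr]; linarith)
  refine ⟨C, hC, fun E hE hv => ?_⟩
  obtain ⟨z, hz⟩ := H E hE hv
  rw [deficit, RieszStability.rieszEnergy_eq_cross, RieszStability.rieszEnergy_eq_cross]
  exact (ciInf_le ⟨0, by rintro _ ⟨x, rfl⟩; exact ENNReal.toReal_nonneg⟩ z).trans hz
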